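/- arXiv:math/0206169 — 5 statements merged into one kernel-verified Lean document; each statement's English description precedes it below -/
import Mathlib

section
/- For every n ≥ 1, the number of even involutions of length n avoiding the pattern 132 equals C(n−1, 2⌊(n+1)/4⌋), where C denotes the binomial coefficient. -/
open Finset

/-- The number of occurrences of the pattern `τ` (of length `k`) in the
permutation `π` (of length `n`): the number of strictly increasing index
sequences along which `π` is order-isomorphic to `τ`. -/
def occ {k n : ℕ} (τ : Equiv.Perm (Fin k)) (π : Equiv.Perm (Fin n)) : ℕ :=
  (Finset.univ.filter (fun f : Fin k → Fin n =>
    (∀ a b : Fin k, a < b → f a < f b) ∧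
    (∀ a b : Fin k, τ a < τ b ↔ π (f a) < π (f b)))).card

/-- The number of inversions of a permutation: pairs `i < j` with `π i > π j`. -/
def inversions {n : ℕ} (π : Equiv.Perm (Fin n)) : ℕ :=
  (Finset.univ.filter (fun p : Fin n × Fin n => p.1 < p.2 ∧ π p.2 < π p.1)).card

/-- The number of fixed points of a permutation. -/
def fixedPointCount {n : ℕ} (π : Equiv.Perm (Fin n)) : ℕ :=
  (Finset.univ.filter (fun j : Fin n => π j = j)).card

/-- The pattern `132` as a permutation of `Fin 3` (zero-indexed values `0,2,1`). -/
def p132 : Equiv.Perm (Fin 3) := Equiv.swap 1 2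


namespace EI

variable {n : ℕ}

/-- `π` is an involution supported in `A`, avoiding 132 on `A`. -/
def P (A : Finset (Fin n)) (π : Equiv.Perm (Fin n)) : Prop :=
  (∀ x, π (π x) = x) ∧ (∀ x, x ∉ A → π x = x) ∧
  (∀ i j k, i ∈ A → j ∈ A → k ∈ A → i < j → j < k → π i < π k → π k < π j → False)

/-- excedance set -/
def exc (π : Equiv.Perm (Fin n)) : Finset (Fin n) := univ.filter (fun x => x < π x)

open Classical in
noncomputable def G (A : Finset (Fin n)) (d : ℕ) : ℕ :=
  (univ.filter (fun π : Equiv.Perm (Fin n) => P A π ∧ (exc π).card = d)).card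

lemma P.mem {A : Finset (Fin n)} {π : Equiv.Perm (Fin n)} (h : P A π) {x : Fin n} (hx : x ∈ A) :
    π x ∈ A := by
  by_contra hc
  have h1 := h.2.1 _ hc
  rw [h.1] at h1
  exact hc (h1 ▸ hx)

lemma P.exc_sub {A : Finset (Fin n)} {π : Equiv.Perm (Fin n)} (h : P A π) {x : Fin n}
    (hx : x < π x) : x ∈ A := by
  by_contra hc
  have h1 := h.2.1 _ hc
  omega

lemma P.lower {A : Finset (Fin n)} {π : Equiv.Perm (Fin n)} (h : P A π) {x y : Fin n}
    (hx : x ∈ A) (hxy : x < y) (hy : y < π y) : x < π x := by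
  by_contra hc
  push Not at hc
  have hyA := h.exc_sub hy
  refine h.2.2 x y (π y) hx hyA (h.mem hyA) hxy hy ?_ ?_
  · rw [h.1]; omega
  · rw [h.1]; exact hy

/-- If `a` has rank `d` in `A`, excedances are exactly the elements below `a`. -/
lemma P.exc_iff {A : Finset (Fin n)} {π : Equiv.Perm (Fin n)} (h : P A π) {a : Fin n} {d : ℕ}
    (ha : (A.filter (· < a)).card = d) (hd : (exc π).card = d) (x : Fin n) :
    x < π x ↔ (x ∈ A ∧ x < a) := by
  have key : exc π = A.filter (· < a) := by
    by_cases hs : exc π ⊆ A.filter (· < a)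
    · exact Finset.eq_of_subset_of_card_le hs (by omega)
    · symm
      apply Finset.eq_of_subset_of_card_le _ (by omega)
      rw [Finset.not_subset] at hs
      obtain ⟨y, hy, hy2⟩ := hs
      simp only [exc, mem_filter, mem_univ, true_and] at hy
      have hyA := h.exc_sub hy
      have : a ≤ y := by
        by_contra hc
        exact hy2 (by simp [hyA]; omega)
      intro z hz
      simp only [mem_filter] at hz
      simp only [exc, mem_filter, mem_univ, true_and]
      exact h.lower hz.1 (by omega) hy
  have := congrArg (x ∈ ·) key
  simpa [exc] using this

lemma P.card {A : Finset (Fin n)} {π : Equiv.Perm (Fin n)} (h : P A π) :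
    A.card = 2 * (exc π).card + (A.filter (fun x => π x = x)).card := by
  have h1 : (A.filter (fun x => π x < x)).card = (exc π).card := by
    apply Finset.card_bij (fun x _ => π x)
    · intro x hx
      simp only [mem_filter] at hx
      simp [exc, h.1, hx.2]
    · intro x _ y _ hxy
      exact π.injective hxy
    · intro y hy
      simp only [exc, mem_filter, mem_univ, true_and] at hy
      exact ⟨π y, by simp [h.1, hy, h.mem (h.exc_sub hy)], h.1 y⟩
  have h2 : exc π = A.filter (fun x => x < π x) := by
    ext x
    simp only [exc, mem_filter, mem_univ, true_and]
    exact ⟨fun hx => ⟨h.exc_sub hx, hx⟩, fun hx => hx.2⟩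
  have h3 := Finset.card_filter_add_card_filter_not (s := A) (fun x => π x = x)
  have h4 := Finset.card_filter_add_card_filter_not (s := A.filter (fun x => ¬ π x = x))
    (fun x => x < π x)
  rw [Finset.filter_filter, Finset.filter_filter] at h4
  have h5 : A.filter (fun x => ¬ π x = x ∧ x < π x) = exc π := by
    rw [h2]; ext x; simp; intro _ _; omega
  have h6 : A.filter (fun x => ¬ π x = x ∧ ¬ x < π x) = A.filter (fun x => π x < x) := by
    ext x; simp; intro _; omega
  rw [h5, h6] at h4
  omega

lemma exists_rank (A : Finset (Fin n)) (d : ℕ) (hd : d < A.card) :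
    ∃ a ∈ A, (A.filter (· < a)).card = d := by
  refine ⟨A.orderEmbOfFin rfl ⟨d, hd⟩, by simp, ?_⟩
  have : A.filter (· < A.orderEmbOfFin rfl ⟨d, hd⟩) =
      (Finset.Iio (⟨d, hd⟩ : Fin A.card)).map (A.orderEmbOfFin rfl).toEmbedding := by
    ext x
    simp only [mem_filter, mem_map, mem_Iio]
    constructor
    · rintro ⟨hx, hlt⟩
      have : x ∈ Set.range (A.orderEmbOfFin rfl) := by simpa using hx
      obtain ⟨y, rfl⟩ := this
      exact ⟨y, by simpa using hlt, rfl⟩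
    · rintro ⟨y, hy, rfl⟩
      simpa using hy
  rw [this]; simp

/-- Removing a fixed point of rank `d`. -/
lemma stepA (A : Finset (Fin n)) (d : ℕ) (a : Fin n) (haA : a ∈ A)
    (ha : (A.filter (· < a)).card = d) (π : Equiv.Perm (Fin n)) :
    (P A π ∧ (exc π).card = d) ∧ π a = a ↔ P (A.erase a) π ∧ (exc π).card = d := by
  constructor
  · rintro ⟨⟨h, hd⟩, hfix⟩
    refine ⟨⟨h.1, ?_, ?_⟩, hd⟩
    · intro x hx
      by_cases hxa : x = a
      · rw [hxa, hfix]
      · exact h.2.1 x (by simpa [hxa] using hx)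
    · intro i j k hi hj hk
      exact h.2.2 i j k (mem_of_mem_erase hi) (mem_of_mem_erase hj) (mem_of_mem_erase hk)
  · rintro ⟨h, hd⟩
    have ha' : ((A.erase a).filter (· < a)).card = d := by
      rw [← ha]; congr 1; ext x; simp only [mem_filter, mem_erase]
      constructor
      · intro h2; exact ⟨h2.1.2, h2.2⟩
      · intro h2; exact ⟨⟨by omega, h2.1⟩, h2.2⟩
    have hE := h.exc_iff ha' hd
    have hfix : π a = a := h.2.1 a (by simp)
    have hinv := h.1
    have hmem : ∀ x, x ∈ A → x ≠ a → π x ∈ A ∧ π x ≠ a := by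
      intro x hx hxa
      have := h.mem (x := x) (by simp [hx, hxa])
      simp at this; tauto
    have hE' : ∀ x, x ∈ A → x < a → x < π x := fun x hx hxa => (hE x).2 ⟨by simp [hx]; omega, hxa⟩
    have hE2 : ∀ x, a ≤ x → ¬ x < π x := fun x hxa hc => by have := (hE x).1 hc; omega
    -- below `a` maps above `a`
    have hup : ∀ x, x ∈ A → x < a → a < π x := by
      intro x hx hxa
      by_contra hc
      have h1 := hmem x hx (by omega)
      have h2 := hE' _ h1.1 (by omega)
      rw [hinv] at h2
      have := hE' x hx hxa
      omega
    have hdown : ∀ x, x ∈ A → a < x → a < π x → π x = x := by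
      intro x hx hxa hc
      have h1 := hE2 x hxa.le
      have h2 := hE2 (π x) hc.le
      rw [hinv] at h2
      omega
    refine ⟨⟨⟨hinv, ?_, ?_⟩, hd⟩, hfix⟩
    · intro x hx
      exact h.2.1 x (by simp [hx])
    · intro i j k hi hj hk hij hjk h1 h2
      by_cases hia : i = a
      · subst hia
        have := hdown j hj hij (by omega)
        have := hdown k hk (by omega) (by omega)
        omega
      by_cases hja : j = a
      · subst hja
        have := hup i hi hij
        omega
      by_cases hka : k = a
      · subst hka
        have := hup i hi (by omega)
        omega
      exact h.2.2 i j k (by simp [*]) (by simp [*]) (by simp [*]) hij hjk h1 h2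

lemma swap_apply {π : Equiv.Perm (Fin n)} {a p : Fin n} (x : Fin n) :
    (π * Equiv.swap a p) x = if x = a then π p else if x = p then π a else π x := by
  rw [Equiv.Perm.mul_apply, Equiv.swap_apply_def]
  split_ifs <;> rfl

/-- Forward map of the second step. -/
lemma stepB_fwd (A : Finset (Fin n)) (d : ℕ) (a b : Fin n) (haA : a ∈ A) (hbA : b ∈ A)
    (ha : (A.filter (· < a)).card = d) (hb : (A.filter (· < b)).card = d + 1)
    (hab : a < b) (hcov : ∀ x ∈ A, x < b → x ≤ a)
    (π : Equiv.Perm (Fin n)) (h : P A π) (hd : (exc π).card = d + 1) (hne : π b ≠ b) :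
    P (A.erase a) (π * Equiv.swap a (π a)) ∧ (exc (π * Equiv.swap a (π a))).card = d ∧
    π a ∈ A.erase a ∧
    ∀ q ∈ A.erase a, (π * Equiv.swap a (π a)) q = q → π a ≤ q := by
  have hE := h.exc_iff hb hd
  have hinv := h.1
  have hap : a < π a := (hE a).2 ⟨haA, hab⟩
  have hpA : π a ∈ A := h.mem haA
  obtain ⟨p, hp⟩ : ∃ p, p = π a := ⟨_, rfl⟩
  rw [← hp] at hap hpA ⊢
  have hpp : π p = a := by rw [hp, hinv]
  obtain ⟨σ, hσ⟩ : ∃ σ, σ = π * Equiv.swap a p := ⟨_, rfl⟩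
  have hval : ∀ x, σ x = if x = a then a else if x = p then p else π x := by
    intro x; rw [hσ, swap_apply, hpp, ← hp]
  rw [← hσ]
  have hσa : σ a = a := by rw [hval]; simp
  have hσp : σ p = p := by
    rw [hval, if_neg (by omega), if_pos rfl]
  have hσx : ∀ x, x ≠ a → x ≠ p → σ x = π x := by
    intro x h1 h2; rw [hval]; simp [h1, h2]
  have hpe : p ∈ A.erase a := by simp [hpA]; omega
  have hE' : ∀ x, x ∈ A → x ≤ a → x < π x := fun x hx hxa => (hE x).2 ⟨hx, by omega⟩
  have hE2 : ∀ x, a < x → ¬ x < π x := fun x hxa hc => by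
    have := (hE x).1 hc; have := hcov x this.1 this.2; omega
  have hup : ∀ x, x ∈ A → x ≤ a → a < π x := by
    intro x hx hxa
    by_contra hc
    have h2 := hE' _ (h.mem hx) (by omega)
    rw [hinv] at h2
    have := hE' x hx hxa
    omega
  have hdown : ∀ x, x ∈ A → a < x → a < π x → π x = x := by
    intro x hx hxa hc
    have h1 := hE2 x hxa
    have h2 := hE2 (π x) hc
    rw [hinv] at h2
    omega
  refine ⟨⟨?_, ?_, ?_⟩, ?_, hpe, ?_⟩
  · intro x
    by_cases h1 : x = a
    · rw [h1, hσa, hσa]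
    by_cases h2 : x = p
    · rw [h2, hσp, hσp]
    rw [hσx x h1 h2, hσx _ _ _, hinv]
    · intro h3; apply h2; rw [hp, ← h3, hinv]
    · intro h3; apply h1; rw [← hpp, ← h3, hinv]
  · intro x hx
    by_cases h1 : x = a
    · rw [h1, hσa]
    · have hxA : x ∉ A := by simpa [h1] using hx
      rw [hσx x h1 (by rintro rfl; exact hxA hpA)]
      exact h.2.1 x hxA
  · intro i j k hi hj hk hij hjk h1 h2
    simp only [mem_erase] at hi hj hk
    obtain ⟨hia, hi⟩ := hi
    obtain ⟨hja, hj⟩ := hj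
    obtain ⟨hka, hk⟩ := hk
    by_cases hip : i = p
    · subst hip
      rw [hσp] at h1
      rw [hσx k hka (by omega)] at h1 h2
      rw [hσx j hja (by omega)] at h2
      have := hdown j hj (by omega) (by omega)
      have := hdown k hk (by omega) (by omega)
      omega
    by_cases hjp : j = p
    · subst hjp
      rw [hσp] at h2
      rw [hσx k hka (by omega)] at h1 h2
      rw [hσx i hia (by omega)] at h1
      have hkc : π k < a := by
        by_contra hc
        have : π k ≠ a := by intro h3; have := hinv k; rw [h3] at this; omega
        have := hdown k hk (by omega) (by omega)
        omega
      have hi2 : a < i := by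
        by_contra hc
        have := hup i hi (by omega)
        omega
      refine h.2.2 (π i) (π k) a (h.mem hi) (h.mem hk) haA h1 hkc ?_ ?_
      · rw [hinv, ← hp]; exact hij
      · rw [hinv, ← hp]; exact hjk
    by_cases hkp : k = p
    · subst hkp
      rw [hσp] at h1 h2
      rw [hσx j hja (by omega)] at h2
      rw [hσx i hia (by omega)] at h1
      have hj2 : j < a := by
        by_contra hc
        have := hE2 j (by omega)
        omega
      exact h.2.2 i j a hi hj haA hij hj2 (by rw [← hp]; exact h1) (by rw [← hp]; exact h2)
    rw [hσx i hia hip, hσx k hka hkp] at h1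
    rw [hσx j hja hjp, hσx k hka hkp] at h2
    exact h.2.2 i j k hi hj hk hij hjk h1 h2
  · have : exc σ = (exc π).erase a := by
      ext x
      simp only [exc, mem_filter, mem_univ, true_and, mem_erase]
      by_cases h1 : x = a
      · subst h1; simp [hσa]
      by_cases h2 : x = p
      · subst h2; simp [hσp, hpp]; omega
      rw [hσx x h1 h2]; tauto
    rw [this, Finset.card_erase_of_mem, hd]
    · rfl
    · simp only [exc, mem_filter, mem_univ, true_and]; omega
  · intro q hq hqf
    by_contra hlt
    simp only [mem_erase] at hq
    rw [hσx q hq.1 (by omega)] at hqf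
    have hqa : a < q := by
      by_contra hc
      have := hE' q hq.2 (by omega)
      omega
    have hqb : b < q := by
      by_contra hc
      have h3 : q = b ∨ q < b := by omega
      rcases h3 with h3 | h3
      · exact hne (h3 ▸ hqf)
      · have := hcov q hq.2 h3; omega
    have hib : π b ≤ a := by
      by_contra hc
      exact hne (hdown b hbA hab (by omega))
    have hib2 : π b ≠ a := by
      intro h3; have h4 := hinv b; rw [h3] at h4; omega
    refine h.2.2 (π b) a q (h.mem hbA) haA hq.2 (by omega) hqa ?_ ?_
    · rw [hinv, hqf]; exact hqb
    · rw [hqf, ← hp]; omega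

/-- Backward map of the second step. -/
lemma stepB_bwd (A : Finset (Fin n)) (d : ℕ) (a b : Fin n) (haA : a ∈ A) (hbA : b ∈ A)
    (ha : (A.filter (· < a)).card = d)
    (hab : a < b) (hcov : ∀ x ∈ A, x < b → x ≤ a)
    (σ : Equiv.Perm (Fin n)) (h : P (A.erase a) σ) (hd : (exc σ).card = d)
    (p : Fin n) (hp : p ∈ A.erase a) (hpf : σ p = p)
    (hmin : ∀ q ∈ A.erase a, σ q = q → p ≤ q) :
    P A (σ * Equiv.swap a p) ∧ (exc (σ * Equiv.swap a p)).card = d + 1 ∧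
    (σ * Equiv.swap a p) b ≠ b ∧ (σ * Equiv.swap a p) a = p := by
  have ha' : ((A.erase a).filter (· < a)).card = d := by
    rw [← ha]; congr 1; ext x; simp only [mem_filter, mem_erase]
    constructor
    · intro h2; exact ⟨h2.1.2, h2.2⟩
    · intro h2; exact ⟨⟨by omega, h2.1⟩, h2.2⟩
  have hE := h.exc_iff ha' hd
  have hinv := h.1
  have hfa : σ a = a := h.2.1 a (by simp)
  have hmem : ∀ x, x ∈ A → x ≠ a → σ x ∈ A ∧ σ x ≠ a := by
    intro x hx hxa
    have := h.mem (x := x) (by simp [hx, hxa])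
    simp at this; tauto
  have hE' : ∀ x, x ∈ A → x < a → x < σ x := fun x hx hxa => (hE x).2 ⟨by simp [hx]; omega, hxa⟩
  have hE2 : ∀ x, a ≤ x → ¬ x < σ x := fun x hxa hc => by have := (hE x).1 hc; omega
  have hup : ∀ x, x ∈ A → x < a → a < σ x := by
    intro x hx hxa
    by_contra hc
    have h1 := hmem x hx (by omega)
    have h2 := hE' _ h1.1 (by omega)
    rw [hinv] at h2
    have := hE' x hx hxa
    omega
  have hdown : ∀ x, x ∈ A → a < x → a < σ x → σ x = x ∧ p ≤ x := by
    intro x hx hxa hc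
    have h1 := hE2 x hxa.le
    have h2 := hE2 (σ x) hc.le
    rw [hinv] at h2
    have h3 : σ x = x := by omega
    exact ⟨h3, hmin x (by simp [hx]; omega) h3⟩
  simp only [mem_erase] at hp
  obtain ⟨hpa, hpA⟩ := hp
  have hap : a < p := by
    by_contra hc
    have := hE' p hpA (by omega)
    omega
  obtain ⟨π, hπ⟩ : ∃ π, π = σ * Equiv.swap a p := ⟨_, rfl⟩
  have hval : ∀ x, π x = if x = a then p else if x = p then a else σ x := by
    intro x; rw [hπ, swap_apply, hpf, hfa]
  rw [← hπ]
  have hπa : π a = p := by rw [hval]; simp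
  have hπp : π p = a := by rw [hval]; simp [hpa]
  have hπx : ∀ x, x ≠ a → x ≠ p → π x = σ x := by
    intro x h1 h2; rw [hval]; simp [h1, h2]
  refine ⟨⟨?_, ?_, ?_⟩, ?_, ?_, hπa⟩
  · intro x
    by_cases h1 : x = a
    · rw [h1, hπa, hπp]
    by_cases h2 : x = p
    · rw [h2, hπp, hπa]
    rw [hπx x h1 h2, hπx _ _ _, hinv]
    · intro h3; apply h1; rw [← hfa, ← h3, hinv]
    · intro h3; apply h2; rw [← hpf, ← h3, hinv]
  · intro x hx
    rw [hπx x (by rintro rfl; exact hx haA) (by rintro rfl; exact hx hpA)]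
    exact h.2.1 x (by simp [hx])
  · intro i j k hi hj hk hij hjk h1 h2
    by_cases hia : i = a
    · subst hia
      rw [hπa] at h1
      have hkp : k ≠ p := by rintro rfl; omega
      have hjp : j ≠ p := by rintro rfl; omega
      rw [hπx k (by omega) hkp] at h1 h2
      rw [hπx j (by omega) hjp] at h2
      have := hdown j hj (by omega) (by omega)
      have := hdown k hk (by omega) (by omega)
      omega
    by_cases hja : j = a
    · subst hja
      rw [hπa] at h2
      rw [hπx i hia (by omega)] at h1
      have := hup i hi hij
      have hkp : k ≠ p := by rintro rfl; omega
      rw [hπx k (by omega) hkp] at h1 h2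
      have := hdown k hk (by omega) (by omega)
      omega
    by_cases hka : k = a
    · subst hka
      rw [hπa] at h1 h2
      rw [hπx i hia (by omega)] at h1
      rw [hπx j hja (by omega)] at h2
      exact h.2.2 i j p (by simp [*]) (by simp [*]) (by simp [*]) hij (by omega)
        (by omega) (by omega)
    by_cases hip : i = p
    · subst hip
      rw [hπp] at h1
      rw [hπx k hka (by omega)] at h1 h2
      rw [hπx j hja (by omega)] at h2
      have := hdown j hj (by omega) (by omega)
      have := hdown k hk (by omega) (by omega)
      omega
    by_cases hjp : j = p
    · subst hjp
      rw [hπp] at h2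
      rw [hπx k hka (by omega)] at h1 h2
      rw [hπx i hia (by omega)] at h1
      exact h.2.2 i j k (by simp [*]) (by simp [*]) (by simp [*]) hij hjk h1 (by omega)
    by_cases hkp : k = p
    · subst hkp
      rw [hπp] at h1 h2
      rw [hπx i hia (by omega)] at h1
      rw [hπx j hja (by omega)] at h2
      by_cases hj2 : j < a
      · have := hup i hi (by omega)
        omega
      · have := hdown j hj (by omega) (by omega)
        omega
    rw [hπx i hia hip, hπx k hka hkp] at h1
    rw [hπx j hja hjp, hπx k hka hkp] at h2
    exact h.2.2 i j k (by simp [*]) (by simp [*]) (by simp [*]) hij hjk h1 h2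
  · have : exc π = insert a (exc σ) := by
      ext x
      simp only [exc, mem_filter, mem_univ, true_and, mem_insert]
      by_cases h1 : x = a
      · subst h1; simp [hπa, hap]
      by_cases h2 : x = p
      · subst h2; simp [hpf, hπp]; omega
      rw [hπx x h1 h2]; tauto
    rw [this, Finset.card_insert_of_notMem, hd]
    simp [exc, hfa]
  · intro hc
    by_cases h1 : b = p
    · rw [h1, hπp] at hc; omega
    · rw [hπx b (by omega) h1] at hc
      have := hmin b (by simp [hbA]; omega) hc
      have := hcov p hpA (by omega)
      omega

lemma G_succ (A : Finset (Fin n)) (d : ℕ) (hA : 2 * (d + 1) ≤ A.card) :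
    ∃ a ∈ A, ∃ b ∈ A, G A (d + 1) = G (A.erase b) (d + 1) + G (A.erase a) d := by
  classical
  obtain ⟨a, haA, ha⟩ := exists_rank A d (by omega)
  obtain ⟨b, hbA, hb⟩ := exists_rank A (d + 1) (by omega)
  have hab : a < b := by
    by_contra hc
    have : A.filter (· < b) ⊆ A.filter (· < a) := by
      intro x; simp only [mem_filter]; rintro ⟨h1, h2⟩; exact ⟨h1, by omega⟩
    have := Finset.card_le_card this
    omega
  have hcov : ∀ x ∈ A, x < b → x ≤ a := by
    intro x hx hxb
    have h1 : insert a (A.filter (· < a)) = A.filter (· < b) := by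
      apply Finset.eq_of_subset_of_card_le
      · intro y; simp only [mem_insert, mem_filter]
        rintro (rfl | ⟨h1, h2⟩)
        · exact ⟨haA, hab⟩
        · exact ⟨h1, by omega⟩
      · rw [Finset.card_insert_of_notMem (by simp)]; omega
    have : x ∈ insert a (A.filter (· < a)) := by rw [h1]; simp [hx, hxb]
    simp only [mem_insert, mem_filter] at this
    omega
  refine ⟨a, haA, b, hbA, ?_⟩
  unfold G
  rw [← Finset.card_filter_add_card_filter_not (fun π : Equiv.Perm (Fin n) => π b = b)]
  congr 1
  · congr 1
    ext π
    simp only [mem_filter, mem_univ, true_and]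
    exact stepA A (d + 1) b hbA hb π
  · apply Finset.card_bij (fun π _ => π * Equiv.swap a (π a))
    · intro π hπ
      simp only [mem_filter, mem_univ, true_and] at hπ ⊢
      have := stepB_fwd A d a b haA hbA ha hb hab hcov π hπ.1.1 hπ.1.2 hπ.2
      exact ⟨this.1, this.2.1⟩
    · intro π₁ h1 π₂ h2 heq
      simp only [mem_filter, mem_univ, true_and] at h1 h2
      have k1 := stepB_fwd A d a b haA hbA ha hb hab hcov π₁ h1.1.1 h1.1.2 h1.2
      have k2 := stepB_fwd A d a b haA hbA ha hb hab hcov π₂ h2.1.1 h2.1.2 h2.2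
      have f1 : (π₁ * Equiv.swap a (π₁ a)) (π₁ a) = π₁ a := by simp
      have f2 : (π₂ * Equiv.swap a (π₂ a)) (π₂ a) = π₂ a := by simp
      have e1 := k1.2.2.2 (π₂ a) k2.2.2.1 (by rw [heq, f2])
      have e2 := k2.2.2.2 (π₁ a) k1.2.2.1 (by rw [← heq, f1])
      have e : π₁ a = π₂ a := le_antisymm e1 e2
      rw [e] at heq
      exact mul_right_cancel heq
    · intro σ hσ
      simp only [mem_filter, mem_univ, true_and] at hσ
      have hc := hσ.1.card
      rw [Finset.card_erase_of_mem haA] at hc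
      have hne : ((A.erase a).filter (fun x => σ x = x)).Nonempty := by
        rw [← Finset.card_pos]; omega
      obtain ⟨p, hp, hpm⟩ := Finset.exists_min_image _ id hne
      rw [mem_filter] at hp
      have := stepB_bwd A d a b haA hbA ha hab hcov σ hσ.1 hσ.2 p hp.1 hp.2 (by
        intro q hq hqf
        exact hpm q (by rw [mem_filter]; exact ⟨hq, hqf⟩))
      refine ⟨σ * Equiv.swap a p, ?_, ?_⟩
      · simp only [mem_filter, mem_univ, true_and]
        exact ⟨⟨this.1, this.2.1⟩, this.2.2.1⟩
      · simp only [this.2.2.2]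
        rw [mul_assoc, Equiv.swap_mul_self, mul_one]

lemma G_zero (A : Finset (Fin n)) : G A 0 = 1 := by
  unfold G
  rw [Finset.card_eq_one]
  refine ⟨1, ?_⟩
  ext π
  simp only [mem_filter, mem_univ, true_and, mem_singleton]
  constructor
  · rintro ⟨h, h0⟩
    rw [Finset.card_eq_zero] at h0
    have hx : ∀ x, ¬ x < π x := by
      intro x hx
      have : x ∈ exc π := by simp [exc, hx]
      rw [h0] at this; simp at this
    ext x
    have h1 := hx x
    have h2 := hx (π x)
    rw [h.1] at h2
    simp; omega
  · rintro rfl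
    refine ⟨⟨by simp, by simp, ?_⟩, by simp [exc]⟩
    intro i j k _ _ _ _ h2 _ h4
    simp at h4; omega

lemma G_big (A : Finset (Fin n)) (d : ℕ) (h : A.card < 2 * d) : G A d = 0 := by
  unfold G
  rw [Finset.card_eq_zero]
  classical
  apply Finset.filter_eq_empty_iff.2
  rintro π _ ⟨h1, h2⟩
  have := h1.card
  omega

lemma G_formula (m : ℕ) : ∀ (d : ℕ) (A : Finset (Fin n)), A.card = m → 2 * (d + 1) ≤ m + 1 →
    G A (d + 1) + m.choose d = m.choose (d + 1) := by
  induction m with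
  | zero => intro d A _ h; omega
  | succ m ih =>
    intro d A hA h
    by_cases h2 : 2 * (d + 1) = m + 2
    · rw [G_big A (d + 1) (by omega), zero_add]
      apply Nat.choose_symm_of_eq_add; omega
    · obtain ⟨a, ha, b, hb, hG⟩ := G_succ A d (by omega)
      have h1 := ih d (A.erase b) (by rw [Finset.card_erase_of_mem hb]; omega) (by omega)
      rw [hG, Nat.choose_succ_succ' m d]
      rcases d with _ | d
      · rw [G_zero]; simp at h1 ⊢; omega
      · have h3 := ih d (A.erase a) (by rw [Finset.card_erase_of_mem ha]; omega) (by omega)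
        rw [Nat.choose_succ_succ' m d]; omega

lemma inv_sign (π : Equiv.Perm (Fin n)) :
    Equiv.Perm.sign π = (-1) ^ inversions π := by
  rw [Equiv.Perm.sign_eq_prod_prod_Ioi]
  have h1 : ∀ i : Fin n, ∏ j ∈ Finset.Ioi i, (if π i < π j then (1 : ℤˣ) else -1) =
      ∏ j : Fin n, (if i < j ∧ π j < π i then (-1 : ℤˣ) else 1) := by
    intro i
    rw [← Finset.filter_lt_eq_Ioi, Finset.prod_filter]
    apply Finset.prod_congr rfl
    intro j _
    by_cases h : i < j
    · have : π i ≠ π j := fun hc => by have := π.injective hc; omega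
      by_cases h2 : π i < π j
      · rw [if_pos h, if_pos h2, if_neg (by omega)]
      · rw [if_pos h, if_neg h2, if_pos ⟨h, by omega⟩]
    · rw [if_neg h, if_neg (by tauto)]
  rw [Finset.prod_congr rfl (fun i _ => h1 i), ← Fintype.prod_prod_type',
    ← Finset.prod_filter, Finset.prod_const]
  rfl

lemma parity (π : Equiv.Perm (Fin n)) (h : P univ π) :
    Even (inversions π) ↔ Even (exc π).card := by
  have h1 : π ^ 2 = 1 := by
    ext x; simp [pow_two, h.1]
  have h2 := Equiv.Perm.sign_of_pow_two_eq_one h1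
  have h3 : Fintype.card (Function.fixedPoints π) =
      (univ.filter (fun x => π x = x)).card := by
    rw [Fintype.card_subtype]; rfl
  have h4 := h.card
  rw [Finset.card_univ] at h4
  rw [h3, h4, Nat.add_sub_cancel, Nat.mul_div_cancel_left _ (by norm_num), inv_sign] at h2
  have hn : (-1 : ℤˣ) ≠ 1 := by decide
  rw [← neg_one_pow_eq_one_iff_even hn, h2, neg_one_pow_eq_one_iff_even hn]

lemma sum_even (n : ℕ) (q : ℕ) (hq : 4 * q ≤ n + 1) :
    ∑ j ∈ range (q + 1), G (univ : Finset (Fin (n + 1))) (2 * j) = n.choose (2 * q) := by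
  induction q with
  | zero => simp [G_zero]
  | succ q ih =>
    rw [Finset.sum_range_succ, ih (by omega)]
    have := G_formula (n + 1) (2 * q + 1) (univ : Finset (Fin (n + 1))) (by simp) (by omega)
    rw [Nat.choose_succ_succ' n (2 * q + 1), Nat.choose_succ_succ' n (2 * q)] at this
    rw [show 2 * (q + 1) = 2 * q + 1 + 1 by ring]
    omega

lemma occ_iff (π : Equiv.Perm (Fin n)) : occ p132 π = 0 ↔
    ∀ i j k, i < j → j < k → π i < π k → π k < π j → False := by
  have e0 : p132 0 = 0 := by decide
  have e1 : p132 1 = 2 := by decide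
  have e2 : p132 2 = 1 := by decide
  unfold occ
  rw [Finset.card_eq_zero, Finset.filter_eq_empty_iff]
  constructor
  · intro h i j k hij hjk h1 h2
    refine @h ![i, j, k] (mem_univ _) ⟨?_, ?_⟩
    · simp [Fin.forall_fin_succ]
      omega
    · intro a b
      fin_cases a <;> fin_cases b <;> simp [e0, e1, e2] <;> omega
  · rintro h f _ ⟨h1, h2⟩
    refine h (f 0) (f 1) (f 2) (h1 0 1 (by decide)) (h1 1 2 (by decide)) ?_ ?_
    · rw [← h2, e0, e2]; decide
    · rw [← h2, e1, e2]; decide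

end EI

theorem even_involutions_avoiding_132 (n : ℕ) (hn : 1 ≤ n) :
    (Finset.univ.filter (fun π : Equiv.Perm (Fin n) =>
      (∀ i, π (π i) = i) ∧ occ p132 π = 0 ∧ Even (inversions π))).card
      = Nat.choose (n - 1) (2 * ((n + 1) / 4)) := by
  classical
  obtain ⟨m, rfl⟩ : ∃ m, n = m + 1 := ⟨n - 1, by omega⟩
  have h1 : (m + 1 - 1).choose (2 * ((m + 1 + 1) / 4)) = m.choose (2 * ((m + 1) / 4)) := by
    rw [Nat.add_sub_cancel]
    by_cases h : (m + 1 + 1) / 4 = (m + 1) / 4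
    · rw [h]
    · apply Nat.choose_symm_of_eq_add; omega
  rw [h1, ← EI.sum_even m _ (by omega)]
  have hP : ∀ π : Equiv.Perm (Fin (m + 1)),
      ((∀ i, π (π i) = i) ∧ occ p132 π = 0 ∧ Even (inversions π)) ↔
      (EI.P univ π ∧ Even (EI.exc π).card) := by
    intro π
    have h2 : EI.P univ π ↔ ((∀ i, π (π i) = i) ∧ occ p132 π = 0) := by
      rw [EI.occ_iff]
      simp [EI.P]
    constructor
    · rintro ⟨ha, hb, hc⟩
      have := h2.2 ⟨ha, hb⟩
      exact ⟨this, (EI.parity π this).1 hc⟩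
    · rintro ⟨ha, hb⟩
      exact ⟨(h2.1 ha).1, (h2.1 ha).2, (EI.parity π ha).2 hb⟩
  rw [Finset.filter_congr (fun π _ => hP π)]
  rw [Finset.card_eq_sum_card_fiberwise (f := fun π => (EI.exc π).card / 2)
    (t := range ((m + 1) / 4 + 1))]
  · apply Finset.sum_congr rfl
    intro j _
    unfold EI.G
    congr 1
    ext π
    simp only [mem_filter, mem_univ, true_and]
    constructor
    · rintro ⟨⟨ha, hb⟩, hc⟩
      exact ⟨ha, by rw [Nat.even_iff] at hb; omega⟩
    · rintro ⟨ha, hb⟩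
      exact ⟨⟨ha, by rw [hb]; simp⟩, by omega⟩
  · intro π hπ
    simp only [coe_filter, mem_univ, true_and, Set.mem_ofPred_eq] at hπ
    have := hπ.1.card
    simp at this
    simp
    omega
end

section
/- For every n ≥ 2, the number of odd involutions of length n avoiding the pattern 132 equals C(n−1, 1+2⌊(n−2)/4⌋), where C denotes the binomial coefficient. -/
open Finset

/-- Prefixes (of length `d`) of 132-avoiding words on `N` letters. -/
def GoodSeq {d N : ℕ} (e : Fin d → Fin N) : Prop :=
  Function.Injective e ∧ ∀ i j, i < j → e i < e j → ∀ v, e i < v → v < e j → ∃ k, k < j ∧ e k = v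

open Classical in
/-- Good sequences all of whose entries are at least `m`. -/
noncomputable def GS (N d m : ℕ) : Finset (Fin d → Fin N) :=
  Finset.univ.filter (fun e => GoodSeq e ∧ ∀ i, m ≤ (e i).val)

lemma mem_GS {N d m : ℕ} (e : Fin d → Fin N) :
    e ∈ GS N d m ↔ GoodSeq e ∧ ∀ i, m ≤ (e i).val := by
  simp [GS]

lemma GS_zero (N m : ℕ) : (GS N 0 m).card = 1 := by
  have : GS N 0 m = Finset.univ := by
    ext e
    simp only [mem_GS, Finset.mem_univ, iff_true]
    exact ⟨⟨Function.injective_of_subsingleton _, fun i => i.elim0⟩, fun i => i.elim0⟩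
  rw [this]; simp

lemma GS_big (N d m : ℕ) (hm : m ≤ N) (h : N < m + d) : (GS N d m).card = 0 := by
  rw [Finset.card_eq_zero, Finset.eq_empty_iff_forall_notMem]
  intro e he
  rw [mem_GS] at he
  obtain ⟨⟨hi, -⟩, hm'⟩ := he
  have h1 : (Finset.univ.image (fun i => (e i).val)).card = d := by
    rw [Finset.card_image_of_injective]
    · simp
    · intro a b hab
      exact hi (Fin.ext hab)
  have h2 : (Finset.univ.image (fun i => (e i).val)) ⊆ Finset.Ico m N := by
    intro x hx
    simp only [Finset.mem_image, Finset.mem_univ, true_and] at hx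
    obtain ⟨i, rfl⟩ := hx
    simp [hm' i]
  have := Finset.card_le_card h2
  simp at this
  omega

lemma good_init {d N : ℕ} (e : Fin (d+1) → Fin N) (h : GoodSeq e) :
    GoodSeq (fun i : Fin d => e i.castSucc) := by
  refine ⟨fun a b hab => Fin.castSucc_injective _ (h.1 hab), ?_⟩
  intro i j hij hlt v h1 h2
  obtain ⟨k, hk, hkv⟩ := h.2 i.castSucc j.castSucc (by simpa using hij) hlt v h1 h2
  have hkd : k.val < d := by
    have := j.isLt
    have h3 : k.val < j.val := hk
    omega
  exact ⟨⟨k.val, hkd⟩, hk, hkv⟩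

lemma last_aux {d N m : ℕ} (e e' : Fin (d+1) → Fin N) (h : GoodSeq e) (h' : GoodSeq e')
    (hm : ∀ i, m ≤ (e i).val) (hx' : ∃ i, (e' i).val = m)
    (hinit : ∀ i : Fin d, e i.castSucc = e' i.castSucc) (hlt : e (Fin.last d) < e' (Fin.last d)) :
    False := by
  obtain ⟨i, hi⟩ := hx'
  have hml := hm (Fin.last d)
  have hlt' : (e (Fin.last d)).val < (e' (Fin.last d)).val := hlt
  induction i using Fin.lastCases with
  | last => omega
  | cast i =>
    have hne : e i.castSucc ≠ e (Fin.last d) := fun hh => by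
      have := h.1 hh
      exact absurd this (Fin.castSucc_lt_last i).ne
    rw [hinit i] at hne
    have hne' : (e' i.castSucc).val ≠ (e (Fin.last d)).val := fun hh => hne (Fin.ext hh)
    obtain ⟨k, hk, hkv⟩ := h'.2 i.castSucc (Fin.last d) (Fin.castSucc_lt_last i)
      (by rw [Fin.lt_def]; omega) (e (Fin.last d)) (by rw [Fin.lt_def]; omega) hlt
    induction k using Fin.lastCases with
    | last => exact absurd hk (lt_irrefl _)
    | cast k =>
      rw [← hinit k] at hkv
      have := h.1 hkv
      exact absurd this (Fin.castSucc_lt_last k).ne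

lemma GS_rec (N d m : ℕ) (h : m + (d + 1) ≤ N) :
    (GS N (d+1) m).card = (GS N (d+1) (m+1)).card + (GS N d m).card := by
  classical
  rw [← Finset.card_filter_add_card_filter_not (s := GS N (d+1) m)
    (fun e => ∀ i, m + 1 ≤ (e i).val)]
  congr 1
  · congr 1
    ext e
    simp only [Finset.mem_filter, mem_GS]
    constructor
    · rintro ⟨⟨h1, h2⟩, h3⟩; exact ⟨h1, h3⟩
    · rintro ⟨h1, h3⟩; exact ⟨⟨h1, fun i => by have := h3 i; omega⟩, h3⟩
  · have key : ∀ e : Fin (d+1) → Fin N, e ∈ (GS N (d+1) m).filter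
        (fun e => ¬ ∀ i, m + 1 ≤ (e i).val) ↔
        (GoodSeq e ∧ (∀ i, m ≤ (e i).val) ∧ ∃ i, (e i).val = m) := by
      intro e
      simp only [Finset.mem_filter, mem_GS, not_forall]
      constructor
      · rintro ⟨⟨h1, h2⟩, i, h3⟩
        exact ⟨h1, h2, i, by have := h2 i; omega⟩
      · rintro ⟨h1, h2, i, h3⟩
        exact ⟨⟨h1, h2⟩, i, by omega⟩
    apply Finset.card_bij (fun e _ => fun i : Fin d => e i.castSucc)
    · intro e he
      rw [key] at he
      rw [mem_GS]
      exact ⟨good_init e he.1, fun i => he.2.1 _⟩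
    · intro e he e' he' hee
      rw [key] at he he'
      have hinit : ∀ i : Fin d, e i.castSucc = e' i.castSucc := fun i => congrFun hee i
      have hlast : e (Fin.last d) = e' (Fin.last d) := by
        rcases lt_trichotomy (e (Fin.last d)) (e' (Fin.last d)) with hl | hl | hl
        · exact (last_aux e e' he.1 he'.1 he.2.1 he'.2.2 hinit hl).elim
        · exact hl
        · exact (last_aux e' e he'.1 he.1 he'.2.1 he.2.2 (fun i => (hinit i).symm) hl).elim
      funext i
      induction i using Fin.lastCases with
      | last => exact hlast
      | cast i => exact hinit i
    · intro f hf
      rw [mem_GS] at hf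
      obtain ⟨hg, hfm⟩ := hf
      have hex : ∃ v, m ≤ v ∧ v < N ∧ ∀ i, (f i).val ≠ v := by
        by_contra hcon
        push Not at hcon
        have hsub : Finset.Ico m N ⊆ Finset.univ.image (fun i => (f i).val) := by
          intro v hv
          simp only [Finset.mem_Ico] at hv
          obtain ⟨i, hi⟩ := hcon v hv.1 hv.2
          simp only [Finset.mem_image, Finset.mem_univ, true_and]
          exact ⟨i, hi⟩
        have h1 := Finset.card_le_card hsub
        have h2 : (Finset.univ.image (fun i => (f i).val)).card ≤ d :=
          Finset.card_image_le.trans (by simp)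
        simp at h1
        omega
      obtain ⟨hx1, hx2, hx3⟩ := Nat.find_spec hex
      have hmin := fun v (hv : v < Nat.find hex) => Nat.find_min hex hv
      set x := Nat.find hex with hx
      let e : Fin (d+1) → Fin N := Fin.snoc f ⟨x, hx2⟩
      have hec : ∀ i : Fin d, e i.castSucc = f i := fun i => by simp [e]
      have hel : e (Fin.last d) = ⟨x, hx2⟩ := by simp [e]
      refine ⟨e, ?_, funext hec⟩
      rw [key]
      refine ⟨⟨?_, ?_⟩, ?_, ?_⟩
      · intro a b hab
        induction a using Fin.lastCases with
        | last =>
          induction b using Fin.lastCases with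
          | last => rfl
          | cast b =>
            rw [hec, hel] at hab
            exact (hx3 b (by rw [← hab])).elim
        | cast a =>
          induction b using Fin.lastCases with
          | last =>
            rw [hec, hel] at hab
            exact (hx3 a (by rw [hab])).elim
          | cast b =>
            rw [hec, hec] at hab
            rw [hg.1 hab]
      · intro i j hij hlt v h1 h2
        induction i using Fin.lastCases with
        | last => exact absurd hij (not_lt.mpr (Fin.le_last j))
        | cast i =>
          rw [hec] at h1
          have h1' : (f i).val < v.val := h1
          induction j using Fin.lastCases with
          | last =>
            rw [hel] at h2
            have h2' : v.val < x := h2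
            have := hmin v.val h2'
            push Not at this
            obtain ⟨k, hk⟩ := this (by have := hfm i; omega) v.isLt
            exact ⟨k.castSucc, Fin.castSucc_lt_last k, by rw [hec]; exact Fin.ext hk⟩
          | cast j =>
            rw [hec] at h2
            rw [hec, hec] at hlt
            obtain ⟨k, hk, hkv⟩ := hg.2 i j (by simpa using hij) hlt v h1 h2
            exact ⟨k.castSucc, by simpa using hk, by rw [hec]; exact hkv⟩
      · intro i
        induction i using Fin.lastCases with
        | last => rw [hel]; exact hx1
        | cast i => rw [hec]; exact hfm i
      · by_cases hmf : ∃ i, (f i).val = m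
        · obtain ⟨i, hi⟩ := hmf
          exact ⟨i.castSucc, by rw [hec]; exact hi⟩
        · push Not at hmf
          refine ⟨Fin.last d, ?_⟩
          rw [hel]
          have : x ≤ m := Nat.find_min' hex ⟨le_refl _, by omega, hmf⟩
          simp only
          omega

lemma GS_formula (N : ℕ) : ∀ d K m, m + K = N → d ≤ K →
    (GS N (d+1) m).card + (K + d + 1).choose d = (K + d + 1).choose (d + 1) := by
  intro d
  induction d with
  | zero =>
    intro K
    induction K with
    | zero =>
      intro m hm _
      rw [GS_big N 1 m (by omega) (by omega)]; simp
    | succ K ih =>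
      intro m hm _
      rw [GS_rec N 0 m (by omega), GS_zero]
      have := ih (m+1) (by omega) (by omega)
      simp at this ⊢
      omega
  | succ d ihd =>
    intro K
    induction K with
    | zero => intro m hm h; omega
    | succ K ih =>
      intro m hm h
      rcases Nat.lt_or_ge d K with hd | hd
      · rw [GS_rec N (d+1) m (by omega)]
        have h1 := ih (m+1) (by omega) (by omega)
        have h2 := ihd (K+1) m hm (by omega)
        have e1 : K + 1 + (d + 1) + 1 = (K + d + 2) + 1 := by ring
        have e2 : K + (d + 1) + 1 = K + d + 2 := by ring
        have e3 : K + 1 + d + 1 = K + d + 2 := by ring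
        rw [e1, Nat.choose_succ_succ (K+d+2) d, Nat.choose_succ_succ (K+d+2) (d+1)]
        rw [e2] at h1
        rw [e3] at h2
        simp only [Nat.succ_eq_add_one] at *
        omega
      · have : d = K := by omega
        subst this
        rw [GS_big N (d+1+1) m (by omega) (by omega), zero_add]
        rw [← Nat.choose_symm_of_eq_add]
        ring

/-- openers of a permutation -/
def openers {n : ℕ} (π : Equiv.Perm (Fin n)) : Finset (Fin n) :=
  Finset.univ.filter (fun i => i < π i)

lemma occ_zero_iff {n : ℕ} (π : Equiv.Perm (Fin n)) :
    occ p132 π = 0 ↔ ∀ a b c : Fin n, a < b → b < c → π a < π c → π c < π b → False := by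
  unfold occ
  rw [Finset.card_eq_zero, Finset.filter_eq_empty_iff]
  constructor
  · intro h a b c hab hbc h1 h2
    apply @h ![a, b, c] (Finset.mem_univ _)
    have hac := hab.trans hbc
    have h3 := h1.trans h2
    constructor
    · intro x y hxy
      fin_cases x <;> fin_cases y <;> simp_all
    · intro x y
      have e0 : p132 0 = 0 := by decide
      have e1 : p132 1 = 2 := by decide
      have e2 : p132 2 = 1 := by decide
      fin_cases x <;> fin_cases y <;> simp [e0, e1, e2, h1, h2, h3, h1.le, h2.le, h3.le]
  · intro h f _ hf
    obtain ⟨h1, h2⟩ := hf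
    exact h (f 0) (f 1) (f 2) (h1 0 1 (by decide)) (h1 1 2 (by decide))
      ((h2 0 2).1 (by decide)) ((h2 2 1).1 (by decide))

lemma parity_inv {n : ℕ} (π : Equiv.Perm (Fin n)) (hinv : ∀ i, π (π i) = i) :
    Odd (inversions π) ↔ Odd (openers π).card := by
  classical
  unfold inversions
  set S := (Finset.univ.filter (fun p : Fin n × Fin n => p.1 < p.2 ∧ π p.2 < π p.1)) with hS
  rw [← Finset.card_filter_add_card_filter_not (s := S) (fun p => p.2 = π p.1)]
  have h1 : (S.filter (fun p => p.2 = π p.1)).card = (openers π).card := by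
    symm
    apply Finset.card_bij (fun i _ => (i, π i))
    · intro i hi
      simp [openers] at hi
      simp [hS, hinv, hi]
    · intro a _ b _ hab
      simpa using (Prod.ext_iff.1 hab).1
    · rintro ⟨a, b⟩ hab
      simp [hS] at hab
      refine ⟨a, ?_, ?_⟩
      · simp [openers]; rw [← hab.2]; exact hab.1.1
      · simp [hab.2]
  have h2 : Even (S.filter (fun p => ¬ p.2 = π p.1)).card := by
    rw [← ZMod.natCast_eq_zero_iff_even]
    rw [Finset.card_eq_sum_ones, Nat.cast_sum]
    apply Finset.sum_involution (fun p _ => (π p.2, π p.1))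
    · intro p _; decide
    · rintro ⟨a, b⟩ hp _ heq
      simp only [Finset.mem_filter] at hp
      simp only [Prod.mk.injEq] at heq
      exact hp.2 heq.2.symm
    · rintro ⟨a, b⟩ hp
      simp only [hS, Finset.mem_filter, Finset.mem_univ, true_and] at hp ⊢
      refine ⟨⟨hp.1.2, by rw [hinv, hinv]; exact hp.1.1⟩, ?_⟩
      rw [hinv]
      exact fun h => hp.2 h.symm
    · rintro ⟨a, b⟩ hp
      simp [hinv]
  rw [h1, Nat.odd_add]
  tauto

lemma openers_le {n : ℕ} (π : Equiv.Perm (Fin n)) (hinv : ∀ i, π (π i) = i) :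
    2 * (openers π).card ≤ n := by
  classical
  have h : Disjoint (openers π) ((openers π).map π.toEmbedding) := by
    rw [Finset.disjoint_left]
    intro a ha hb
    simp only [Finset.mem_map, openers, Finset.mem_filter, Finset.mem_univ, true_and] at ha hb
    obtain ⟨c, hc, rfl⟩ := hb
    simp only [Equiv.coe_toEmbedding] at ha
    rw [hinv] at ha
    exact lt_asymm hc ha
  have := Finset.card_le_univ (openers π ∪ (openers π).map π.toEmbedding)
  rw [Finset.card_union_of_disjoint h] at this
  simp at this
  omega

lemma openers_iff {n : ℕ} (π : Equiv.Perm (Fin n)) (hinv : ∀ i, π (π i) = i)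
    (hav : occ p132 π = 0) (i : Fin n) : i < π i ↔ i.val < (openers π).card := by
  rw [occ_zero_iff] at hav
  have low : ∀ i j : Fin n, i < j → j < π j → i < π i := by
    intro i j hij hj
    by_contra hcon
    push Not at hcon
    apply hav i j (π j) hij hj
    · rw [hinv]; exact hcon.trans_lt hij
    · rw [hinv]; exact hj
  constructor
  · intro h
    have hs : Finset.Iic i ⊆ openers π := by
      intro x hx
      simp only [Finset.mem_Iic] at hx
      simp only [openers, Finset.mem_filter, Finset.mem_univ, true_and]
      rcases hx.lt_or_eq with h' | rfl
      · exact low x i h' h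
      · exact h
    have := Finset.card_le_card hs
    simp at this
    omega
  · intro h
    by_contra hcon
    have hs : openers π ⊆ Finset.Iio i := by
      intro x hx
      simp only [openers, Finset.mem_filter, Finset.mem_univ, true_and] at hx
      simp only [Finset.mem_Iio]
      by_contra hx'
      push Not at hx'
      rcases hx'.lt_or_eq with h' | h'
      · exact hcon (low i x h' hx)
      · subst h'; exact hcon hx
    have := Finset.card_le_card hs
    simp at this
    omega

open Classical in
/-- The involution attached to a sequence. -/
noncomputable def bfun {d N : ℕ} (e : Fin d → Fin N) : Fin (d + N) → Fin (d + N) :=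
  Fin.addCases (fun i => Fin.natAdd d (e i))
    (fun v => if h : ∃ i, e i = v then Fin.castAdd N h.choose else Fin.natAdd d v)

lemma bfun_left {d N : ℕ} (e : Fin d → Fin N) (i : Fin d) :
    bfun e (Fin.castAdd N i) = Fin.natAdd d (e i) := by
  simp [bfun]

lemma bfun_right {d N : ℕ} (e : Fin d → Fin N) (he : Function.Injective e) (i : Fin d) :
    bfun e (Fin.natAdd d (e i)) = Fin.castAdd N i := by
  have h : ∃ j, e j = e i := ⟨i, rfl⟩
  simp only [bfun, Fin.addCases_right, dif_pos h]
  rw [he h.choose_spec]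

lemma bfun_fix {d N : ℕ} (e : Fin d → Fin N) (v : Fin N) (h : ∀ i, e i ≠ v) :
    bfun e (Fin.natAdd d v) = Fin.natAdd d v := by
  have h : ¬ ∃ j, e j = v := by push Not; exact h
  simp only [bfun, Fin.addCases_right, dif_neg h]

lemma bfun_cases {d N : ℕ} (e : Fin d → Fin N) (x : Fin (d + N)) :
    (∃ i, x = Fin.castAdd N i) ∨ (∃ i, x = Fin.natAdd d (e i)) ∨
    (∃ v, x = Fin.natAdd d v ∧ ∀ i, e i ≠ v) := by
  induction x using Fin.addCases with
  | left i => exact Or.inl ⟨i, rfl⟩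
  | right v =>
    by_cases h : ∃ i, e i = v
    · obtain ⟨i, rfl⟩ := h
      exact Or.inr (Or.inl ⟨i, rfl⟩)
    · push Not at h
      exact Or.inr (Or.inr ⟨v, rfl, h⟩)

lemma bfun_invol {d N : ℕ} (e : Fin d → Fin N) (he : Function.Injective e) :
    Function.Involutive (bfun e) := by
  intro x
  rcases bfun_cases e x with ⟨i, rfl⟩ | ⟨i, rfl⟩ | ⟨v, rfl, h⟩
  · rw [bfun_left, bfun_right e he]
  · rw [bfun_right e he, bfun_left]
  · rw [bfun_fix e v h, bfun_fix e v h]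

lemma bfun_avoid {d N : ℕ} (e : Fin d → Fin N) (he : GoodSeq e) (a b c : Fin (d + N))
    (hab : a < b) (hbc : b < c) (h1 : bfun e a < bfun e c) (h2 : bfun e c < bfun e b) : False := by
  have good : ∀ i j : Fin d, ∀ v : Fin N, i.val < j.val → (e i).val < v.val → v.val < (e j).val →
      ∃ k : Fin d, k.val < j.val ∧ e k = v := fun i j v hij hv1 hv2 =>
    he.2 i j hij (hv1.trans hv2) v hv1 hv2
  rcases bfun_cases e a with ⟨i, rfl⟩ | ⟨i, rfl⟩ | ⟨u, rfl, hu⟩ <;>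
  rcases bfun_cases e b with ⟨j, rfl⟩ | ⟨j, rfl⟩ | ⟨v, rfl, hv⟩ <;>
  rcases bfun_cases e c with ⟨k, rfl⟩ | ⟨k, rfl⟩ | ⟨w, rfl, hw⟩ <;>
  (try simp only [bfun_left, bfun_right e he.1] at h1 h2) <;>
  (try rw [bfun_fix e u hu] at h1) <;>
  (try rw [bfun_fix e v hv] at h2) <;>
  (try rw [bfun_fix e w hw] at h1 h2) <;>
  simp only [Fin.lt_def, Fin.val_castAdd, Fin.val_natAdd] at hab hbc h1 h2 <;>
  (try omega)
  · obtain ⟨l, hl, hl'⟩ := good i j (e k) hab (by omega) (by omega)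
    have := he.1 hl'
    subst this
    omega
  · obtain ⟨l, hl, hl'⟩ := good i j w hab (by omega) (by omega)
    exact hw l hl'
  · obtain ⟨l, hl, hl'⟩ := good i k (e j) h1 (by omega) (by omega)
    have := he.1 hl'
    subst this
    omega
  · obtain ⟨l, hl, hl'⟩ := good i k v h1 (by omega) (by omega)
    exact hv l hl'

theorem card_T (d N : ℕ) :
    (Finset.univ.filter (fun π : Equiv.Perm (Fin (d + N)) =>
      ((∀ i, π (π i) = i) ∧ occ p132 π = 0) ∧ (openers π).card = d)).card = (GS N d 0).card := by
  symm
  apply Finset.card_bij (fun e he => (bfun_invol e ((mem_GS e).1 he).1.1).toPerm)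
  · intro e he
    have hg := ((mem_GS e).1 he).1
    simp only [Finset.mem_filter, Finset.mem_univ, true_and]
    refine ⟨⟨fun i => bfun_invol e hg.1 i, ?_⟩, ?_⟩
    · rw [occ_zero_iff]
      intro a b c
      exact bfun_avoid e hg a b c
    · have : openers (bfun_invol e hg.1).toPerm = Finset.univ.map (Fin.castAddEmb N) := by
        ext x
        have hmem : x ∈ openers (bfun_invol e hg.1).toPerm ↔ x < bfun e x := by
          unfold openers
          rw [Finset.mem_filter]
          exact and_iff_right (Finset.mem_univ x)
        rw [hmem]
        simp only [Finset.mem_univ, true_and, Finset.mem_map]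
        clear hmem
        rcases bfun_cases e x with ⟨i, rfl⟩ | ⟨i, rfl⟩ | ⟨v, rfl, h⟩
        · rw [bfun_left]
          simp [Fin.lt_def]
          omega
        · rw [bfun_right e hg.1]
          simp only [Fin.lt_def, Fin.ext_iff, Fin.val_castAdd, Fin.val_natAdd, Fin.castAddEmb_apply]
          constructor
          · intro; omega
          · rintro ⟨j, hj⟩; omega
        · rw [bfun_fix e v h]
          simp only [Fin.lt_def, Fin.ext_iff, Fin.val_castAdd, Fin.val_natAdd, Fin.castAddEmb_apply]
          constructor
          · intro; omega
          · rintro ⟨j, hj⟩; omega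
      rw [this]; simp
  · intro e he e' he' heq
    funext i
    have := congrArg (fun p : Equiv.Perm (Fin (d + N)) => p (Fin.castAdd N i)) heq
    simp only [Function.Involutive.coe_toPerm, bfun_left] at this
    exact Fin.natAdd_injective _ _ this
  · intro π hπ
    simp only [Finset.mem_filter, Finset.mem_univ, true_and] at hπ
    obtain ⟨⟨hinv, hocc⟩, hd⟩ := hπ
    have hop := openers_iff π hinv hocc
    rw [hd] at hop
    rw [occ_zero_iff] at hocc
    have hbig : ∀ i : Fin d, d ≤ (π (Fin.castAdd N i)).val := by
      intro i
      by_contra hcon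
      push Not at hcon
      have h1 := (hop (π (Fin.castAdd N i))).2 hcon
      have h2 := (hop (Fin.castAdd N i)).2 (by simp)
      rw [hinv] at h1
      exact lt_asymm h1 h2
    have hfix : ∀ x : Fin (d + N), d ≤ x.val → d ≤ (π x).val → π x = x := by
      intro x h1 h2
      have h3 := (hop x).not.2 (by omega)
      have h4 := (hop (π x)).not.2 (by omega)
      rw [hinv] at h4
      push Not at h3 h4
      exact le_antisymm h3 h4
    have hex : ∀ i : Fin d, ∃ v : Fin N, Fin.natAdd d v = π (Fin.castAdd N i) := by
      intro i
      refine ⟨⟨(π (Fin.castAdd N i)).val - d, ?_⟩, ?_⟩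
      · have := (π (Fin.castAdd N i)).isLt
        have := hbig i
        omega
      · ext
        have := hbig i
        simp
        omega
    choose e he using hex
    have hg : GoodSeq e := by
      constructor
      · intro a b hab
        have := he a
        rw [hab, he b] at this
        exact (Fin.castAdd_injective _ _ (π.injective this)).symm
      · intro i j hij hlt v h1 h2
        have hv1 : π (Fin.castAdd N i) < Fin.natAdd d v := by
          rw [← he, Fin.lt_def]; simpa using h1
        have hv2 : Fin.natAdd d v < π (Fin.castAdd N j) := by
          rw [← he, Fin.lt_def]; simpa using h2
        have hij' : Fin.castAdd N i < Fin.castAdd N j := by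
          rw [Fin.lt_def]; simpa using hij
        by_cases hk : (π (Fin.natAdd d v)).val < d
        · refine ⟨⟨_, hk⟩, ?_, ?_⟩
          · by_contra hcon
            push Not at hcon
            have hle : Fin.castAdd N j ≤ π (Fin.natAdd d v) := hcon
            rcases hle.lt_or_eq with h' | h'
            · exact hocc _ _ _ hij' h' (by rw [hinv]; exact hv1) (by rw [hinv]; exact hv2)
            · rw [h', hinv] at hv2
              exact lt_irrefl _ hv2
          · have := he ⟨_, hk⟩
            have h3 : Fin.castAdd N (⟨_, hk⟩ : Fin d) = π (Fin.natAdd d v) := rfl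
            rw [h3, hinv] at this
            exact Fin.natAdd_injective _ _ this
        · push Not at hk
          have hf := hfix (Fin.natAdd d v) (by simp) hk
          exfalso
          refine hocc _ _ (Fin.natAdd d v) hij' ?_ (by rw [hf]; exact hv1) (by rw [hf]; exact hv2)
          rw [Fin.lt_def]
          simp
          omega
    refine ⟨e, (mem_GS e).2 ⟨hg, fun i => Nat.zero_le _⟩, ?_⟩
    ext x
    simp only [Function.Involutive.coe_toPerm]
    congr 1
    rcases bfun_cases e x with ⟨i, rfl⟩ | ⟨i, rfl⟩ | ⟨v, rfl, h⟩
    · rw [bfun_left, he]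
    · rw [bfun_right e hg.1, he, hinv]
    · rw [bfun_fix e v h]
      symm
      apply hfix
      · simp
      · by_contra hcon
        push Not at hcon
        apply h ⟨_, hcon⟩
        have := he ⟨_, hcon⟩
        have h3 : Fin.castAdd N (⟨_, hcon⟩ : Fin d) = π (Fin.natAdd d v) := rfl
        rw [h3, hinv] at this
        exact Fin.natAdd_injective _ _ this

lemma card_T' (n d : ℕ) (h : 2 * (d + 1) ≤ n) :
    (Finset.univ.filter (fun π : Equiv.Perm (Fin n) =>
      ((∀ i, π (π i) = i) ∧ occ p132 π = 0) ∧ (openers π).card = d + 1)).card + n.choose d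
      = n.choose (d + 1) := by
  obtain ⟨N, rfl⟩ : ∃ N, n = (d + 1) + N := ⟨n - (d+1), by omega⟩
  rw [card_T]
  have := GS_formula N d N 0 (by omega) (by omega)
  have e : d + 1 + N = N + d + 1 := by ring
  rw [e]
  exact this

lemma tele (n : ℕ) (T : ℕ → ℕ) (q : ℕ)
    (hT : ∀ i ≤ q, T i + (n+1).choose (2 * i) = (n+1).choose (2 * i + 1)) :
    ∑ i ∈ Finset.range (q + 1), T i = n.choose (1 + 2 * q) := by
  induction q with
  | zero =>
    have := hT 0 le_rfl
    simp at this ⊢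
    omega
  | succ q ih =>
    rw [Finset.sum_range_succ, ih (fun i hi => hT i (by omega))]
    have := hT (q+1) le_rfl
    have e1 : 2 * (q + 1) = (1 + 2 * q) + 1 := by ring
    have e2 : 1 + ((1 + 2 * q) + 1) = (1 + 2 * q) + 2 := by ring
    rw [e1] at this ⊢
    rw [e2]
    rw [Nat.choose_succ_succ, Nat.choose_succ_succ] at this
    simp only [Nat.succ_eq_add_one] at this
    rw [show 1 + 2 * q + 1 + 1 = 1 + 2 * q + 2 from rfl] at this
    omega

/-- For every n ≥ 2, the number of odd involutions of length n avoiding 132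
equals C(n−1, 1+2⌊(n−2)/4⌋). -/
theorem odd_involutions_avoiding_132 (n : ℕ) (hn : 2 ≤ n) :
    (Finset.univ.filter (fun π : Equiv.Perm (Fin n) =>
      (∀ i, π (π i) = i) ∧ occ p132 π = 0 ∧ Odd (inversions π))).card
      = Nat.choose (n - 1) (1 + 2 * ((n - 2) / 4)) := by
  classical
  rw [Finset.card_eq_sum_card_fiberwise (f := fun π => (openers π).card / 2)
    (t := Finset.range ((n - 2) / 4 + 1))]
  · apply tele
    intro i hi
    have h := card_T' n (2 * i) (by omega)
    rw [Nat.sub_add_cancel (by omega)]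
    rw [← h]
    congr 2
    rw [Finset.filter_filter]
    apply Finset.filter_congr
    intro π _
    constructor
    · rintro ⟨⟨h1, h2, h3⟩, h4⟩
      rw [parity_inv π h1, Nat.odd_iff] at h3
      exact ⟨⟨h1, h2⟩, by omega⟩
    · rintro ⟨⟨h1, h2⟩, h4⟩
      refine ⟨⟨h1, h2, ?_⟩, by omega⟩
      rw [parity_inv π h1, Nat.odd_iff]
      omega
  · intro π hπ
    simp only [Finset.coe_filter, Finset.mem_univ, true_and, Set.mem_ofPred_eq] at hπ
    obtain ⟨h1, h2, h3⟩ := hπ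
    rw [parity_inv π h1, Nat.odd_iff] at h3
    have := openers_le π h1
    simp only [Finset.coe_range, Set.mem_Iio]
    omega
end

section
/- For every n ≥ 1 and every r with 0 ≤ r ≤ n−1, the number of involutions of length n avoiding the pattern 132 and having exactly r rises equals C(⌊n/2⌋, ⌊(r+1)/2⌋) · C(⌊(n−1)/2⌋, ⌊r/2⌋), where C denotes the binomial coefficient. -/
open Finset

/-- The number of rises of a permutation: indices j with π j < π (j+1). -/
def rises {n : ℕ} (π : Equiv.Perm (Fin n)) : ℕ :=
  (Finset.univ.filter (fun p : Fin n × Fin n =>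
    (p.2 : ℕ) = (p.1 : ℕ) + 1 ∧ π p.1 < π p.2)).card


namespace Inv132

/-- Avoidance of 132 for functions on the naturals. -/
def Av (p : ℕ → ℕ) : Prop := ∀ a b c, a < b → b < c → p a < p c → p c < p b → False

/-- 132-avoiding involutions of `ℕ` fixing everything from `n` on. -/
structure GoodFn (n : ℕ) (p : ℕ → ℕ) : Prop where
  inv : ∀ i, p (p i) = i
  fix : ∀ i, n ≤ i → p i = i
  av : Av p

/-- Descent set. -/
def Des (n : ℕ) (p : ℕ → ℕ) : Finset ℕ := (Icc 1 (n-1)).filter (fun i => p i < p (i-1))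

/-- Number of elements of `X` up to `i`. -/
def cnt (X : Finset ℕ) (i : ℕ) : ℕ := (X.filter (fun x => x ≤ i)).card

/-- Sets which are descent sets of 132-avoiding involutions. -/
def GoodSet (n : ℕ) (X : Finset ℕ) : Prop :=
  X ⊆ Icc 1 (n-1) ∧ ∀ i j, n ≤ i + j + 1 → X.card ≤ cnt X i + cnt X j

lemma GoodFn.inj {n : ℕ} {p : ℕ → ℕ} (h : GoodFn n p) {a b : ℕ} (hab : p a = p b) : a = b := by
  rw [← h.inv a, hab, h.inv]

lemma GoodFn.p0 {n : ℕ} {p : ℕ → ℕ} (h : GoodFn n p) {i : ℕ} (hi : n ≤ i) : p 0 ≤ i := by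
  by_contra hc
  have h1 := h.fix (p 0) (by omega)
  rw [h.inv] at h1
  omega

lemma mem_L {n : ℕ} {p : ℕ → ℕ} (h : GoodFn n p) (i : ℕ) :
    i ∈ insert 0 (Des n p) ↔ ∀ k < i, p i < p k := by
  simp only [Des, mem_insert, mem_filter, mem_Icc]
  constructor
  · rintro (rfl | ⟨⟨h1, h2⟩, h3⟩) k hk
    · omega
    · by_contra hc
      have hne : p k ≠ p i := fun e => by have := h.inj e; omega
      have hk1 : k ≠ i - 1 := by rintro rfl; omega
      exact h.av k (i-1) i (by omega) (by omega) (by omega) h3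
  · intro hh
    by_cases hi : i = 0
    · exact Or.inl hi
    · right
      have h1 := hh (i-1) (by omega)
      have h2 := hh 0 (by omega)
      refine ⟨⟨by omega, ?_⟩, h1⟩
      by_contra hc
      have h3 := h.fix i (by omega)
      have h4 := h.p0 (i := i) (by omega)
      omega

lemma L_card {n : ℕ} {p : ℕ → ℕ} : (insert 0 (Des n p)).card = (Des n p).card + 1 := by
  apply card_insert_of_notMem
  simp [Des]

lemma L_cnt {n : ℕ} {p : ℕ → ℕ} (i : ℕ) :
    ((insert 0 (Des n p)).filter (fun x => x ≤ i)).card = cnt (Des n p) i + 1 := by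
  rw [filter_insert, if_pos (Nat.zero_le _), card_insert_of_notMem, cnt]
  simp [Des]

lemma L_symm {n : ℕ} {p : ℕ → ℕ} (h : GoodFn n p) {i : ℕ} (hi : i ∈ insert 0 (Des n p)) :
    p i ∈ insert 0 (Des n p) := by
  rw [mem_L h] at *
  intro k hk
  rw [h.inv]
  by_contra hc
  have hne : p k ≠ i := by rintro rfl; rw [h.inv] at hk; omega
  have := hi (p k) (by omega)
  rw [h.inv] at this
  omega

lemma key {n : ℕ} {p : ℕ → ℕ} (h : GoodFn n p) (i j : ℕ) :
    (∀ k ≤ i, j < p k) ↔ cnt (Des n p) i + cnt (Des n p) j < (Des n p).card := by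
  obtain ⟨l, hl, hmin⟩ := exists_min_image (range (i+1)) p ⟨0, by simp⟩
  simp only [mem_range] at hl hmin
  have hlL : l ∈ insert 0 (Des n p) := by
    rw [mem_L h]
    intro k hk
    have h1 := hmin k (by omega)
    have hne : p k ≠ p l := fun e => by have := h.inj e; omega
    omega
  have hplL := L_symm h hlL
  have hc : ((insert 0 (Des n p)).filter (fun x => x ≤ i)).card =
      ((insert 0 (Des n p)).filter (fun x => p l ≤ x)).card := by
    apply card_nbij' p p
    · intro x hx
      simp only [coe_filter, Set.mem_ofPred_eq] at hx ⊢
      exact ⟨L_symm h hx.1, hmin x (by omega)⟩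
    · intro y hy
      simp only [coe_filter, Set.mem_ofPred_eq] at hy ⊢
      refine ⟨L_symm h hy.1, ?_⟩
      by_contra hc
      have := (mem_L h (p y)).1 (L_symm h hy.1) l (by omega)
      rw [h.inv] at this
      omega
    · intro x _; exact h.inv x
    · intro x _; exact h.inv x
  rw [L_cnt] at hc
  have hj := L_cnt (n := n) (p := p) j
  have hL := L_card (n := n) (p := p)
  have h1 : (∀ k ≤ i, j < p k) ↔ j < p l :=
    ⟨fun hh => hh l (by omega), fun hh k hk => lt_of_lt_of_le hh (hmin k (by omega))⟩
  rw [h1]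
  have hui := card_union_add_card_inter ((insert 0 (Des n p)).filter (fun x => x ≤ j))
    ((insert 0 (Des n p)).filter (fun x => p l ≤ x))
  constructor
  · intro hlt
    have : ((insert 0 (Des n p)).filter (fun x => x ≤ j)) ∩
      ((insert 0 (Des n p)).filter (fun x => p l ≤ x)) = ∅ := by
      ext x; simp only [mem_inter, mem_filter, notMem_empty, iff_false]; omega
    rw [this, card_empty] at hui
    have hle := card_le_card (union_subset
      (filter_subset (fun x => x ≤ j) (insert 0 (Des n p)))
      (filter_subset (fun x => p l ≤ x) (insert 0 (Des n p))))
    omega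
  · intro hlt
    by_contra hcon
    have h2 : 0 < (((insert 0 (Des n p)).filter (fun x => x ≤ j)) ∩
      ((insert 0 (Des n p)).filter (fun x => p l ≤ x))).card := by
      apply card_pos.2
      refine ⟨p l, ?_⟩
      rw [mem_inter, mem_filter, mem_filter]
      exact ⟨⟨hplL, by omega⟩, hplL, le_refl _⟩
    have h3 : (insert 0 (Des n p)) ⊆ ((insert 0 (Des n p)).filter (fun x => x ≤ j)) ∪
      ((insert 0 (Des n p)).filter (fun x => p l ≤ x)) := by
      intro x hx
      rw [mem_union, mem_filter, mem_filter]
      by_cases hxj : x ≤ j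
      · exact Or.inl ⟨hx, hxj⟩
      · exact Or.inr ⟨hx, by omega⟩
    have h4 := card_le_card h3
    omega

lemma GoodFn.lt {n : ℕ} {p : ℕ → ℕ} (h : GoodFn n p) {i : ℕ} (hi : i < n) : p i < n := by
  by_contra hc
  have := h.fix (p i) (by omega)
  rw [h.inv] at this
  omega

lemma goodSet_Des {n : ℕ} {p : ℕ → ℕ} (h : GoodFn n p) : GoodSet n (Des n p) := by
  refine ⟨filter_subset _ _, ?_⟩
  intro i j hij
  by_contra hc
  have hD := (key h i j).2 (by omega)
  have hi : i < n := by
    by_contra hi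
    have := hD (p 0) (h.p0 (by omega))
    rw [h.inv] at this
    omega
  have := card_le_card_of_injOn (s := range (i+1)) (t := Ioo j n) p (by
    intro k hk
    simp only [coe_range, Set.mem_Iio, coe_Ioo, Set.mem_Ioo] at hk ⊢
    exact ⟨hD k (by omega), h.lt (by omega)⟩) (fun a _ b _ e => h.inj e)
  simp at this
  omega

lemma uniq {p q : ℕ → ℕ} (hp : Function.Bijective p) (hq : Function.Bijective q)
    (ap : Av p) (aq : Av q)
    (hD : ∀ i j, (∀ k ≤ i, j < p k) ↔ (∀ k ≤ i, j < q k)) : p = q := by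
  have main : ∀ (p q : ℕ → ℕ), Function.Bijective p → Function.Bijective q → Av q →
      (∀ i j, (∀ k ≤ i, j < p k) ↔ (∀ k ≤ i, j < q k)) →
      ∀ i, (∀ k < i, p k = q k) → ¬ p i < q i := by
    intro p q hp hq aq hD i hi hlt
    obtain ⟨k, hk⟩ := hq.2 (p i)
    have hki : i < k := by
      rcases lt_trichotomy k i with h1 | h1 | h1
      · have := hi k h1
        rw [hk] at this
        have := hp.1 this
        omega
      · subst h1; omega
      · exact h1
    have hall : ∀ a ≤ i, p i < q a := by
      intro a ha
      by_contra hc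
      rcases Nat.lt_or_eq_of_le ha with h1 | h1
      · have hne : q a ≠ q k := fun e => by have := hq.1 e; omega
        exact aq a i k h1 hki (by omega) (by omega)
      · subst h1; omega
    have := (hD i (p i)).2 hall i le_rfl
    omega
  funext i
  induction i using Nat.strong_induction_on with
  | _ i ih =>
    have h1 := main p q hp hq aq hD i ih
    have h2 := main q p hq hp ap (fun i j => (hD i j).symm) i (fun k hk => (ih k hk).symm)
    omega

lemma GoodFn.bij {n : ℕ} {p : ℕ → ℕ} (h : GoodFn n p) : Function.Bijective p :=
  ⟨fun _ _ e => h.inj e, fun y => ⟨p y, h.inv y⟩⟩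

lemma Des_inj {n : ℕ} {p q : ℕ → ℕ} (hp : GoodFn n p) (hq : GoodFn n q)
    (e : Des n p = Des n q) : p = q :=
  uniq hp.bij hq.bij hp.av hq.av (fun i j => by rw [key hp, key hq, e])

lemma exists_greedy (μ : ℕ → ℕ) : ∃ f : ℕ → ℕ, ∀ i, μ i ≤ f i ∧ (∀ k < i, f k ≠ f i) ∧
    ∀ v, μ i ≤ v → v < f i → ∃ k < i, f k = v := by
  let F : (i : ℕ) → ((k : ℕ) → k < i → ℕ) → ℕ :=
    fun i g => sInf {v | μ i ≤ v ∧ ∀ k (hk : k < i), g k hk ≠ v}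
  let f : ℕ → ℕ := fun i => Nat.lt_wfRel.wf.fix F i
  have hf : ∀ i, f i = sInf {v | μ i ≤ v ∧ ∀ k < i, f k ≠ v} := by
    intro i
    exact Nat.lt_wfRel.wf.fix_eq F i
  refine ⟨f, fun i => ?_⟩
  have hne : {v | μ i ≤ v ∧ ∀ k < i, f k ≠ v}.Nonempty := by
    refine ⟨μ i + ∑ k ∈ range i, (f k + 1), by simp, ?_⟩
    intro k hk
    have := single_le_sum (f := fun k => f k + 1) (s := range i) (fun _ _ => Nat.zero_le _)
      (mem_range.2 hk)
    omega
  have hm := Nat.sInf_mem hne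
  rw [← hf] at hm
  refine ⟨hm.1, hm.2, ?_⟩
  intro v hv hlt
  rw [hf] at hlt
  have := Nat.notMem_of_lt_sInf hlt
  simp only [Set.mem_ofPred_eq, not_and, not_forall, not_not] at this
  obtain ⟨k, hk, e⟩ := this hv
  exact ⟨k, hk, e⟩

lemma cnt_mono (X : Finset ℕ) {i j : ℕ} (h : i ≤ j) : cnt X i ≤ cnt X j := by
  apply card_le_card
  intro x
  simp only [mem_filter]
  intro hx; exact ⟨hx.1, by omega⟩

lemma cnt_succ (X : Finset ℕ) (i : ℕ) :
    cnt X (i+1) = cnt X i + if i + 1 ∈ X then 1 else 0 := by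
  have : X.filter (fun x => x ≤ i+1) = X.filter (fun x => x ≤ i) ∪ X.filter (fun x => x = i+1) := by
    ext x; simp only [mem_filter, mem_union]; grind
  rw [cnt, this, card_union_of_disjoint, cnt, filter_eq']
  · split_ifs <;> simp
  · rw [disjoint_left]; intro x; simp only [mem_filter]; omega

lemma exists_fn {n : ℕ} {X : Finset ℕ} (hn : 1 ≤ n) (hX : GoodSet n X) :
    ∃ f, GoodFn n f ∧ Des n f = X := by
  obtain ⟨hsub, hX⟩ := hX
  have hc0 : cnt X 0 = 0 := by
    rw [cnt, card_eq_zero, filter_eq_empty_iff]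
    intro x hx h0
    have := mem_Icc.1 (hsub hx)
    omega
  have hcn : ∀ i, n ≤ i + 1 → X.card ≤ cnt X i := by
    intro i hi; have := hX i 0 (by omega); omega
  let μ : ℕ → ℕ := fun i => sInf {j | X.card ≤ cnt X i + cnt X j}
  have hμm : ∀ i, X.card ≤ cnt X i + cnt X (μ i) := fun i =>
    Nat.sInf_mem (s := {j | X.card ≤ cnt X i + cnt X j})
      ⟨n, by have := hcn n (by omega); simp only [Set.mem_ofPred_eq]; omega⟩
  have hμ : ∀ i j, j < μ i ↔ cnt X i + cnt X j < X.card := by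
    intro i j
    constructor
    · intro h
      have := Nat.notMem_of_lt_sInf h
      simpa using this
    · intro h
      by_contra hc
      have := cnt_mono X (not_lt.1 hc)
      have := hμm i
      omega
  have hanti : ∀ i j, i ≤ j → μ j ≤ μ i := by
    intro i j hij
    by_contra hc
    have h1 := (hμ j (μ i)).1 (by omega)
    have := hμm i
    have := cnt_mono X hij
    omega
  have hμb : ∀ i, i < n → μ i + i + 1 ≤ n := by
    intro i hi
    by_contra hc
    have h1 := (hμ i (n-1-i)).1 (by omega)
    have := hX i (n-1-i) (by omega)
    omega
  have hμ0 : ∀ i, n ≤ i → μ i = 0 := by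
    intro i hi
    by_contra hc
    have h1 := (hμ i 0).1 (by omega)
    have := hcn i (by omega)
    omega
  obtain ⟨f, hf⟩ := exists_greedy μ
  have finj : Function.Injective f := by
    intro a b e
    rcases lt_trichotomy a b with h | h | h
    · exact absurd e ((hf b).2.1 a h)
    · exact h
    · exact absurd e.symm ((hf a).2.1 b h)
  have hlo : ∀ i, ∀ k ≤ i, μ i ≤ f k := fun i k hk => (hanti k i hk).trans (hf k).1
  have hat : ∀ i, ∃ k ≤ i, f k = μ i := by
    intro i
    rcases Nat.lt_or_eq_of_le (hf i).1 with h | h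
    · obtain ⟨k, hk, e⟩ := (hf i).2.2 (μ i) le_rfl h
      exact ⟨k, hk.le, e⟩
    · exact ⟨i, le_rfl, h.symm⟩
  have hD : ∀ i j, (∀ k ≤ i, j < f k) ↔ cnt X i + cnt X j < X.card := by
    intro i j
    rw [← hμ]
    constructor
    · intro h; obtain ⟨k, hk, e⟩ := hat i; rw [← e]; exact h k hk
    · intro h k hk; exact lt_of_lt_of_le h (hlo i k hk)
  have fav : Av f := by
    intro a b c hab hbc h1 h2
    obtain ⟨k, hk, e⟩ := (hf b).2.2 (f c) ((hlo b a hab.le).trans h1.le) h2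
    have := finj e
    omega
  have fub : ∀ i, f i < max n (i+1) := by
    intro i
    by_contra hc
    have := card_le_card_of_injOn (s := Ico (μ i) (max n (i+1))) (t := (range i).image f) id (by
      intro v hv
      simp only [coe_Ico, Set.mem_Ico] at hv
      obtain ⟨k, hk, e⟩ := (hf i).2.2 v hv.1 (by omega)
      simp only [id, coe_image, Set.mem_image, coe_range, Set.mem_Iio]
      exact ⟨k, hk, e⟩) (fun _ _ _ _ e => e)
    have h2 := card_image_le (s := range i) (f := f)
    simp only [Nat.card_Ico, card_range] at this h2
    by_cases hi : i < n
    · have := hμb i hi; omega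
    · have := hμ0 i (by omega); omega
  have himg : ∀ i, n ≤ i → (range i).image f = range i := by
    intro i hi
    apply eq_of_subset_of_card_le
    · intro v hv
      obtain ⟨k, hk, rfl⟩ := mem_image.1 hv
      have := fub k
      have := mem_range.1 hk
      rw [mem_range]; omega
    · rw [card_image_of_injective _ finj]
  have ffix : ∀ i, n ≤ i → f i = i := by
    intro i hi
    have h1 := fub i
    by_contra hc
    have : f i ∈ (range i).image f := by rw [himg i hi, mem_range]; omega
    obtain ⟨k, hk, e⟩ := mem_image.1 this
    have := finj e
    have := mem_range.1 hk
    omega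
  have fsurj : Function.Surjective f := by
    intro v
    have : v ∈ (range (n+v+1)).image f := by rw [himg _ (by omega), mem_range]; omega
    obtain ⟨k, hk, e⟩ := mem_image.1 this
    exact ⟨k, e⟩
  let E := Equiv.ofBijective f ⟨finj, fsurj⟩
  have hE : ∀ x, f (E.symm x) = x := fun x => E.apply_symm_apply x
  have hE2 : ∀ x, E.symm (f x) = x := fun x => E.symm_apply_apply x
  have hinv : f = E.symm := by
    apply uniq ⟨finj, fsurj⟩ E.symm.bijective fav
    · intro a b c hab hbc h1 h2
      refine fav (E.symm a) (E.symm c) (E.symm b) h1 h2 ?_ ?_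
      · rwa [hE, hE]
      · rwa [hE, hE]
    · intro i j
      rw [hD, add_comm, ← hD]
      constructor
      · intro h k hk
        by_contra hc
        have := h (E.symm k) (by omega)
        rw [hE] at this
        omega
      · intro h k hk
        by_contra hc
        have := h (f k) (by omega)
        rw [hE2] at this
        omega
  refine ⟨f, ⟨fun i => ?_, ffix, fav⟩, ?_⟩
  · have := hE2 i
    rwa [← hinv] at this
  · ext i
    simp only [Des, mem_filter, mem_Icc]
    rcases Nat.eq_zero_or_pos i with h0 | h0
    · subst h0
      constructor
      · omega
      · intro h; have := mem_Icc.1 (hsub h); omega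
    obtain ⟨i, rfl⟩ : ∃ k, i = k + 1 := ⟨i - 1, by omega⟩
    have hs := cnt_succ X i
    simp only [Nat.add_sub_cancel]
    constructor
    · rintro ⟨h1, h2⟩
      by_contra hni
      rw [if_neg hni] at hs
      have hmu : μ (i+1) = μ i := by simp only [μ, hs, add_zero]
      obtain ⟨k, hk, e⟩ := hat i
      have h3 := (hf (i+1)).1
      have hne : f k ≠ f (i+1) := fun e => by have := finj e; omega
      have hki : k ≠ i := by rintro rfl; omega
      exact fav k i (i+1) (by omega) (by omega) (by omega) h2
    · intro hi
      refine ⟨mem_Icc.1 (hsub hi), ?_⟩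
      rw [if_pos hi] at hs
      have hlt : μ (i+1) < μ i := by
        rw [hμ]
        rcases Nat.eq_zero_or_pos (μ (i+1)) with h | h
        · rw [h, hc0]
          have : cnt X (i+1) ≤ X.card := card_filter_le _ _
          omega
        · have h1 := (hμ (i+1) (μ (i+1) - 1)).1 (by omega)
          have h2 := cnt_succ X (μ (i+1) - 1)
          rw [Nat.sub_add_cancel h] at h2
          split_ifs at h2 <;> omega
      obtain ⟨k, hk, e⟩ := hat (i+1)
      have hk2 : k = i + 1 := by
        by_contra hne
        have := hlo i k (by omega)
        omega
      subst hk2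
      have := hlo i i le_rfl
      omega


/-- Number of elements of `X` at least `n - i`. -/
def hic (n : ℕ) (X : Finset ℕ) (i : ℕ) : ℕ := (X.filter (fun x => n - i ≤ x)).card

/-- The outer `m` elements on both sides of `{1, …, n-1}`. -/
def T (n : ℕ) : ℕ → Finset ℕ
  | 0 => ∅
  | m + 1 => insert (m+1) (insert (n-m-1) (T n m))

/-- Ballot condition together with prescribed end counts. -/
def Q (n m u v a b : ℕ) (X : Finset ℕ) : Prop :=
  (∀ i ≤ m, hic n X i ≤ cnt X i) ∧ cnt X m + u = a ∧ hic n X m + v = b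

open Classical in
/-- Number of subsets satisfying `Q`. -/
noncomputable def G (n m u v a b : ℕ) : ℕ :=
  ∑ X ∈ (T n m).powerset, if Q n m u v a b X then 1 else 0

lemma mem_T {n m : ℕ} (h : 2 * m < n) (x : ℕ) :
    x ∈ T n m ↔ (1 ≤ x ∧ x ≤ m) ∨ (n - m ≤ x ∧ x < n) := by
  induction m with
  | zero => simp only [T, notMem_empty, false_iff]; omega
  | succ m ih =>
    rw [T, mem_insert, mem_insert, ih (by omega)]
    omega

lemma cnt_insert {X : Finset ℕ} {x : ℕ} (hx : x ∉ X) (i : ℕ) :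
    cnt (insert x X) i = cnt X i + if x ≤ i then 1 else 0 := by
  rw [cnt, filter_insert]
  split_ifs with h
  · rw [card_insert_of_notMem (by simp [hx]), cnt]
  · rfl

lemma hic_insert {n : ℕ} {X : Finset ℕ} {x : ℕ} (hx : x ∉ X) (i : ℕ) :
    hic n (insert x X) i = hic n X i + if n - i ≤ x then 1 else 0 := by
  rw [hic, filter_insert]
  split_ifs with h
  · rw [card_insert_of_notMem (by simp [hx]), hic]
  · rfl

lemma cnt_T {n m : ℕ} (h : 2 * m + 2 < n) {Y : Finset ℕ} (hY : Y ⊆ T n m) :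
    cnt Y (m+1) = cnt Y m := by
  unfold cnt
  congr 1
  apply filter_congr
  intro x hx
  have := (mem_T (by omega) x).1 (hY hx)
  omega

lemma hic_T {n m : ℕ} (h : 2 * m + 2 < n) {Y : Finset ℕ} (hY : Y ⊆ T n m) :
    hic n Y (m+1) = hic n Y m := by
  unfold hic
  congr 1
  apply filter_congr
  intro x hx
  have := (mem_T (by omega) x).1 (hY hx)
  omega

lemma Q_step {n m a b u v : ℕ} (h : 2 * m + 2 < n) (hab : b ≤ a) {X Y : Finset ℕ}
    (hc : ∀ i, i ≤ m → cnt X i = cnt Y i) (hh : ∀ i, i ≤ m → hic n X i = hic n Y i)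
    (hc1 : cnt X (m+1) = cnt Y m + u) (hh1 : hic n X (m+1) = hic n Y m + v) :
    Q n (m+1) 0 0 a b X ↔ Q n m u v a b Y := by
  unfold Q
  rw [hc1, hh1]
  constructor
  · rintro ⟨h1, h2, h3⟩
    refine ⟨fun i hi => ?_, by omega, by omega⟩
    rw [← hc i hi, ← hh i hi]
    exact h1 i (by omega)
  · rintro ⟨h1, h2, h3⟩
    refine ⟨fun i hi => ?_, by omega, by omega⟩
    rcases Nat.lt_or_eq_of_le hi with h4 | h4
    · rw [hc i (by omega), hh i (by omega)]
      exact h1 i (by omega)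
    · subst h4; omega

lemma G_succ {n m a b : ℕ} (h : 2 * m + 2 < n) (hab : b ≤ a) :
    G n (m+1) 0 0 a b = G n m 0 0 a b + G n m 0 1 a b + (G n m 1 0 a b + G n m 1 1 a b) := by
  classical
  have n1 : n - m - 1 ∉ T n m := by rw [mem_T (by omega)]; omega
  have n2 : m + 1 ∉ insert (n-m-1) (T n m) := by rw [mem_insert, mem_T (by omega)]; omega
  unfold G
  rw [T, sum_powerset_insert n2, sum_powerset_insert n1, sum_powerset_insert n1]
  have m1 : ∀ Y ∈ (T n m).powerset, n - m - 1 ∉ Y := fun Y hY hh => n1 (mem_powerset.1 hY hh)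
  have m2 : ∀ Y ∈ (T n m).powerset, m + 1 ∉ Y := fun Y hY hh =>
    n2 (mem_insert_of_mem (mem_powerset.1 hY hh))
  have m3 : ∀ Y ∈ (T n m).powerset, m + 1 ∉ insert (n-m-1) Y := fun Y hY hh => by
    rcases mem_insert.1 hh with h1 | h1
    · omega
    · exact m2 Y hY h1
  congr 1
  · congr 1
    · apply sum_congr rfl
      intro Y hY
      have e1 := cnt_T h (mem_powerset.1 hY)
      have e2 := hic_T h (mem_powerset.1 hY)
      simp only [Q_step h hab (X := Y) (Y := Y) (u := 0) (v := 0) (fun _ _ => rfl) (fun _ _ => rfl) e1 e2]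
    · apply sum_congr rfl
      intro Y hY
      have e1 := cnt_T h (mem_powerset.1 hY)
      have e2 := hic_T h (mem_powerset.1 hY)
      have := Q_step h hab (X := insert (n-m-1) Y) (Y := Y) (u := 0) (v := 1)
        (fun i hi => by rw [cnt_insert (m1 Y hY), if_neg (by omega), add_zero])
        (fun i hi => by rw [hic_insert (m1 Y hY), if_neg (by omega), add_zero])
        (by rw [cnt_insert (m1 Y hY), if_neg (by omega), e1])
        (by rw [hic_insert (m1 Y hY), if_pos (by omega), e2])
      simp only [this]
  · congr 1
    · apply sum_congr rfl
      intro Y hY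
      have e1 := cnt_T h (mem_powerset.1 hY)
      have e2 := hic_T h (mem_powerset.1 hY)
      have := Q_step h hab (X := insert (m+1) Y) (Y := Y) (u := 1) (v := 0)
        (fun i hi => by rw [cnt_insert (m2 Y hY), if_neg (by omega), add_zero])
        (fun i hi => by rw [hic_insert (m2 Y hY), if_neg (by omega), add_zero])
        (by rw [cnt_insert (m2 Y hY), if_pos (by omega), e1])
        (by rw [hic_insert (m2 Y hY), if_neg (by omega), e2])
      simp only [this]
    · apply sum_congr rfl
      intro Y hY
      have e1 := cnt_T h (mem_powerset.1 hY)
      have e2 := hic_T h (mem_powerset.1 hY)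
      have := Q_step h hab (X := insert (m+1) (insert (n-m-1) Y)) (Y := Y) (u := 1) (v := 1)
        (fun i hi => by
          rw [cnt_insert (m3 Y hY), cnt_insert (m1 Y hY), if_neg (by omega), if_neg (by omega),
            add_zero, add_zero])
        (fun i hi => by
          rw [hic_insert (m3 Y hY), hic_insert (m1 Y hY), if_neg (by omega), if_neg (by omega),
            add_zero, add_zero])
        (by rw [cnt_insert (m3 Y hY), cnt_insert (m1 Y hY), if_neg (by omega), if_pos (by omega), e1])
        (by rw [hic_insert (m3 Y hY), hic_insert (m1 Y hY), if_pos (by omega), if_neg (by omega), e2])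
      simp only [this]

lemma G_u {n m v a b : ℕ} : G n m 1 v (a+1) b = G n m 0 v a b := by
  simp [G, Q]

lemma G_u0 {n m v b : ℕ} : G n m 1 v 0 b = 0 := by
  simp [G, Q]

lemma G_v {n m u a b : ℕ} : G n m u 1 a (b+1) = G n m u 0 a b := by
  simp [G, Q]

lemma G_v0 {n m u a : ℕ} : G n m u 1 a 0 = 0 := by
  simp [G, Q]

lemma G_lt {n m a b : ℕ} (h : a < b) : G n m 0 0 a b = 0 := by
  unfold G
  apply sum_eq_zero
  intro X _
  rw [if_neg]
  rintro ⟨h1, h2, h3⟩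
  have := h1 m le_rfl
  omega

lemma G_closed {n m : ℕ} (h : 2 * m < n) : ∀ a b, b ≤ a + 1 →
    (G n m 0 0 a b : ℤ) = (m.choose a : ℤ) * m.choose b -
      (m.choose (a+1) : ℤ) * (if b = 0 then 0 else (m.choose (b-1) : ℤ)) := by
  induction m with
  | zero =>
    intro a b hab
    have hT : (T n 0).powerset = {∅} := by simp [T]
    rw [G, hT, sum_singleton]
    have hQ : Q n 0 0 0 a b ∅ ↔ a = 0 ∧ b = 0 := by
      simp [Q, cnt, hic, eq_comm]
    simp only [hQ]
    rcases a with _ | a <;> rcases b with _ | b <;> simp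
  | succ m ih =>
    intro a b hab
    have ih := ih (by omega)
    rcases Nat.lt_or_eq_of_le hab with h1 | h1
    · rw [G_succ (by omega) (by omega)]
      rcases a with _ | a <;> rcases b with _ | b
      · rw [G_u0, G_u0, G_v0]
        have := ih 0 0 (by omega)
        push_cast
        rw [this]
        simp
      · omega
      · rw [G_u, G_u, G_v0, G_v0]
        have e1 := ih (a+1) 0 (by omega)
        have e2 := ih a 0 (by omega)
        push_cast
        rw [e1, e2]
        simp [Nat.choose_succ_succ]
        ring
      · rw [G_u, G_u, G_v, G_v]
        have e1 := ih (a+1) (b+1) (by omega)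
        have e2 := ih (a+1) b (by omega)
        have e3 := ih a (b+1) (by omega)
        have e4 := ih a b (by omega)
        push_cast
        rw [e1, e2, e3, e4]
        rcases b with _ | b
        · simp [Nat.choose_succ_succ]; ring
        · simp [Nat.choose_succ_succ]; ring
    · rw [h1, G_lt (by omega)]
      simp; ring

lemma G_sum {n m d : ℕ} (h : 2 * m < n) : ∀ k, 2 * k ≤ d →
    ∑ b ∈ range (k+1), G n m 0 0 (d-b) b = m.choose (d-k) * m.choose k := by
  intro k
  induction k with
  | zero =>
    intro _
    have := G_closed h d 0 (by omega)
    simp at this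
    simp
    exact_mod_cast this
  | succ k ih =>
    intro hk
    rw [sum_range_succ, ih (by omega)]
    have := G_closed h (d-(k+1)) (k+1) (by omega)
    rw [show d - (k+1) + 1 = d - k by omega] at this
    simp only [Nat.add_sub_cancel, Nat.succ_ne_zero, if_false, Nat.add_eq_zero_iff] at this
    zify
    rw [this]
    simp

open Classical in
/-- Ballot subsets of size `d`. -/
noncomputable def Fm (n m d : ℕ) : Finset (Finset ℕ) :=
  (T n m).powerset.filter (fun X => X.card = d ∧ ∀ i ≤ m, hic n X i ≤ cnt X i)

lemma card_T {n m : ℕ} (h : 2 * m < n) {X : Finset ℕ} (hX : X ⊆ T n m) :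
    X.card = cnt X m + hic n X m := by
  rw [← card_filter_add_card_filter_not (s := X) (fun x => x ≤ m)]
  unfold cnt hic
  congr 2
  apply filter_congr
  intro x hx
  have := (mem_T h x).1 (hX hx)
  omega

lemma card_Fm {n m d : ℕ} (h : 2 * m < n) :
    (Fm n m d).card = m.choose (d - d/2) * m.choose (d/2) := by
  classical
  rw [← G_sum h (d/2) (by omega)]
  rw [card_eq_sum_card_fiberwise (f := fun X => hic n X m) (t := range (d/2+1))]
  · apply sum_congr rfl
    intro b hb
    rw [mem_range] at hb
    rw [Fm, filter_filter, card_filter, G]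
    apply sum_congr rfl
    intro X hX
    have hc := card_T h (mem_powerset.1 hX)
    congr 1
    apply propext
    unfold Q
    constructor
    · rintro ⟨⟨h1, h2⟩, h3⟩
      exact ⟨h2, by omega, by omega⟩
    · rintro ⟨h1, h2, h3⟩
      exact ⟨⟨by omega, h1⟩, by omega⟩
  · intro X hX
    rw [Fm, coe_filter, Set.mem_ofPred_eq] at hX
    have hc := card_T h (mem_powerset.1 hX.1)
    have := hX.2.2 m le_rfl
    simp only [coe_range, Set.mem_Iio]
    omega

lemma hic_cnt {n : ℕ} {X : Finset ℕ} {i : ℕ} (h : i < n) :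
    cnt X (n - 1 - i) + hic n X i = X.card := by
  rw [← card_filter_add_card_filter_not (s := X) (fun x => x ≤ n - 1 - i)]
  unfold cnt hic
  congr 2
  apply filter_congr
  intro x hx
  omega

lemma goodSet_iff {n m : ℕ} (hn : 1 ≤ n) (hm : m = (n-1)/2) {X : Finset ℕ} (hs : X ⊆ Icc 1 (n-1)) :
    GoodSet n X ↔ ∀ i ≤ m, hic n X i ≤ cnt X i := by
  unfold GoodSet
  constructor
  · rintro ⟨_, h⟩ i hi
    have h1 := h i (n-1-i) (by omega)
    have h2 := hic_cnt (X := X) (show i < n by omega)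
    omega
  · intro h
    refine ⟨hs, ?_⟩
    have main : ∀ i j, i ≤ j → n ≤ i + j + 1 → X.card ≤ cnt X i + cnt X j := by
      intro i j hij hl
      by_cases hj : j < n
      · have h2 := hic_cnt (X := X) (show n - 1 - j < n by omega)
        rw [show n - 1 - (n-1-j) = j by omega] at h2
        have h3 := h (n-1-j) (by omega)
        have h4 := cnt_mono X (show n - 1 - j ≤ i by omega)
        omega
      · have : cnt X j = X.card := by
          unfold cnt
          congr 1
          apply filter_true_of_mem
          intro x hx
          have := mem_Icc.1 (hs hx)
          omega
        omega
    intro i j hl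
    rcases le_total i j with hij | hij
    · exact main i j hij hl
    · have := main j i hij (by omega); omega

open Classical in
lemma count_good (n r : ℕ) (hn : 1 ≤ n) (hr : r ≤ n - 1) :
    ((Icc 1 (n-1)).powerset.filter (fun X => GoodSet n X ∧ X.card = n - 1 - r)).card
      = Nat.choose (n / 2) ((r + 1) / 2) * Nat.choose ((n - 1) / 2) (r / 2) := by
  set d := n - 1 - r with hd
  set m := (n-1)/2 with hm
  have e0 : ((Icc 1 (n-1)).powerset.filter (fun X => GoodSet n X ∧ X.card = d)) =
      (Icc 1 (n-1)).powerset.filter (fun X => X.card = d ∧ ∀ i ≤ m, hic n X i ≤ cnt X i) := by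
    apply filter_congr
    intro X hX
    rw [goodSet_iff hn hm (mem_powerset.1 hX), and_comm]
  rw [e0]
  rcases Nat.even_or_odd' n with ⟨c, hc | hc⟩
  · skip
    have hT : Icc 1 (n-1) = insert c (T n m) := by
      ext x
      rw [mem_insert, mem_T (by omega), mem_Icc]
      omega
    have hcT : c ∉ T n m := by rw [mem_T (by omega)]; omega
    have e1 : ((Icc 1 (n-1)).powerset.filter
        (fun X => X.card = d ∧ ∀ i ≤ m, hic n X i ≤ cnt X i)).card =
        (Fm n m d).card + if d = 0 then 0 else (Fm n m (d-1)).card := by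
      rw [hT, card_filter, sum_powerset_insert hcT, Fm, card_filter]
      congr 1
      have e2 : ∀ Y ∈ (T n m).powerset, ((insert c Y).card = d ∧
          ∀ i ≤ m, hic n (insert c Y) i ≤ cnt (insert c Y) i) ↔
          (d ≠ 0 ∧ Y.card = d - 1 ∧ ∀ i ≤ m, hic n Y i ≤ cnt Y i) := by
        intro Y hY
        have hcY : c ∉ Y := fun hh => hcT (mem_powerset.1 hY hh)
        rw [card_insert_of_notMem hcY, ← and_assoc]
        apply and_congr
        · omega
        · apply forall_congr'
          intro i
          apply imp_congr_right
          intro hi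
          rw [hic_insert hcY, cnt_insert hcY, if_neg (by omega), if_neg (by omega)]
          simp
      split_ifs with hd0
      · apply sum_eq_zero
        intro Y hY
        rw [if_neg]
        rw [e2 Y hY]
        tauto
      · rw [Fm, card_filter]
        apply sum_congr rfl
        intro Y hY
        congr 1
        apply propext
        rw [e2 Y hY]
        tauto
    rw [e1, card_Fm (by omega), card_Fm (by omega)]
    rcases Nat.even_or_odd' d with ⟨e, he | he⟩
    · rw [show d - d/2 = e by omega, show d/2 = e by omega, show n/2 = m+1 by omega,
        show (r+1)/2 = m + 1 - e by omega, show r/2 = m - e by omega,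
        Nat.choose_symm (by omega), Nat.choose_symm (by omega)]
      rcases e with _ | e
      · simp [he]
      · rw [if_neg (by omega), show (d-1) - (d-1)/2 = e+1 by omega, show (d-1)/2 = e by omega,
          Nat.choose_succ_succ]
        ring
    · rw [show d - d/2 = e+1 by omega, show d/2 = e by omega, show n/2 = m+1 by omega,
        show (r+1)/2 = m + 1 - (e+1) by omega, show r/2 = m - e by omega,
        Nat.choose_symm (by omega), Nat.choose_symm (by omega), if_neg (by omega),
        show (d-1) - (d-1)/2 = e by omega, show (d-1)/2 = e by omega, Nat.choose_succ_succ]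
      ring
  · have hT : Icc 1 (n-1) = T n m := by
      ext x
      rw [mem_T (by omega), mem_Icc]
      omega
    have e1 := card_Fm (n := n) (m := m) (d := d) (by omega)
    rw [hT]
    rw [Fm] at e1
    rw [e1, show n/2 = m by omega, show (r+1)/2 = m - d/2 by omega,
      show r/2 = m - (d - d/2) by omega, Nat.choose_symm (by omega), Nat.choose_symm (by omega),
      mul_comm]


/-- Extension of a permutation of `Fin n` to `ℕ`. -/
def ext {n : ℕ} (π : Equiv.Perm (Fin n)) (i : ℕ) : ℕ := if h : i < n then (π ⟨i, h⟩ : ℕ) else i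

lemma ext_lt {n : ℕ} (π : Equiv.Perm (Fin n)) {i : ℕ} (h : i < n) : ext π i = π ⟨i, h⟩ := by
  simp [ext, h]

lemma ext_fin {n : ℕ} (π : Equiv.Perm (Fin n)) (i : Fin n) : ext π i = π i := by
  simp [ext]

lemma ext_ge {n : ℕ} (π : Equiv.Perm (Fin n)) {i : ℕ} (h : n ≤ i) : ext π i = i := by
  simp [ext, not_lt.2 h]

lemma ext_lt_n {n : ℕ} (π : Equiv.Perm (Fin n)) {i : ℕ} (h : i < n) : ext π i < n := by
  rw [ext_lt π h]; exact (π ⟨i, h⟩).2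

lemma ext_inj {n : ℕ} {π σ : Equiv.Perm (Fin n)} (h : ext π = ext σ) : π = σ := by
  ext i
  rw [← ext_fin, h, ext_fin]

lemma occ_iff {n : ℕ} (π : Equiv.Perm (Fin n)) : occ p132 π = 0 ↔ Av (ext π) := by
  rw [occ, card_eq_zero, filter_eq_empty_iff]
  have p0 : p132 0 = 0 := by decide
  have p1 : p132 1 = 2 := by decide
  have p2 : p132 2 = 1 := by decide
  constructor
  · intro h a b c hab hbc h1 h2
    have hc : c < n := by
      by_contra hc
      rw [ext_ge π (not_lt.1 hc)] at h2
      by_cases hb : b < n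
      · have := ext_lt_n π hb; omega
      · rw [ext_ge π (not_lt.1 hb)] at h2; omega
    rw [ext_lt π (show a < n by omega), ext_lt π hc] at h1
    rw [ext_lt π hc, ext_lt π (show b < n by omega)] at h2
    apply h (mem_univ ![⟨a, by omega⟩, ⟨b, by omega⟩, ⟨c, hc⟩])
    constructor
    · intro x y hxy
      fin_cases x <;> fin_cases y <;> simp at hxy ⊢ <;> omega
    · intro x y
      fin_cases x <;> fin_cases y <;> simp [p0, p1, p2] <;> omega
  · rintro h f - ⟨h1, h2⟩
    have h3 := (h2 0 2).1 (by decide)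
    have h4 := (h2 2 1).1 (by decide)
    refine h (f 0) (f 1) (f 2) (h1 0 1 (by decide)) (h1 1 2 (by decide)) ?_ ?_
    · rw [ext_fin, ext_fin]; exact h3
    · rw [ext_fin, ext_fin]; exact h4

lemma rises_eq {n : ℕ} (π : Equiv.Perm (Fin n)) :
    rises π = ((Icc 1 (n-1)).filter (fun i => ¬ ext π i < ext π (i-1))).card := by
  unfold rises
  apply card_bij (fun p _ => (p.2 : ℕ))
  · rintro ⟨a, b⟩ h
    simp only [mem_filter, mem_univ, true_and, mem_Icc] at h ⊢
    have hb := b.2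
    refine ⟨by omega, ?_⟩
    rw [ext_fin, show (b : ℕ) - 1 = a by omega, ext_fin]
    have := Fin.lt_def.1 h.2
    omega
  · rintro ⟨a, b⟩ h ⟨a2, b2⟩ h2 e
    simp only [mem_filter, mem_univ, true_and] at h h2 e
    have hb : b = b2 := Fin.ext e
    have ha : a = a2 := Fin.ext (by omega)
    rw [ha, hb]
  · intro i hi
    simp only [mem_filter, mem_Icc] at hi
    refine ⟨(⟨i-1, by omega⟩, ⟨i, by omega⟩), ?_, rfl⟩
    simp only [mem_filter, mem_univ, true_and]
    refine ⟨by omega, ?_⟩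
    have h := hi.2
    rw [ext_lt π (show i < n by omega), ext_lt π (show i - 1 < n by omega)] at h
    have hne : (π ⟨i-1, by omega⟩ : ℕ) ≠ π ⟨i, by omega⟩ := by
      intro e
      have := π.injective (Fin.ext e)
      rw [Fin.mk.injEq] at this
      omega
    rw [Fin.lt_def]
    omega

lemma rises_add {n : ℕ} (π : Equiv.Perm (Fin n)) : rises π + (Des n (ext π)).card = n - 1 := by
  rw [rises_eq, Des, add_comm, card_filter_add_card_filter_not]
  simp

lemma goodFn_iff {n : ℕ} (π : Equiv.Perm (Fin n)) :
    ((∀ i, π (π i) = i) ∧ occ p132 π = 0) ↔ GoodFn n (ext π) := by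
  rw [occ_iff]
  constructor
  · rintro ⟨h1, h2⟩
    refine ⟨fun i => ?_, fun i hi => ext_ge π hi, h2⟩
    by_cases hi : i < n
    · rw [ext_lt π hi, ext_fin, h1]
    · rw [ext_ge π (not_lt.1 hi), ext_ge π (not_lt.1 hi)]
  · intro h
    refine ⟨fun i => ?_, h.av⟩
    apply Fin.ext
    rw [← ext_fin, ← ext_fin, h.inv]

lemma exists_perm {n : ℕ} {f : ℕ → ℕ} (h : GoodFn n f) : ∃ π : Equiv.Perm (Fin n), ext π = f := by
  let g : Fin n → Fin n := fun i => ⟨f i, h.lt i.2⟩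
  have hg : Function.Involutive g := fun i => Fin.ext (h.inv i)
  refine ⟨hg.toPerm g, ?_⟩
  funext i
  by_cases hi : i < n
  · rw [ext_lt _ hi]; rfl
  · rw [ext_ge _ (not_lt.1 hi), h.fix i (not_lt.1 hi)]

open Classical in
lemma card_perm (n r : ℕ) (hn : 1 ≤ n) (hr : r ≤ n - 1) :
    (Finset.univ.filter (fun π : Equiv.Perm (Fin n) =>
      (∀ i, π (π i) = i) ∧ occ p132 π = 0 ∧ rises π = r)).card =
    ((Icc 1 (n-1)).powerset.filter (fun X => GoodSet n X ∧ X.card = n - 1 - r)).card := by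
  have hmem : ∀ π : Equiv.Perm (Fin n), (∀ i, π (π i) = i) ∧ occ p132 π = 0 ∧ rises π = r ↔
      GoodFn n (ext π) ∧ (Des n (ext π)).card = n - 1 - r := by
    intro π
    rw [← and_assoc, goodFn_iff]
    have := rises_add π
    apply and_congr_right
    intro _
    omega
  apply card_bij (fun π _ => Des n (ext π))
  · intro π hπ
    rw [mem_filter, hmem] at hπ
    rw [mem_filter, mem_powerset]
    exact ⟨filter_subset _ _, goodSet_Des hπ.2.1, hπ.2.2⟩
  · intro π hπ σ hσ e
    rw [mem_filter, hmem] at hπ hσ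
    exact ext_inj (Des_inj hπ.2.1 hσ.2.1 e)
  · intro X hX
    rw [mem_filter] at hX
    obtain ⟨f, hf, rfl⟩ := exists_fn hn hX.2.1
    obtain ⟨π, rfl⟩ := exists_perm hf
    refine ⟨π, ?_, rfl⟩
    rw [mem_filter, hmem]
    exact ⟨mem_univ _, hf, hX.2.2⟩

end Inv132

/-- The number of 132-avoiding involutions of length n with exactly r rises is
C(⌊n/2⌋, ⌊(r+1)/2⌋) · C(⌊(n−1)/2⌋, ⌊r/2⌋). -/
theorem involutions_avoiding_132_with_r_rises (n r : ℕ) (hn : 1 ≤ n) (hr : r ≤ n - 1) :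
    (Finset.univ.filter (fun π : Equiv.Perm (Fin n) =>
      (∀ i, π (π i) = i) ∧ occ p132 π = 0 ∧ rises π = r)).card
      = Nat.choose (n / 2) ((r + 1) / 2) * Nat.choose ((n - 1) / 2) (r / 2) := by
  rw [Inv132.card_perm n r hn hr, Inv132.count_good n r hn hr]
end

section
/- For every n ≥ 3, every p with 1 ≤ p ≤ n, and every integer i, the number of involutions of length n having exactly p fixed points and exactly i inversions that contain the pattern 132 exactly once equals the number of involutions of length n−2 avoiding 132 that have exactly p fixed points and exactly i−2n+2p+3 inversions (where a count with a negative inversion parameter is 0). -/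
open Finset

/-- Extension of a permutation of `Fin n` to a function on `ℕ`. -/
def extN {n : ℕ} (π : Equiv.Perm (Fin n)) (x : ℕ) : ℕ :=
  if h : x < n then (π ⟨x, h⟩ : ℕ) else x

/-- `g` restricts to an involution of `{0,…,n-1}`. -/
def IsInv (n : ℕ) (g : ℕ → ℕ) : Prop := ∀ x < n, g x < n ∧ g (g x) = x

open Classical in
/-- The permutation attached to a function which is an involution below `n`. -/
noncomputable def toPerm (n : ℕ) (g : ℕ → ℕ) : Equiv.Perm (Fin n) :=
  if h : IsInv n g then
    { toFun := fun x => ⟨g x, (h x x.2).1⟩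
      invFun := fun x => ⟨g x, (h x x.2).1⟩
      left_inv := fun x => Fin.ext (h x x.2).2
      right_inv := fun x => Fin.ext (h x x.2).2 }
  else 1

theorem extN_toPerm {n : ℕ} {g : ℕ → ℕ} (h : IsInv n g) {x : ℕ} (hx : x < n) :
    extN (toPerm n g) x = g x := by
  simp [extN, toPerm, h, hx]

theorem extN_val {n : ℕ} (π : Equiv.Perm (Fin n)) (x : Fin n) : extN π x = π x := by
  simp [extN]

theorem extN_inv {n : ℕ} (π : Equiv.Perm (Fin n)) (h : ∀ j, π (π j) = j) : IsInv n (extN π) := by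
  intro x hx
  have h1 := extN_val π ⟨x, hx⟩
  have h2 := extN_val π (π ⟨x, hx⟩)
  simp only [h] at h1 h2
  rw [h1]
  exact ⟨(π ⟨x, hx⟩).2, h2⟩

theorem inv_of_extN {n : ℕ} (π : Equiv.Perm (Fin n)) (h : IsInv n (extN π)) (j : Fin n) :
    π (π j) = j := by
  have := (h j j.2).2
  rw [extN_val, extN_val] at this
  exact Fin.ext this

theorem perm_ext {n : ℕ} (π σ : Equiv.Perm (Fin n)) (h : ∀ x < n, extN π x = extN σ x) :
    π = σ := by
  ext x
  have := h x x.2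
  rwa [extN_val, extN_val] at this

/-- number of fixed points below `n` -/
def fixN (n : ℕ) (g : ℕ → ℕ) : ℕ := ((range n).filter (fun x => g x = x)).card

/-- number of inversions below `n` -/
def invN (n : ℕ) (g : ℕ → ℕ) : ℕ :=
  ∑ x ∈ range n, ∑ y ∈ range n, if x < y ∧ g y < g x then 1 else 0

theorem fix_eq {n : ℕ} (π : Equiv.Perm (Fin n)) : fixedPointCount π = fixN n (extN π) := by
  unfold fixedPointCount fixN
  rw [card_filter, card_filter, ← Fin.sum_univ_eq_sum_range (fun x => if extN π x = x then 1 else 0)]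
  simp only [extN_val, Fin.val_inj]

theorem inversions_eq {n : ℕ} (π : Equiv.Perm (Fin n)) : inversions π = invN n (extN π) := by
  unfold inversions invN
  rw [card_filter, Fintype.sum_prod_type]
  rw [← Fin.sum_univ_eq_sum_range
    (fun x => ∑ y ∈ range n, if x < y ∧ extN π y < extN π x then 1 else 0)]
  refine sum_congr rfl fun x _ => ?_
  rw [← Fin.sum_univ_eq_sum_range
    (fun y => if (x : ℕ) < y ∧ extN π y < extN π x then 1 else 0)]
  simp only [extN_val, Fin.lt_def]

/-- occurrence of 132 at `i,j,k` -/
def Oc (n : ℕ) (g : ℕ → ℕ) (i j k : ℕ) : Prop := i < j ∧ j < k ∧ k < n ∧ g i < g k ∧ g k < g j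

theorem occ_iff {n : ℕ} (π : Equiv.Perm (Fin n)) (f : Fin 3 → Fin n) :
    ((∀ a b : Fin 3, a < b → f a < f b) ∧
    (∀ a b : Fin 3, p132 a < p132 b ↔ π (f a) < π (f b))) ↔
      Oc n (extN π) (f 0) (f 1) (f 2) := by
  have e0 : p132 0 = 0 := by decide
  have e1 : p132 1 = 2 := by decide
  have e2 : p132 2 = 1 := by decide
  unfold Oc
  simp only [extN_val]
  constructor
  · rintro ⟨h1, h2⟩
    refine ⟨h1 0 1 (by decide), h1 1 2 (by decide), (f 2).2, (h2 0 2).1 ?_, (h2 2 1).1 ?_⟩ <;>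
      simp [e0, e1, e2]
  · rintro ⟨h1, h2, _, h3, h4⟩
    have h5 := h3.trans h4
    have h6 := h1.trans h2
    constructor
    · intro a b hab
      fin_cases a <;> fin_cases b <;> first | (exact absurd hab (by decide)) | assumption
    · intro a b
      simp only [Fin.lt_def] at *
      fin_cases a <;> fin_cases b <;> simp [e0, e1, e2] <;> omega

theorem occ_zero {n : ℕ} (π : Equiv.Perm (Fin n)) :
    occ p132 π = 0 ↔ ∀ i j k, ¬ Oc n (extN π) i j k := by
  unfold occ
  rw [card_eq_zero, filter_eq_empty_iff]
  constructor
  · intro h i j k ho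
    have hh := ho
    obtain ⟨h1, h2, h3, -⟩ := hh
    refine h (x := ![⟨i, by omega⟩, ⟨j, by omega⟩, ⟨k, by omega⟩]) (mem_univ _) ((occ_iff π _).2 ?_)
    simpa using ho
  · intro h f _ hf
    exact h _ _ _ ((occ_iff π _).1 hf)

theorem occ_one {n : ℕ} (π : Equiv.Perm (Fin n)) :
    occ p132 π = 1 ↔ ∃ a b c, Oc n (extN π) a b c ∧
      ∀ i j k, Oc n (extN π) i j k → i = a ∧ j = b ∧ k = c := by
  unfold occ
  rw [card_eq_one]
  constructor
  · rintro ⟨f, hf⟩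
    have hm : f ∈ ({f} : Finset (Fin 3 → Fin n)) := mem_singleton_self f
    rw [← hf, mem_filter] at hm
    refine ⟨_, _, _, (occ_iff π _).1 hm.2, ?_⟩
    intro i j k ho
    have hh := ho
    obtain ⟨h1, h2, h3, -⟩ := hh
    have : ![⟨i, by omega⟩, ⟨j, by omega⟩, ⟨k, by omega⟩] ∈ ({f} : Finset (Fin 3 → Fin n)) := by
      rw [← hf, mem_filter]
      exact ⟨mem_univ _, (occ_iff π _).2 (by simpa using ho)⟩
    rw [mem_singleton] at this
    subst this
    simp
  · rintro ⟨a, b, c, ho, hu⟩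
    have hh := ho
    obtain ⟨h1, h2, h3, -⟩ := hh
    refine ⟨![⟨a, by omega⟩, ⟨b, by omega⟩, ⟨c, by omega⟩], ?_⟩
    ext f
    rw [mem_filter, mem_singleton]
    constructor
    · rintro ⟨-, hf⟩
      obtain ⟨e1, e2, e3⟩ := hu _ _ _ ((occ_iff π _).1 hf)
      funext x
      fin_cases x <;> apply Fin.ext <;> simpa
    · rintro rfl
      exact ⟨mem_univ _, (occ_iff π _).2 (by simpa using ho)⟩

/-- normal form of a 132-avoiding involution with first fixed point `f` -/
structure Str0 (N t f : ℕ) (g : ℕ → ℕ) : Prop where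
  inv : IsInv N g
  htN : t ≤ N
  lo : ∀ x < t, t ≤ g x
  hi : ∀ x, t ≤ x → x < N → g x = x ∨ g x < t
  tf : t ≤ f
  fN : f < N
  ff : g f = f
  fmin : ∀ x < f, g x ≠ x
  av : ∀ i j k, ¬ Oc N g i j k

/-- normal form of an involution with exactly one 132 -/
structure Str1 (n t c : ℕ) (g : ℕ → ℕ) : Prop where
  inv : IsInv n g
  lo : ∀ x < t, t + 2 ≤ g x
  gt : g t = t
  gt1 : g (t + 1) = c
  gc : g c = t + 1
  tc : t + 2 ≤ c
  cn : c < n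
  hi : ∀ x, t + 2 ≤ x → x < n → x ≠ c → g x = x ∨ g x < t
  cmin : ∀ x, t + 2 ≤ x → x < c → g x ≠ x
  one : ∀ i j k, Oc n g i j k → i = t ∧ j = t + 1 ∧ k = c

def up (t f : ℕ) (g : ℕ → ℕ) (x : ℕ) : ℕ :=
  if x < t then g x + 2 else if x = t then t else if x = t + 1 then f + 2
  else if x = f + 2 then t + 1 else if g (x - 2) < t then g (x - 2) else x

def down (t : ℕ) (g : ℕ → ℕ) (x : ℕ) : ℕ :=
  if x < t then g x - 2 else if g (x + 2) < t then g (x + 2) else x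

theorem downset_eq_range (S : Finset ℕ) (h : ∀ x ∈ S, ∀ y < x, y ∈ S) : S = range S.card := by
  have key : ∀ x ∈ S, x < S.card := by
    intro x hx
    have : range (x + 1) ⊆ S := by
      intro y hy
      rw [mem_range] at hy
      rcases Nat.lt_or_ge y x with h1 | h1
      · exact h x hx y h1
      · have : y = x := by omega
        exact this ▸ hx
    have := card_le_card this
    rw [card_range] at this
    omega
  refine eq_of_subset_of_card_le (fun x hx => mem_range.2 (key x hx)) (by simp)

theorem card_op_cl {N : ℕ} {g : ℕ → ℕ} (h : IsInv N g) :
    ((range N).filter (fun x => x < g x)).card = ((range N).filter (fun x => g x < x)).card := by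
  refine card_nbij' g g ?_ ?_ ?_ ?_ <;> intro x hx <;>
    simp only [coe_filter, mem_range, Set.mem_ofPred_eq] at hx ⊢ <;>
    have := h x hx.1 <;> omega

theorem card_inv {N : ℕ} {g : ℕ → ℕ} (h : IsInv N g) :
    N = 2 * ((range N).filter (fun x => x < g x)).card + fixN N g := by
  have h1 := card_op_cl h
  have h2 := card_filter_add_card_filter_not (s := range N) (fun x => x < g x)
  have h3 := card_filter_add_card_filter_not (s := (range N).filter (fun x => ¬ x < g x))
    (fun x => g x = x)
  rw [filter_filter, filter_filter] at h3
  have e1 : (range N).filter (fun x => ¬ x < g x ∧ g x = x) = (range N).filter (fun x => g x = x) := by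
    apply filter_congr; intros; omega
  have e2 : (range N).filter (fun x => ¬ x < g x ∧ ¬ g x = x) =
      (range N).filter (fun x => g x < x) := by
    apply filter_congr; intros; omega
  rw [e1, e2] at h3
  rw [card_range] at h2
  unfold fixN
  omega

theorem str0_op {N t f : ℕ} {g : ℕ → ℕ} (h : Str0 N t f g) :
    (range N).filter (fun x => x < g x) = range t := by
  ext x
  simp only [mem_filter, mem_range]
  have h1 := h.lo x
  have h2 := h.hi x
  have := h.htN
  omega

theorem str0_fix {N t f : ℕ} {g : ℕ → ℕ} (h : Str0 N t f g) : N = 2 * t + fixN N g := by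
  have := card_inv h.inv
  rwa [str0_op h, card_range] at this

theorem str1_fix {n t c : ℕ} {g : ℕ → ℕ} (h : Str1 n t c g) : n = 2 * (t + 1) + fixN n g := by
  have := card_inv h.inv
  have e : (range n).filter (fun x => x < g x) = insert (t + 1) (range t) := by
    ext x
    simp only [mem_filter, mem_range, mem_insert]
    have h1 := h.lo x
    have h2 := h.hi x
    have h3 := h.cn
    have h4 := h.tc
    have h5 := h.gt
    have h6 := h.gt1
    have h7 := h.gc
    constructor
    · intro h8
      by_contra hc
      by_cases x = t
      · subst x; omega
      by_cases x = c
      · subst x; omega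
      omega
    · rintro (rfl | h8) <;> omega
  rwa [e, card_insert_of_notMem (by simp), card_range] at this

theorem exists_str0 {N : ℕ} {g : ℕ → ℕ} (h : IsInv N g) (av : ∀ i j k, ¬ Oc N g i j k)
    (hp : 1 ≤ fixN N g) : Str0 N ((N - fixN N g) / 2) (sInf {x | g x = x}) g := by
  have hc := card_inv h
  set O := (range N).filter (fun x => x < g x) with hO
  have hd : O = range O.card := by
    apply downset_eq_range
    intro x hx y hy
    rw [hO, mem_filter, mem_range] at hx ⊢
    refine ⟨by omega, ?_⟩
    by_contra hn
    have h1 := h x hx.1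
    have h2 := h y (by omega)
    by_cases hfix : g y = y
    · exact av y x (g x) ⟨hy, hx.2, h1.1, by omega, by omega⟩
    · exact av (g y) x (g x) ⟨by omega, hx.2, h1.1, by omega, by omega⟩
  have ht : (N - fixN N g) / 2 = O.card := by omega
  rw [ht]
  set t := O.card with hteq
  have hmem : ∀ x, (x < N ∧ x < g x) ↔ x < t := by
    intro x
    rw [← mem_range (n := t), ← hd, hO, mem_filter, mem_range]
  have hne : ((range N).filter (fun x => g x = x)).Nonempty := by
    rw [← card_pos]; exact hp
  obtain ⟨w, hw⟩ := hne
  rw [mem_filter, mem_range] at hw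
  have hf : g (sInf {x | g x = x}) = sInf {x | g x = x} := Nat.sInf_mem (s := {x | g x = x}) ⟨w, hw.2⟩
  have hfw : sInf {x | g x = x} ≤ w := Nat.sInf_le hw.2
  have hmin : ∀ x < sInf {x | g x = x}, g x ≠ x := fun x hx => Nat.notMem_of_lt_sInf (s := {x | g x = x}) hx
  generalize sInf {x | g x = x} = f at *
  refine ⟨h, by omega, ?_, ?_, ?_, by omega, hf, hmin, av⟩
  · intro x hx
    have h1 := (hmem x).2 hx
    have h2 := hmem (g x)
    have := h x h1.1
    omega
  · intro x hx hxN
    have h1 := hmem x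
    have h2 := hmem (g x)
    have := h x hxN
    omega
  · have := hmem f
    omega

theorem exists_str1 {n : ℕ} {g : ℕ → ℕ} (h : IsInv n g) (hone : ∃ a b c, Oc n g a b c ∧
      ∀ i j k, Oc n g i j k → i = a ∧ j = b ∧ k = c) :
    Str1 n ((n - 2 - fixN n g) / 2) (g ((n - 2 - fixN n g) / 2 + 1)) g := by
  obtain ⟨a, b, c, ho, hu⟩ := hone
  have hh := ho
  obtain ⟨h1, h2, h3, h4, h5⟩ := hh
  have ia := h a (by omega)
  have ib := h b (by omega)
  have ic := h c (by omega)
  have hs := hu (g a) (g c) (g b) ⟨h4, h5, ib.1, by omega, by omega⟩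
  obtain ⟨ga, gc, gb⟩ := hs
  have hc := card_inv h
  set O := (range n).filter (fun x => x < g x) with hO
  have hbO : b ∈ O := by rw [hO, mem_filter, mem_range]; omega
  -- fixed points before openers
  have fo : ∀ w i, w < i → i < n → g w = w → i < g i → w = a ∧ i = b := by
    intro w i hw hi e1 e2
    have := hu w i (g i) ⟨hw, e2, (h i hi).1, by have := (h i hi).2; omega, by
      have := (h i hi).2; omega⟩
    exact ⟨this.1, this.2.1⟩
  have co : ∀ y i, y < i → i < n → g y < y → g i ≤ i := by
    intro y i hw hi e1
    by_contra! e2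
    have i1 := h i hi
    have i2 := h y (by omega)
    have := hu (g y) i (g i) ⟨by omega, e2, i1.1, by omega, by omega⟩
    have h7 : y = g a := by rw [← this.1]; exact i2.2.symm
    omega
  have hd : O.erase b = range (O.erase b).card := by
    apply downset_eq_range
    intro x hx y hy
    rw [mem_erase, hO, mem_filter, mem_range] at hx ⊢
    obtain ⟨hxb, hxn, hxg⟩ := hx
    have f1 := fo y x hy hxn
    have f2 := co y x hy hxn
    refine ⟨?_, by omega, by omega⟩
    rintro rfl
    have := fo a x (by omega) hxn
    omega
  rw [card_erase_of_mem hbO] at hd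
  have hpos : 0 < O.card := card_pos.2 ⟨b, hbO⟩
  have ht : (n - 2 - fixN n g) / 2 = O.card - 1 := by omega
  rw [ht]
  generalize O.card - 1 = t at *
  have hmem : ∀ x, (x ≠ b ∧ x < n ∧ x < g x) ↔ x < t := by
    intro x
    rw [← mem_range (n := t), ← hd, mem_erase, hO, mem_filter, mem_range]
  have mt := hmem t
  have ma := hmem a
  have mb := hmem b
  have hbt : t ≤ b := by omega
  have hat : a = t := by
    have := fo t b
    have := co t b
    by_cases h7 : t = b
    · omega
    · omega
  have hb1 : b = t + 1 := by
    by_contra hne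
    have m1 := hmem (t + 1)
    have := fo (t + 1) b
    have := co (t + 1) b
    omega
  subst hat hb1
  refine ⟨h, ?_, ga, rfl, by omega, by omega, by omega, ?_, ?_, ?_⟩
  · intro x hx
    have m1 := (hmem x).2 hx
    have m2 := hmem (g x)
    have := h x m1.2.1
    by_contra hlt
    have : g x = a ∨ g x = a + 1 := by omega
    rcases this with e | e <;> rw [e] at this m2 <;> omega
  · intro x hx hxn hxc
    have m1 := hmem x
    have m2 := hmem (g x)
    have := h x hxn
    by_cases e : g x = a + 1
    · rw [e] at this; omega
    · omega
  · intro x hx hxc hfix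
    have := hu a (a + 1) x ⟨by omega, by omega, by omega, by omega, by omega⟩
    omega
  · intro i j k ho
    have := hu i j k ho
    omega

theorem up_str1 {N t f : ℕ} {g : ℕ → ℕ} (h : Str0 N t f g) :
    Str1 (N + 2) t (f + 2) (up t f g) := by
  obtain ⟨inv, htN, lo, hi, tf, fN, ff, fmin, av⟩ := h
  have u1 : ∀ x < t, up t f g x = g x + 2 := by intro x hx; simp [up, hx]
  have u2 : up t f g t = t := by simp [up]
  have u3 : up t f g (t + 1) = f + 2 := by simp [up]
  have u4 : up t f g (f + 2) = t + 1 := by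
    unfold up; split_ifs <;> omega
  have u5 : ∀ x, t ≤ x → x < N → x ≠ f → g x < t → up t f g (x + 2) = g x := by
    intro x h1 h2 h3 h4
    unfold up
    simp only [Nat.add_sub_cancel]
    split_ifs <;> omega
  have u6 : ∀ x, t ≤ x → x < N → x ≠ f → g x = x → up t f g (x + 2) = x + 2 := by
    intro x h1 h2 h3 h4
    unfold up
    simp only [Nat.add_sub_cancel]
    split_ifs <;> omega
  -- classification of positions below `N + 2`
  have cls : ∀ y < N + 2, (y < t ∧ up t f g y = g y + 2 ∧ t ≤ g y ∧ g y < N ∧ g (g y) = y ∧ g y ≠ f)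
      ∨ (y = t ∧ up t f g y = t)
      ∨ (y = t + 1 ∧ up t f g y = f + 2) ∨ (y = f + 2 ∧ up t f g y = t + 1) ∨
      (∃ x, y = x + 2 ∧ t ≤ x ∧ x < N ∧ x ≠ f ∧ g x < t ∧ g (g x) = x ∧ up t f g y = g x) ∨
      (∃ x, y = x + 2 ∧ f < x ∧ x < N ∧ g x = x ∧ up t f g y = x + 2) := by
    intro y hy
    by_cases c1 : y < t
    · left
      have := inv y (by omega)
      refine ⟨c1, u1 y c1, lo y c1, this.1, this.2, ?_⟩
      intro e
      rw [e] at this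
      omega
    right
    by_cases c2 : y = t
    · subst c2; exact Or.inl ⟨rfl, u2⟩
    right
    by_cases c3 : y = t + 1
    · subst c3; exact Or.inl ⟨rfl, u3⟩
    right
    by_cases c4 : y = f + 2
    · subst c4; exact Or.inl ⟨rfl, u4⟩
    right
    obtain ⟨x, rfl⟩ : ∃ x, y = x + 2 := ⟨y - 2, by omega⟩
    have := inv x (by omega)
    rcases hi x (by omega) (by omega) with e | e
    · right
      refine ⟨x, rfl, ?_, by omega, e, u6 x (by omega) (by omega) (by omega) e⟩
      have := fmin x
      omega
    · left
      exact ⟨x, rfl, by omega, by omega, by omega, e, this.2,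
        u5 x (by omega) (by omega) (by omega) e⟩
  refine ⟨?_, ?_, u2, u3, u4, by omega, by omega, ?_, ?_, ?_⟩
  · intro y hy
    rcases cls y hy with ⟨c1, e, c2, c3, c4, c5⟩ | ⟨c1, e⟩ | ⟨c1, e⟩ | ⟨c1, e⟩ |
      ⟨x, c1, c2, c3, c4, c5, c6, e⟩ | ⟨x, c1, c2, c3, c4, e⟩
    · rw [e, u5 _ c2 c3 c5 (by omega)]
      omega
    · rw [e, u2]; omega
    · rw [e, u4]; omega
    · rw [e, u3]; omega
    · rw [e, u1 _ c5]; omega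
    · rw [e, u6 _ (by omega) c3 (by omega) c4]; omega
  · intro x hx
    rw [u1 x hx]
    have := lo x hx
    omega
  · intro y h1 h2 h3
    rcases cls y h2 with ⟨c1, e, c2, c3, c4, c5⟩ | ⟨c1, e⟩ | ⟨c1, e⟩ | ⟨c1, e⟩ |
      ⟨x, c1, c2, c3, c4, c5, c6, e⟩ | ⟨x, c1, c2, c3, c4, e⟩ <;> omega
  · intro y h1 h2
    rcases cls y (by omega) with ⟨c1, e, c2, c3, c4, c5⟩ | ⟨c1, e⟩ | ⟨c1, e⟩ | ⟨c1, e⟩ |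
      ⟨x, c1, c2, c3, c4, c5, c6, e⟩ | ⟨x, c1, c2, c3, c4, e⟩ <;> omega
  · rintro i j k ⟨h1, h2, h3, h4, h5⟩
    have A : ∀ a b c, a < b → b < c → c < N → g a < g c → g b ≤ g c := by
      intro a b c l1 l2 l3 l4
      by_contra! l5
      exact av a b c ⟨l1, l2, l3, l4, l5⟩
    rcases cls i (by omega) with ⟨c1, e, c2, c3, c4, c5⟩ | ⟨c1, e⟩ | ⟨c1, e⟩ | ⟨c1, e⟩ |
      ⟨x, c1, c2, c3, c4, c5, c6, e⟩ | ⟨x, c1, c2, c3, c4, e⟩ <;>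
    rcases cls j (by omega) with ⟨d1, e', d2, d3, d4, d5⟩ | ⟨d1, e'⟩ | ⟨d1, e'⟩ | ⟨d1, e'⟩ |
      ⟨x', d1, d2, d3, d4, d5, d6, e'⟩ | ⟨x', d1, d2, d3, d4, e'⟩ <;>
    rcases cls k (by omega) with ⟨f1, e'', f2, f3, f4, f5⟩ | ⟨f1, e''⟩ | ⟨f1, e''⟩ | ⟨f1, e''⟩ |
      ⟨x'', f1, f2, f3, f4, f5, f6, e''⟩ | ⟨x'', f1, f2, f3, f4, e''⟩ <;>
    first
      | omega
      | (exfalso; have := A i j k; omega)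
      | (exfalso; have := A i j f; omega)
      | (exfalso; have := A i j x''; omega)
      | (exfalso; have := A x x' x''; omega)
      | (exfalso; have := A x f x''; omega)

theorem down_str0 {N t c : ℕ} {g : ℕ → ℕ} (h : Str1 (N + 2) t c g) :
    Str0 N t (c - 2) (down t g) := by
  obtain ⟨inv, lo, gt, gt1, gc, tc, cn, hi, cmin, one⟩ := h
  have u1 : ∀ x < t, down t g x = g x - 2 := by intro x hx; simp [down, hx]
  have u5 : ∀ x, t ≤ x → g (x + 2) < t → down t g x = g (x + 2) := by
    intro x h1 h2
    unfold down; split_ifs <;> omega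
  have u6 : ∀ x, t ≤ x → t ≤ g (x + 2) → down t g x = x := by
    intro x h1 h2
    unfold down; split_ifs <;> omega
  have cls : ∀ y < N, (∃ z, y < t ∧ g y = z + 2 ∧ down t g y = z ∧ t ≤ z ∧ z < N ∧ g (z + 2) = y ∧
        z + 2 ≠ c)
      ∨ (y + 2 = c ∧ down t g y = y) ∨
      (t ≤ y ∧ y + 2 ≠ c ∧ g (y + 2) < t ∧ g (g (y + 2)) = y + 2 ∧ down t g y = g (y + 2)) ∨
      (t ≤ y ∧ c < y + 2 ∧ g (y + 2) = y + 2 ∧ down t g y = y) := by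
    intro y hy
    by_cases c1 : y < t
    · left
      have i1 := inv y (by omega)
      have i2 := lo y c1
      obtain ⟨z, hz⟩ : ∃ z, g y = z + 2 := ⟨g y - 2, by omega⟩
      rw [hz] at i1 i2
      refine ⟨z, c1, hz, by rw [u1 y c1]; omega, by omega, by omega, i1.2, ?_⟩
      intro e
      rw [e] at i1
      omega
    right
    by_cases c2 : y + 2 = c
    · left; exact ⟨c2, u6 y (by omega) (by rw [c2]; omega)⟩
    right
    rcases hi (y + 2) (by omega) (by omega) c2 with e | e
    · right
      have := cmin (y + 2)
      exact ⟨by omega, by omega, e, u6 y (by omega) (by omega)⟩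
    · left
      exact ⟨by omega, c2, e, (inv (y + 2) (by omega)).2, u5 y (by omega) e⟩
  have hfN : c - 2 + 2 = c := by omega
  have tN : t ≤ N := by omega
  refine ⟨?_, tN, ?_, ?_, by omega, by omega, ?_, ?_, ?_⟩
  · intro y hy
    rcases cls y hy with ⟨z, c1, c2, c3, c4, c5, c6, c7⟩ | ⟨c1, c2⟩ | ⟨c1, c2, c3, c4, c5⟩ |
      ⟨c1, c2, c3, c4⟩
    · rw [c3, u5 z c4 (by omega)]; omega
    · rw [c2, c2]; omega
    · rw [c5, u1 _ c3]; omega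
    · rw [c4, c4]; omega
  · intro y hy
    rcases cls y (by omega) with ⟨z, c1, c2, c3, c4, c5, c6, c7⟩ | ⟨c1, c2⟩ |
      ⟨c1, c2, c3, c4, c5⟩ | ⟨c1, c2, c3, c4⟩ <;> omega
  · intro y hy1 hy
    rcases cls y (by omega) with ⟨z, c1, c2, c3, c4, c5, c6, c7⟩ | ⟨c1, c2⟩ |
      ⟨c1, c2, c3, c4, c5⟩ | ⟨c1, c2, c3, c4⟩ <;> omega
  · apply u6 _ (by omega)
    rw [hfN]; omega
  · intro y hy
    rcases cls y (by omega) with ⟨z, c1, c2, c3, c4, c5, c6, c7⟩ | ⟨c1, c2⟩ |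
      ⟨c1, c2, c3, c4, c5⟩ | ⟨c1, c2, c3, c4⟩ <;> omega
  · rintro i j k ⟨h1, h2, h3, h4, h5⟩
    have A : ∀ a b c', a < b → b < c' → c' < N + 2 → g a < g c' → (a ≠ t ∨ b ≠ t + 1) →
        g b ≤ g c' := by
      intro a b c l1 l2 l3 l4 l5
      by_contra! l6
      have := one a b c ⟨l1, l2, l3, l4, l6⟩
      omega
    rcases cls i (by omega) with ⟨z, c1, c2, c3, c4, c5, c6, c7⟩ | ⟨c1, c2⟩ |
      ⟨c1, c2, c3, c4, c5⟩ | ⟨c1, c2, c3, c4⟩ <;>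
    rcases cls j (by omega) with ⟨z', d1, d2, d3, d4, d5, d6, d7⟩ | ⟨d1, d2⟩ |
      ⟨d1, d2, d3, d4, d5⟩ | ⟨d1, d2, d3, d4⟩ <;>
    rcases cls k (by omega) with ⟨z'', f1, f2, f3, f4, f5, f6, f7⟩ | ⟨f1, f2⟩ |
      ⟨f1, f2, f3, f4, f5⟩ | ⟨f1, f2, f3, f4⟩ <;>
    first
      | omega
      | (exfalso; have := A i j k; omega)
      | (exfalso; have := A i j (t + 1); omega)
      | (exfalso; have := A i j (k + 2); omega)
      | (exfalso; have := A (i + 2) (j + 2) (k + 2); omega)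
      | (exfalso; subst d1; have := A (i + 2) (j + 2) (k + 2); omega)

theorem down_up {N t f : ℕ} {g : ℕ → ℕ} (h : Str0 N t f g) :
    ∀ x < N, down t (up t f g) x = g x := by
  obtain ⟨inv, htN, lo, hi, tf, fN, ff, fmin, av⟩ := h
  intro x hx
  have h1 := lo x
  have h2 := hi x
  by_cases e : x = f
  · subst e
    unfold down up
    split_ifs <;> omega
  · unfold down up
    simp only [Nat.add_sub_cancel]
    split_ifs <;> omega

theorem up_down {N t c : ℕ} {g : ℕ → ℕ} (h : Str1 (N + 2) t c g) :
    ∀ x < N + 2, up t (c - 2) (down t g) x = g x := by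
  obtain ⟨inv, lo, gt, gt1, gc, tc, cn, hi, cmin, one⟩ := h
  intro x hx
  have h1 := lo x
  have h2 := hi x
  by_cases e : x = t
  · subst e; simp [up, gt]
  by_cases e : x = t + 1
  · subst e
    have : c - 2 + 2 = c := by omega
    simp [up, gt1, this]
  by_cases e : x = c
  · subst e
    unfold up
    split_ifs <;> omega
  by_cases e : x < t
  · simp [up, down, e]; omega
  · have : x - 2 + 2 = x := by omega
    unfold up down
    simp only [this]
    split_ifs <;> omega

theorem card_cl {N t f : ℕ} {g : ℕ → ℕ} (h : Str0 N t f g) :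
    (∑ x ∈ range N, if t ≤ x ∧ g x < t then 1 else 0) = t := by
  have h1 := card_op_cl h.inv
  rw [str0_op h, card_range] at h1
  rw [← card_filter, h1]
  congr 1
  apply filter_congr
  intro x hx
  rw [mem_range] at hx
  have h1 := h.lo x
  have := h.hi x
  omega

/-- splitting a sum over `range (N+2)` by removing the two indices `t`, `t+1` -/
theorem sum_split (N t : ℕ) (ht : t ≤ N) (F : ℕ → ℕ) :
    ∑ x ∈ range (N + 2), F x =
      (∑ x ∈ range N, F (if x < t then x else x + 2)) + F t + F (t + 1) := by
  obtain ⟨m, rfl⟩ := Nat.exists_eq_add_of_le ht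
  have e1 : t + m + 2 = t + (2 + m) := by ring
  rw [e1, sum_range_add, sum_range_add, sum_range_add, sum_range_succ, sum_range_one]
  have a1 : ∑ x ∈ range t, F (if x < t then x else x + 2) = ∑ x ∈ range t, F x := by
    refine sum_congr rfl fun x hx => ?_
    rw [if_pos (mem_range.1 hx)]
  have a2 : ∑ x ∈ range m, F (if t + x < t then t + x else t + x + 2) =
      ∑ x ∈ range m, F (t + (2 + x)) := by
    refine sum_congr rfl fun x hx => ?_
    rw [if_neg (by omega)]
    congr 1
    ring
  rw [a1, a2]
  simp only [add_zero]
  ring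

theorem inv_up {N t f : ℕ} {g : ℕ → ℕ} (h : Str0 N t f g) :
    invN (N + 2) (up t f g) = invN N g + (4 * t + 1) := by
  have hcl := card_cl h
  obtain ⟨inv, htN, lo, hi, tf, fN, ff, fmin, av⟩ := h
  have u2 : up t f g t = t := by simp [up]
  have u3 : up t f g (t + 1) = f + 2 := by simp [up]
  set e : ℕ → ℕ := fun x => if x < t then x else x + 2 with he
  set π := up t f g with hπ
  -- values of `π` along `e`
  have cls : ∀ x < N, (x < t ∧ e x = x ∧ π (e x) = g x + 2 ∧ t ≤ g x ∧ g x ≠ f) ∨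
      (x = f ∧ e x = x + 2 ∧ π (e x) = t + 1 ∧ g x = x) ∨
      (t ≤ x ∧ x ≠ f ∧ e x = x + 2 ∧ π (e x) = g x ∧ g x < t) ∨
      (f < x ∧ e x = x + 2 ∧ π (e x) = x + 2 ∧ g x = x) := by
    intro x hx
    by_cases c1 : x < t
    · left
      have e1 : e x = x := by simp [he, c1]
      refine ⟨c1, e1, by rw [e1]; simp [hπ, up, c1], lo x c1, ?_⟩
      intro e2
      have := inv x hx
      rw [e2] at this
      omega
    right
    have e1 : e x = x + 2 := by simp [he, c1]
    rw [e1]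
    by_cases c2 : x = f
    · left
      refine ⟨c2, rfl, ?_, by rw [c2, ff]⟩
      rw [hπ]; unfold up; split_ifs <;> omega
    right
    have e2 : π (x + 2) = if g x < t then g x else x + 2 := by
      rw [hπ]; unfold up
      simp only [Nat.add_sub_cancel]
      split_ifs <;> omega
    have := hi x
    have := fmin x
    rw [e2]
    split_ifs with c3
    · left; exact ⟨by omega, c2, rfl, rfl, c3⟩
    · right; exact ⟨by omega, rfl, rfl, by omega⟩
  unfold invN
  rw [sum_split N t htN]
  simp only [sum_split N t htN (fun y => if _ ∧ π y < _ then 1 else 0)]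
  change (∑ x ∈ range N, (∑ y ∈ range N, (if e x < e y ∧ π (e y) < π (e x) then 1 else 0)
     + (if e x < t ∧ π t < π (e x) then 1 else 0) + (if e x < t + 1 ∧ π (t + 1) < π (e x) then 1 else 0)))
     + (∑ y ∈ range N, (if t < e y ∧ π (e y) < π t then 1 else 0)
     + (if t < t ∧ π t < π t then 1 else 0) + (if t < t + 1 ∧ π (t + 1) < π t then 1 else 0))
     + (∑ y ∈ range N, (if t + 1 < e y ∧ π (e y) < π (t + 1) then 1 else 0)
     + (if t + 1 < t ∧ π t < π (t + 1) then 1 else 0)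
     + (if t + 1 < t + 1 ∧ π (t + 1) < π (t + 1) then 1 else 0)) = _
  have s1 : ∀ x ∈ range N, (∑ y ∈ range N, (if e x < e y ∧ π (e y) < π (e x) then 1 else 0)) =
      (∑ y ∈ range N, (if x < y ∧ g y < g x then 1 else 0)) +
        (if x < t ∧ g x < f then 1 else 0) := by
    intro x hx
    rw [mem_range] at hx
    have : (if x < t ∧ g x < f then 1 else 0) =
        ∑ y ∈ range N, (if y = f then (if x < t ∧ g x < f then 1 else 0) else 0) := by
      rw [sum_ite_eq' (range N) f, if_pos (mem_range.2 fN)]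
    rw [this, ← sum_add_distrib]
    refine sum_congr rfl fun y hy => ?_
    rw [mem_range] at hy
    rcases cls x hx with c | c | c | c <;> rcases cls y hy with d | d | d | d <;>
      split_ifs <;> first | rfl | omega
  simp only [sum_add_distrib]
  rw [sum_congr rfl s1, sum_add_distrib]
  have s2 : ∀ x ∈ range N, (if e x < t ∧ π t < π (e x) then 1 else 0) = if x < t then 1 else 0 := by
    intro x hx
    rw [mem_range] at hx
    rw [u2]
    rcases cls x hx with c | c | c | c <;> split_ifs <;> first | rfl | omega
  have s3 : ∀ x ∈ range N, (if e x < t + 1 ∧ π (t + 1) < π (e x) then 1 else 0) +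
      (if x < t ∧ g x < f then 1 else 0) = if x < t then 1 else 0 := by
    intro x hx
    rw [mem_range] at hx
    rw [u3]
    rcases cls x hx with c | c | c | c <;> split_ifs <;> first | rfl | omega
  have s4 : ∀ x ∈ range N, (if t < e x ∧ π (e x) < π t then 1 else 0) =
      if t ≤ x ∧ g x < t then 1 else 0 := by
    intro x hx
    rw [mem_range] at hx
    rw [u2]
    rcases cls x hx with c | c | c | c <;> split_ifs <;> first | rfl | omega
  have s5 : ∀ x ∈ range N, (if t + 1 < e x ∧ π (e x) < π (t + 1) then 1 else 0) =
      (if t ≤ x ∧ g x < t then 1 else 0) + if x = f then 1 else 0 := by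
    intro x hx
    rw [mem_range] at hx
    rw [u3]
    rcases cls x hx with c | c | c | c <;> split_ifs <;> first | rfl | omega
  have s3' := sum_congr rfl s3
  rw [sum_add_distrib] at s3'
  have st : (∑ x ∈ range N, if x < t then 1 else 0) = t := by
    rw [← card_filter]
    have : (range N).filter (fun x => x < t) = range t := by
      ext x; simp only [mem_filter, mem_range]; omega
    rw [this, card_range]
  have sf : (∑ x ∈ range N, if x = f then 1 else 0) = 1 := by
    rw [sum_ite_eq' (range N) f, if_pos (mem_range.2 fN)]
  rw [st] at s3'
  simp only [u3] at s3'
  rw [sum_congr rfl s2, sum_congr rfl s4, sum_congr rfl s5, sum_add_distrib, hcl, st, sf, u2, u3,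
    if_neg (by omega), if_neg (by omega), if_neg (by omega), if_neg (by omega)]
  omega

theorem IsInv.congr {n : ℕ} {g g' : ℕ → ℕ} (h : IsInv n g) (e : ∀ x < n, g' x = g x) :
    IsInv n g' := by
  intro x hx
  have := h x hx
  rw [e x hx, e _ this.1]
  exact this

theorem Oc.congr {n : ℕ} {g g' : ℕ → ℕ} (e : ∀ x < n, g' x = g x) {i j k : ℕ}
    (h : Oc n g' i j k) : Oc n g i j k := by
  obtain ⟨h1, h2, h3, h4, h5⟩ := h
  rw [e i (by omega), e k (by omega)] at h4
  rw [e j (by omega), e k (by omega)] at h5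
  exact ⟨h1, h2, h3, h4, h5⟩

theorem Str0.congr {N t f : ℕ} {g g' : ℕ → ℕ} (h : Str0 N t f g) (e : ∀ x < N, g' x = g x) :
    Str0 N t f g' := by
  have h1 := h.htN
  have h2 := h.fN
  refine ⟨h.inv.congr e, h.htN, ?_, ?_, h.tf, h.fN, ?_, ?_, ?_⟩
  · intro x hx; rw [e x (by omega)]; exact h.lo x hx
  · intro x hx hx'; rw [e x hx']; exact h.hi x hx hx'
  · rw [e f h2]; exact h.ff
  · intro x hx; rw [e x (by omega)]; exact h.fmin x hx
  · intro i j k ho; exact h.av i j k (ho.congr e)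

theorem Str1.congr {n t c : ℕ} {g g' : ℕ → ℕ} (h : Str1 n t c g) (e : ∀ x < n, g' x = g x) :
    Str1 n t c g' := by
  have h1 := h.tc
  have h2 := h.cn
  refine ⟨h.inv.congr e, ?_, ?_, ?_, ?_, h.tc, h.cn, ?_, ?_, ?_⟩
  · intro x hx; rw [e x (by omega)]; exact h.lo x hx
  · rw [e _ (by omega)]; exact h.gt
  · rw [e _ (by omega)]; exact h.gt1
  · rw [e _ (by omega)]; exact h.gc
  · intro x hx hx'; rw [e x hx']; exact h.hi x hx hx'
  · intro x hx hx'; rw [e x (by omega)]; exact h.cmin x hx hx'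
  · intro i j k ho; exact h.one i j k (ho.congr e)

theorem Str1.occ {n t c : ℕ} {g : ℕ → ℕ} (h : Str1 n t c g) : Oc n g t (t + 1) c := by
  obtain ⟨inv, lo, gt, gt1, gc, tc, cn, hi, cmin, one⟩ := h
  refine ⟨by omega, by omega, by omega, by omega, by omega⟩

theorem Str0.f_eq {N t f : ℕ} {g : ℕ → ℕ} (h : Str0 N t f g) : sInf {x | g x = x} = f := by
  apply le_antisymm (Nat.sInf_le (s := {x | g x = x}) h.ff)
  by_contra! hlt
  exact h.fmin _ hlt (Nat.sInf_mem (s := {x | g x = x}) ⟨f, h.ff⟩)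

theorem invN_congr {n : ℕ} {g g' : ℕ → ℕ} (e : ∀ x < n, g' x = g x) : invN n g' = invN n g := by
  unfold invN
  refine sum_congr rfl fun x hx => sum_congr rfl fun y hy => ?_
  rw [e x (mem_range.1 hx), e y (mem_range.1 hy)]

/-- the insertion map -/
noncomputable def upP (N t : ℕ) (σ : Equiv.Perm (Fin N)) : Equiv.Perm (Fin (N + 2)) :=
  toPerm (N + 2) (up t (sInf {x | extN σ x = x}) (extN σ))

/-- the deletion map -/
noncomputable def downP (N t : ℕ) (π : Equiv.Perm (Fin (N + 2))) : Equiv.Perm (Fin N) :=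
  toPerm N (down t (extN π))

theorem mem0_iff {N p : ℕ} (hp : 1 ≤ p) (σ : Equiv.Perm (Fin N)) :
    ((∀ j, σ (σ j) = j) ∧ occ p132 σ = 0 ∧ fixedPointCount σ = p) ↔
      ((∃ f, Str0 N ((N - p) / 2) f (extN σ)) ∧ N = 2 * ((N - p) / 2) + p) := by
  rw [occ_zero, fix_eq]
  constructor
  · rintro ⟨h1, h2, h3⟩
    have := exists_str0 (extN_inv σ h1) h2 (by omega)
    rw [h3] at this
    have h4 := str0_fix this
    exact ⟨⟨_, this⟩, by omega⟩
  · rintro ⟨⟨f, h⟩, h2⟩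
    have h4 := str0_fix h
    exact ⟨inv_of_extN σ h.inv, h.av, by omega⟩

theorem mem1_iff {N p : ℕ} (π : Equiv.Perm (Fin (N + 2))) :
    ((∀ j, π (π j) = j) ∧ fixedPointCount π = p ∧ occ p132 π = 1) ↔
      ((∃ c, Str1 (N + 2) ((N - p) / 2) c (extN π)) ∧ N = 2 * ((N - p) / 2) + p) := by
  rw [occ_one, fix_eq]
  constructor
  · rintro ⟨h1, h2, h3⟩
    have := exists_str1 (extN_inv π h1) h3
    rw [h2, Nat.add_sub_cancel] at this
    have h4 := str1_fix this
    exact ⟨⟨_, this⟩, by omega⟩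
  · rintro ⟨⟨c, h⟩, h2⟩
    have h4 := str1_fix h
    exact ⟨inv_of_extN π h.inv, by omega, _, _, _, h.occ, h.one⟩

theorem extN_up {N t f : ℕ} {σ : Equiv.Perm (Fin N)} (h : Str0 N t f (extN σ)) :
    ∀ x < N + 2, extN (upP N t σ) x = up t f (extN σ) x := by
  intro x hx
  unfold upP
  rw [h.f_eq, extN_toPerm (up_str1 h).inv hx]

theorem extN_down {N t c : ℕ} {π : Equiv.Perm (Fin (N + 2))} (h : Str1 (N + 2) t c (extN π)) :
    ∀ x < N, extN (downP N t π) x = down t (extN π) x := by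
  intro x hx
  unfold downP
  rw [extN_toPerm (down_str0 h).inv hx]

theorem up_congr {N t f : ℕ} {g g' : ℕ → ℕ} (_htN : t ≤ N) (e : ∀ x < N, g' x = g x) :
    ∀ x < N + 2, up t f g' x = up t f g x := by
  intro x hx
  unfold up
  split_ifs with h1 h2 h3 h4 h5 h6 h7 <;> try rfl
  · rw [e x (by omega)]
  · rw [e _ (by omega)]
  · rw [e _ (by omega)] at h5; omega
  · rw [e _ (by omega)] at h5; omega

theorem down_congr {N t : ℕ} {g g' : ℕ → ℕ} (htN : t ≤ N) (e : ∀ x < N + 2, g' x = g x) :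
    ∀ x < N, down t g' x = down t g x := by
  intro x hx
  unfold down
  rw [e x (by omega), e (x + 2) (by omega)]

theorem downP_upP {N t f : ℕ} {σ : Equiv.Perm (Fin N)} (h : Str0 N t f (extN σ)) :
    downP N t (upP N t σ) = σ := by
  apply perm_ext
  intro x hx
  rw [extN_down ((up_str1 h).congr (extN_up h)) x hx, down_congr h.htN (extN_up h) x hx,
    down_up h x hx]

theorem upP_downP {N t c : ℕ} {π : Equiv.Perm (Fin (N + 2))} (h : Str1 (N + 2) t c (extN π)) :
    upP N t (downP N t π) = π := by
  apply perm_ext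
  intro x hx
  rw [extN_up ((down_str0 h).congr (extN_down h)) x hx,
    up_congr (down_str0 h).htN (extN_down h) x hx, up_down h x hx]

theorem inversions_upP {N t f : ℕ} {σ : Equiv.Perm (Fin N)} (h : Str0 N t f (extN σ)) :
    inversions (upP N t σ) = inversions σ + (4 * t + 1) := by
  rw [inversions_eq, inversions_eq, invN_congr (extN_up h), inv_up h]

/-- The number of involutions of length n with p fixed points and i inversions
containing 132 exactly once equals the number of 132-avoiding involutions of
length n−2 with p fixed points and i−2n+2p+3 inversions. -/
theorem psi_inversions (n p : ℕ) (hn : 3 ≤ n) (hp1 : 1 ≤ p) (hpn : p ≤ n) (i : ℤ) :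
    (Finset.univ.filter (fun π : Equiv.Perm (Fin n) =>
      (∀ j, π (π j) = j) ∧ fixedPointCount π = p ∧ (inversions π : ℤ) = i ∧
        occ p132 π = 1)).card
    = (Finset.univ.filter (fun σ : Equiv.Perm (Fin (n - 2)) =>
      (∀ j, σ (σ j) = j) ∧ occ p132 σ = 0 ∧ fixedPointCount σ = p ∧
        (inversions σ : ℤ) = i - 2 * n + 2 * p + 3)).card := by
  obtain ⟨N, rfl⟩ : ∃ N, n = N + 2 := ⟨n - 2, by omega⟩
  change _ = (Finset.univ.filter (fun σ : Equiv.Perm (Fin N) =>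
      (∀ j, σ (σ j) = j) ∧ occ p132 σ = 0 ∧ fixedPointCount σ = p ∧
        (inversions σ : ℤ) = i - 2 * (N + 2 : ℕ) + 2 * p + 3)).card
  have key0 : ∀ σ : Equiv.Perm (Fin N), ((∀ j, σ (σ j) = j) ∧ occ p132 σ = 0 ∧
      fixedPointCount σ = p ∧ (inversions σ : ℤ) = i - 2 * (N + 2 : ℕ) + 2 * p + 3) ↔
      (((∃ f, Str0 N ((N - p) / 2) f (extN σ)) ∧ N = 2 * ((N - p) / 2) + p) ∧
        (inversions σ : ℤ) = i - 2 * (N + 2 : ℕ) + 2 * p + 3) := by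
    intro σ; rw [← mem0_iff hp1]; tauto
  have key1 : ∀ π : Equiv.Perm (Fin (N + 2)), ((∀ j, π (π j) = j) ∧ fixedPointCount π = p ∧
      (inversions π : ℤ) = i ∧ occ p132 π = 1) ↔
      (((∃ c, Str1 (N + 2) ((N - p) / 2) c (extN π)) ∧ N = 2 * ((N - p) / 2) + p) ∧
        (inversions π : ℤ) = i) := by
    intro π; rw [← mem1_iff]; tauto
  generalize (N - p) / 2 = t at key0 key1
  refine card_nbij' (downP N t) (upP N t) ?_ ?_ ?_ ?_
  · intro π hπ
    rw [mem_coe, mem_filter, key1] at hπ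
    rw [mem_coe, mem_filter, key0]
    obtain ⟨-, ⟨⟨c, h⟩, h2⟩, h3⟩ := hπ
    have hs := (down_str0 h).congr (extN_down h)
    have := inversions_upP hs
    rw [upP_downP h] at this
    refine ⟨mem_univ _, ⟨⟨_, hs⟩, h2⟩, ?_⟩
    omega
  · intro σ hσ
    rw [mem_coe, mem_filter, key0] at hσ
    rw [mem_coe, mem_filter, key1]
    obtain ⟨-, ⟨⟨f, h⟩, h2⟩, h3⟩ := hσ
    have := inversions_upP h
    refine ⟨mem_univ _, ⟨⟨_, (up_str1 h).congr (extN_up h)⟩, h2⟩, ?_⟩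
    omega
  · intro π hπ
    rw [mem_coe, mem_filter, key1] at hπ
    obtain ⟨-, ⟨⟨c, h⟩, h2⟩, h3⟩ := hπ
    exact upP_downP h
  · intro σ hσ
    rw [mem_coe, mem_filter, key0] at hσ
    obtain ⟨-, ⟨⟨f, h⟩, h2⟩, h3⟩ := hσ
    exact downP_upP h
end

section
/- For every n ≥ 5, the number of even involutions of length n containing the pattern 132 exactly once equals C(n−3, 1+2⌊(n−5)/4⌋), where C denotes the binomial coefficient. -/
open Finset

/-- `(i, j, k)` is an occurrence of `132` in `π`. -/
def Tri {n : ℕ} (π : Equiv.Perm (Fin n)) (i j k : Fin n) : Prop :=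
  i < j ∧ j < k ∧ π i < π k ∧ π k < π j

/-- There is exactly one occurrence of `132`. -/
def Once {n : ℕ} (π : Equiv.Perm (Fin n)) : Prop :=
  ∃ i j k, Tri π i j k ∧ ∀ i' j' k', Tri π i' j' k' → i' = i ∧ j' = j ∧ k' = k

/-- The values `≥ a` appear in increasing order. -/
def Cond {n : ℕ} (π : Equiv.Perm (Fin n)) (a : ℕ) : Prop :=
  ∀ i j : Fin n, i < j → a ≤ (π i).val → a ≤ (π j).val → π i < π j

theorem sign_eq_inversions {n : ℕ} (π : Equiv.Perm (Fin n)) :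
    Equiv.Perm.sign π = (-1) ^ inversions π := by
  rw [Equiv.Perm.sign_eq_prod_prod_Ioi, Finset.prod_sigma']
  have h : ∀ x ∈ (Finset.univ.sigma fun i : Fin n => Finset.Ioi i),
      (if π x.1 < π x.2 then (1 : ℤˣ) else -1) = if π x.2 < π x.1 then -1 else 1 := by
    rintro ⟨i, j⟩ hx
    simp only [Finset.mem_sigma, Finset.mem_univ, Finset.mem_Ioi, true_and] at hx
    have : π i ≠ π j := fun h => hx.ne (π.injective h)
    rcases lt_or_gt_of_ne this with h | h
    · simp [h, h.le]
    · simp [h, h.le]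
  rw [Finset.prod_congr rfl h, Finset.prod_ite, Finset.prod_const, Finset.prod_const_one, mul_one]
  congr 1
  unfold inversions
  refine Finset.card_bij (fun x _ => (x.1, x.2)) ?_ ?_ ?_
  · rintro ⟨i, j⟩ h
    simpa using h
  · rintro ⟨i, j⟩ _ ⟨i', j'⟩ _ h
    simp at h
    simp [h]
  · rintro ⟨i, j⟩ h
    exact ⟨⟨i, j⟩, by simpa using h, rfl⟩

theorem even_inversions_iff {n : ℕ} (π : Equiv.Perm (Fin n)) :
    Even (inversions π) ↔ Equiv.Perm.sign π = 1 := by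
  rw [sign_eq_inversions]
  exact (neg_one_pow_eq_one_iff_even (by decide)).symm

theorem pat_iff {n : ℕ} (π : Equiv.Perm (Fin n)) (f : Fin 3 → Fin n) :
    ((∀ a b : Fin 3, a < b → f a < f b) ∧
      (∀ a b : Fin 3, p132 a < p132 b ↔ π (f a) < π (f b))) ↔ Tri π (f 0) (f 1) (f 2) := by
  have e0 : p132 0 = 0 := by decide
  have e1 : p132 1 = 2 := by decide
  have e2 : p132 2 = 1 := by decide
  unfold Tri
  constructor
  · rintro ⟨h1, h2⟩
    refine ⟨h1 0 1 (by decide), h1 1 2 (by decide), (h2 0 2).1 (by decide), (h2 2 1).1 (by decide)⟩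
  · rintro ⟨h1, h2, h3, h4⟩
    constructor
    · intro a b hab
      fin_cases a <;> fin_cases b <;> simp at hab ⊢ <;> first | assumption | exact h1.trans h2
    · intro a b
      fin_cases a <;> fin_cases b <;> simp [e0, e1, e2, h3, h4, h3.le, h4.le, h3.trans h4, (h3.trans h4).le]

theorem occ_one_iff {n : ℕ} (π : Equiv.Perm (Fin n)) : occ p132 π = 1 ↔ Once π := by
  unfold occ Once
  rw [Finset.card_eq_one]
  constructor
  · rintro ⟨f, hf⟩
    have hf' : ∀ g : Fin 3 → Fin n, Tri π (g 0) (g 1) (g 2) ↔ g = f := by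
      intro g
      rw [← pat_iff, ← Finset.mem_singleton, ← hf, Finset.mem_filter]
      simp
    refine ⟨f 0, f 1, f 2, (hf' f).2 rfl, ?_⟩
    intro i j k h
    have := (hf' ![i, j, k]).1 (by simpa using h)
    rw [← this]
    simp
  · rintro ⟨i, j, k, h, hu⟩
    refine ⟨![i, j, k], ?_⟩
    ext f
    rw [Finset.mem_filter, pat_iff, Finset.mem_singleton]
    simp only [Finset.mem_univ, true_and]
    constructor
    · intro hf
      obtain ⟨h0, h1, h2⟩ := hu _ _ _ hf
      funext x
      fin_cases x <;> simp [h0, h1, h2]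
    · rintro rfl
      simpa using h

/-- The order embedding skipping `0` and `b + 1`. -/
def emb {n : ℕ} (b : Fin (n + 1)) : Fin n ↪ Fin (n + 2) where
  toFun i := ⟨if i.val < b.val then i.val + 1 else i.val + 2, by split_ifs <;> omega⟩
  inj' := by
    intro i j h
    simp only [Fin.mk.injEq] at h
    apply Fin.ext
    split_ifs at h <;> omega

theorem emb_val {n : ℕ} (b : Fin (n + 1)) (i : Fin n) :
    (emb b i).val = if i.val < b.val then i.val + 1 else i.val + 2 := rfl

theorem emb_lt {n : ℕ} (b : Fin (n + 1)) (i j : Fin n) : emb b i < emb b j ↔ i < j := by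
  rw [Fin.lt_def, Fin.lt_def, emb_val, emb_val]
  split_ifs <;> omega

theorem emb_ne_zero {n : ℕ} (b : Fin (n + 1)) (i : Fin n) : emb b i ≠ 0 := by
  rw [Ne, Fin.ext_iff, emb_val]
  split_ifs <;> simp

theorem emb_ne_succ {n : ℕ} (b : Fin (n + 1)) (i : Fin n) : emb b i ≠ b.succ := by
  rw [Ne, Fin.ext_iff, emb_val, Fin.val_succ]
  split_ifs <;> omega

theorem succ_lt_emb {n : ℕ} (b : Fin (n + 1)) (i : Fin n) : b.succ < emb b i ↔ b.val ≤ i.val := by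
  rw [Fin.lt_def, emb_val, Fin.val_succ]
  split_ifs <;> omega

theorem exists_emb {n : ℕ} (b : Fin (n + 1)) (x : Fin (n + 2)) (h0 : x ≠ 0) (h1 : x ≠ b.succ) :
    ∃ i, x = emb b i := by
  rw [Ne, Fin.ext_iff] at h0 h1
  simp only [Fin.val_zero, Fin.val_succ] at h0 h1
  by_cases h : x.val < b.val + 1
  · refine ⟨⟨x.val - 1, by omega⟩, Fin.ext ?_⟩
    rw [emb_val]
    simp only
    split_ifs <;> omega
  · refine ⟨⟨x.val - 2, by omega⟩, Fin.ext ?_⟩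
    rw [emb_val]
    simp only
    split_ifs <;> omega

/-- Insert the transposition `0 ↔ b + 1`. -/
def ins {n : ℕ} (b : Fin (n + 1)) (τ : Equiv.Perm (Fin n)) : Equiv.Perm (Fin (n + 2)) :=
  Equiv.swap 0 b.succ * τ.viaFintypeEmbedding (emb b)

theorem ins_emb {n : ℕ} (b : Fin (n + 1)) (τ : Equiv.Perm (Fin n)) (i : Fin n) :
    ins b τ (emb b i) = emb b (τ i) := by
  unfold ins
  rw [Equiv.Perm.mul_apply, Equiv.Perm.viaFintypeEmbedding_apply_image,
    Equiv.swap_apply_of_ne_of_ne (emb_ne_zero _ _) (emb_ne_succ _ _)]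

theorem ins_zero {n : ℕ} (b : Fin (n + 1)) (τ : Equiv.Perm (Fin n)) : ins b τ 0 = b.succ := by
  unfold ins
  rw [Equiv.Perm.mul_apply, Equiv.Perm.viaFintypeEmbedding_apply_notMem_range,
    Equiv.swap_apply_left]
  rintro ⟨i, hi⟩
  exact emb_ne_zero _ _ hi

theorem ins_succ {n : ℕ} (b : Fin (n + 1)) (τ : Equiv.Perm (Fin n)) : ins b τ b.succ = 0 := by
  unfold ins
  rw [Equiv.Perm.mul_apply, Equiv.Perm.viaFintypeEmbedding_apply_notMem_range,
    Equiv.swap_apply_right]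
  rintro ⟨i, hi⟩
  exact emb_ne_succ _ _ hi

theorem sign_ins {n : ℕ} (b : Fin (n + 1)) (τ : Equiv.Perm (Fin n)) :
    Equiv.Perm.sign (ins b τ) = - Equiv.Perm.sign τ := by
  unfold ins
  rw [Equiv.Perm.sign_mul, Equiv.Perm.viaFintypeEmbedding_sign,
    Equiv.Perm.sign_swap (Fin.succ_ne_zero b).symm]
  simp

theorem ins_injective {n : ℕ} (b : Fin (n + 1)) : Function.Injective (ins b) := by
  intro τ τ' h
  ext1 i
  have := congrArg (fun π => π (emb b i)) h
  simp only [ins_emb] at this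
  exact (emb b).injective this

theorem cases_emb {n : ℕ} (b : Fin (n + 1)) (x : Fin (n + 2)) :
    x = 0 ∨ x = b.succ ∨ ∃ i, x = emb b i := by
  by_cases h0 : x = 0
  · exact Or.inl h0
  · by_cases h1 : x = b.succ
    · exact Or.inr (Or.inl h1)
    · exact Or.inr (Or.inr (exists_emb b x h0 h1))

theorem ins_invol {n : ℕ} (b : Fin (n + 1)) (τ : Equiv.Perm (Fin n)) :
    (∀ i, ins b τ (ins b τ i) = i) ↔ ∀ i, τ (τ i) = i := by
  constructor
  · intro h i
    have := h (emb b i)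
    rw [ins_emb, ins_emb] at this
    exact (emb b).injective this
  · intro h x
    rcases cases_emb b x with rfl | rfl | ⟨i, rfl⟩
    · rw [ins_zero, ins_succ]
    · rw [ins_succ, ins_zero]
    · rw [ins_emb, ins_emb, h]

theorem exists_ins {n : ℕ} (b : Fin (n + 1)) (π : Equiv.Perm (Fin (n + 2)))
    (hπ : ∀ i, π (π i) = i) (h0 : π 0 = b.succ) : ∃ τ, ins b τ = π := by
  have h1 : π b.succ = 0 := by rw [← h0, hπ]
  have hex : ∀ i, ∃ j, π (emb b i) = emb b j := by
    intro i
    apply exists_emb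
    · intro h
      rw [← h1] at h
      exact emb_ne_succ _ _ (π.injective h)
    · intro h
      rw [← h0] at h
      exact emb_ne_zero _ _ (π.injective h)
  choose f hf using hex
  have hinv : Function.Involutive f := by
    intro i
    apply (emb b).injective
    rw [← hf, ← hf, hπ]
  refine ⟨hinv.toPerm f, ?_⟩
  ext1 x
  rcases cases_emb b x with rfl | rfl | ⟨i, rfl⟩
  · rw [ins_zero, h0]
  · rw [ins_succ, h1]
  · rw [ins_emb, hf]
    rfl

theorem tri_emb {n : ℕ} (b : Fin (n + 1)) (τ : Equiv.Perm (Fin n)) (i j k : Fin n) :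
    Tri (ins b τ) (emb b i) (emb b j) (emb b k) ↔ Tri τ i j k := by
  unfold Tri
  simp only [ins_emb, emb_lt]

theorem tri_ins {n : ℕ} (b : Fin (n + 1)) (τ : Equiv.Perm (Fin n)) (hτ : ∀ i, τ (τ i) = i)
    (hc : Cond τ b.val) (x y z : Fin (n + 2)) (h : Tri (ins b τ) x y z) :
    ∃ i j k, x = emb b i ∧ y = emb b j ∧ z = emb b k ∧ Tri τ i j k := by
  have h' := h
  obtain ⟨hxy, hyz, h1, h2⟩ := h
  have hy : ∃ j, y = emb b j := by
    apply exists_emb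
    · rintro rfl
      exact absurd hxy (Fin.not_lt_zero _)
    · rintro rfl
      rw [ins_succ] at h2
      exact absurd h2 (Fin.not_lt_zero _)
  have hz : ∃ j, z = emb b j := by
    apply exists_emb
    · rintro rfl
      exact absurd hyz (Fin.not_lt_zero _)
    · rintro rfl
      rw [ins_succ] at h1
      exact absurd h1 (Fin.not_lt_zero _)
  obtain ⟨j, rfl⟩ := hy
  obtain ⟨k, rfl⟩ := hz
  rw [ins_emb] at h1
  rw [ins_emb, ins_emb, emb_lt] at h2
  rw [emb_lt] at hyz
  rcases cases_emb b x with rfl | rfl | ⟨i, rfl⟩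
  · exfalso
    rw [ins_zero, succ_lt_emb] at h1
    have := hc j k hyz (h1.trans (Fin.lt_def.1 h2).le) h1
    exact absurd this h2.not_gt
  · exfalso
    rw [succ_lt_emb] at hxy
    have := hc (τ k) (τ j) h2 (by rw [hτ]; exact hxy.trans (Fin.lt_def.1 hyz).le)
      (by rw [hτ]; exact hxy)
    rw [hτ, hτ] at this
    exact absurd this hyz.not_gt
  · exact ⟨i, j, k, rfl, rfl, rfl, (tri_emb b τ i j k).1 h'⟩

theorem one_ins {n : ℕ} (b : Fin (n + 1)) (τ : Equiv.Perm (Fin n)) (hτ : ∀ i, τ (τ i) = i) :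
    Once (ins b τ) ↔ Once τ ∧ Cond τ b.val := by
  constructor
  · rintro ⟨x, y, z, h, hu⟩
    have hc : Cond τ b.val := by
      intro u v huv hu1 hv1
      by_contra hlt
      have hlt' : τ v < τ u := by
        refine lt_of_le_of_ne (not_lt.1 hlt) fun h => huv.ne' (τ.injective h)
      have t1 : Tri (ins b τ) 0 (emb b u) (emb b v) := by
        refine ⟨Fin.pos_iff_ne_zero.2 (emb_ne_zero _ _), (emb_lt _ _ _).2 huv, ?_, ?_⟩
        · rw [ins_zero, ins_emb, succ_lt_emb]
          exact hv1
        · rw [ins_emb, ins_emb, emb_lt]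
          exact hlt'
      have t2 : Tri (ins b τ) b.succ (emb b (τ v)) (emb b (τ u)) := by
        refine ⟨(succ_lt_emb _ _).2 hv1, (emb_lt _ _ _).2 hlt', ?_, ?_⟩
        · rw [ins_succ, ins_emb]
          exact Fin.pos_iff_ne_zero.2 (emb_ne_zero _ _)
        · rw [ins_emb, ins_emb, emb_lt, hτ, hτ]
          exact huv
      have e1 := (hu _ _ _ t1).1
      have e2 := (hu _ _ _ t2).1
      rw [← e1] at e2
      exact Fin.succ_ne_zero _ e2
    refine ⟨?_, hc⟩
    obtain ⟨i, j, k, rfl, rfl, rfl, ht⟩ := tri_ins b τ hτ hc x y z h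
    refine ⟨i, j, k, ht, ?_⟩
    intro i' j' k' ht'
    obtain ⟨h1, h2, h3⟩ := hu _ _ _ ((tri_emb b τ _ _ _).2 ht')
    exact ⟨(emb b).injective h1, (emb b).injective h2, (emb b).injective h3⟩
  · rintro ⟨⟨i, j, k, ht, hu⟩, hc⟩
    refine ⟨emb b i, emb b j, emb b k, (tri_emb b τ _ _ _).2 ht, ?_⟩
    intro x y z h
    obtain ⟨i', j', k', rfl, rfl, rfl, ht'⟩ := tri_ins b τ hτ hc x y z h
    obtain ⟨rfl, rfl, rfl⟩ := hu _ _ _ ht'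
    exact ⟨rfl, rfl, rfl⟩

theorem cond_ins {n : ℕ} (b : Fin (n + 1)) (τ : Equiv.Perm (Fin n)) (hτ : ∀ i, τ (τ i) = i)
    (hc : Cond τ b.val) (a : ℕ) : Cond (ins b τ) a ↔ b.val < a := by
  constructor
  · intro h
    by_contra hab
    have hv : ins b τ (ins b τ b.castSucc) = b.castSucc := (ins_invol b τ).2 hτ _
    have hne : ins b τ b.castSucc ≠ 0 := by
      intro h0
      rw [h0, ins_zero, Fin.ext_iff] at hv
      simp at hv
    have := h 0 (ins b τ b.castSucc) (Fin.pos_iff_ne_zero.2 hne)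
      (by rw [ins_zero, Fin.val_succ]; omega) (by rw [hv, Fin.val_castSucc]; omega)
    rw [hv, ins_zero, Fin.lt_def, Fin.val_succ, Fin.val_castSucc] at this
    omega
  · intro hab x y hxy hx hy
    have hy0 : ∃ j, y = emb b j := by
      apply exists_emb
      · rintro rfl
        exact absurd hxy (Fin.not_lt_zero _)
      · rintro rfl
        rw [ins_succ, Fin.val_zero] at hy
        omega
    obtain ⟨j, rfl⟩ := hy0
    rw [ins_emb] at hy ⊢
    have hj : b.val ≤ (τ j).val := by
      rw [emb_val] at hy
      split_ifs at hy <;> omega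
    rcases cases_emb b x with rfl | rfl | ⟨i, rfl⟩
    · rw [ins_zero, succ_lt_emb]
      exact hj
    · rw [ins_succ, Fin.val_zero] at hx
      omega
    · rw [ins_emb] at hx ⊢
      have hi : b.val ≤ (τ i).val := by
        rw [emb_val] at hx
        split_ifs at hx <;> omega
      rw [emb_lt] at hxy ⊢
      exact hc i j hxy hi hj

theorem base_unique {n : ℕ} (π : Equiv.Perm (Fin (n + 3))) (h0 : π 0 = 0) (h : Once π) :
    π = Equiv.swap 1 2 := by
  obtain ⟨i, j, k, ⟨hij, hjk, h1, h2⟩, hu⟩ := h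
  have key : ∀ x y, x < y → π y < π x → x = j ∧ y = k := by
    intro x y hxy hlt
    have hx : x ≠ 0 := by
      rintro rfl
      rw [h0] at hlt
      exact absurd hlt (Fin.not_lt_zero _)
    have hy : π y ≠ 0 := by
      intro h
      rw [← h0] at h
      have := π.injective h
      rw [this] at hxy
      exact absurd hxy (Fin.not_lt_zero _)
    have := hu 0 x y ⟨Fin.pos_iff_ne_zero.2 hx, hxy, by rw [h0]; exact Fin.pos_iff_ne_zero.2 hy, hlt⟩
    exact this.2
  have inj : ∀ x y, π x = π y → x = y := fun x y h => π.injective h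
  have hi0 : i = 0 := by
    have hx : j ≠ 0 := by
      rintro rfl
      exact absurd hij (Fin.not_lt_zero _)
    have := hu 0 j k ⟨Fin.pos_iff_ne_zero.2 hx, hjk, by
      rw [h0]; exact lt_of_le_of_lt (Fin.zero_le _) h1, h2⟩
    exact this.1.symm
  have v1 : ((1 : Fin (n + 3)) : ℕ) = 1 := rfl
  have v2 : ((2 : Fin (n + 3)) : ℕ) = 2 := rfl
  have hj : j = 1 := by
    by_contra hne
    have hj1 : (1 : Fin (n + 3)) < j := by
      rw [Fin.lt_def, v1]
      rw [Fin.lt_def] at hij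
      rw [Fin.ext_iff, v1] at hne
      omega
    rcases lt_trichotomy (π 1) (π k) with h | h | h
    · have := (hu 1 j k ⟨hj1, hjk, h, h2⟩).1
      rw [hi0, Fin.ext_iff, v1] at this
      simp at this
    · have := inj _ _ h
      rw [this] at hj1
      exact absurd hj1 hjk.not_gt
    · exact hne (key 1 k (hj1.trans hjk) h).1.symm
  subst hj
  have hk : k = 2 := by
    by_contra hne
    have hk2 : (2 : Fin (n + 3)) < k := by
      rw [Fin.lt_def, v2]
      rw [Fin.lt_def, v1] at hjk
      rw [Fin.ext_iff, v2] at hne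
      omega
    have h12 : (1 : Fin (n + 3)) < 2 := by rw [Fin.lt_def, v1, v2]; omega
    rcases lt_trichotomy (π 2) (π k) with h | h | h
    · exact hne (key 1 2 h12 (h.trans h2)).2.symm
    · exact hne (inj _ _ h).symm
    · exact h12.ne (key 2 k hk2 h).1.symm
  subst hk
  have mono : ∀ x y, x < y → ¬ (x = 1 ∧ y = 2) → π x < π y := by
    intro x y hxy hn
    rcases lt_trichotomy (π x) (π y) with h | h | h
    · exact h
    · exact absurd (inj _ _ h) hxy.ne
    · exact absurd (key x y hxy h) hn
  have hs : StrictMono (π * Equiv.swap 1 2 : Equiv.Perm (Fin (n + 3))) := by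
    intro x y hxy
    rw [Equiv.Perm.mul_apply, Equiv.Perm.mul_apply, Equiv.swap_apply_def, Equiv.swap_apply_def]
    simp only [Fin.lt_def, Fin.ext_iff, v1, v2] at hxy mono h2 ⊢
    split_ifs with a1 a2 a3 a4 a5 a6 a7 a8 <;>
      first | omega | exact h2 | (apply mono <;> (try simp only [v1, v2]) <;> omega)
  have hid : (π * Equiv.swap 1 2 : Equiv.Perm (Fin (n + 3))) = 1 := by
    ext1 x
    have := congrArg (fun f : Fin (n + 3) ≃o Fin (n + 3) => f x)
      (Subsingleton.elim (hs.orderIsoOfSurjective _ (Equiv.surjective _)) (OrderIso.refl _))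
    exact this
  rw [mul_eq_one_iff_eq_inv] at hid
  rw [hid, Equiv.swap_inv]

theorem base_once (n : ℕ) : Once (Equiv.swap 1 2 : Equiv.Perm (Fin (n + 3))) := by
  have v1 : ((1 : Fin (n + 3)) : ℕ) = 1 := rfl
  have v2 : ((2 : Fin (n + 3)) : ℕ) = 2 := rfl
  refine ⟨0, 1, 2, ⟨?_, ?_, ?_, ?_⟩, ?_⟩
  · rw [Fin.lt_def, v1]; simp
  · rw [Fin.lt_def, v1, v2]; omega
  · rw [Equiv.swap_apply_right, Equiv.swap_apply_of_ne_of_ne]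
    · rw [Fin.lt_def, v1]; simp
    · rw [Ne, Fin.ext_iff, v1]; simp
    · rw [Ne, Fin.ext_iff, v2]; simp
  · rw [Equiv.swap_apply_right, Equiv.swap_apply_left, Fin.lt_def, v1, v2]; omega
  · rintro i j k ⟨h1, h2, h3, h4⟩
    rw [Equiv.swap_apply_def, Equiv.swap_apply_def] at h3 h4
    simp only [Fin.lt_def, Fin.ext_iff, v1, v2, apply_ite Fin.val, Fin.val_zero] at *
    split_ifs at h3 h4 <;> omega

theorem base_cond (n a : ℕ) : Cond (Equiv.swap 1 2 : Equiv.Perm (Fin (n + 3))) a ↔ 2 ≤ a := by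
  have v1 : ((1 : Fin (n + 3)) : ℕ) = 1 := rfl
  have v2 : ((2 : Fin (n + 3)) : ℕ) = 2 := rfl
  constructor
  · intro h
    by_contra ha
    have := h 1 2 (by rw [Fin.lt_def, v1, v2]; omega)
    rw [Equiv.swap_apply_right, Equiv.swap_apply_left, Fin.lt_def, v1, v2] at this
    omega
  · intro ha i j hij hi hj
    rw [Equiv.swap_apply_def] at hi hj ⊢
    rw [Equiv.swap_apply_def]
    simp only [Fin.lt_def, Fin.ext_iff, v1, v2, apply_ite Fin.val] at *
    split_ifs at * <;> omega

theorem base_sign (n : ℕ) : Equiv.Perm.sign (Equiv.swap 1 2 : Equiv.Perm (Fin (n + 3))) = -1 := by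
  apply Equiv.Perm.sign_swap
  have v1 : ((1 : Fin (n + 3)) : ℕ) = 1 := rfl
  have v2 : ((2 : Fin (n + 3)) : ℕ) = 2 := rfl
  rw [Ne, Fin.ext_iff, v1, v2]
  omega

theorem not_once_small {n : ℕ} (hn : n < 3) (π : Equiv.Perm (Fin n)) : ¬ Once π := by
  rintro ⟨i, j, k, ⟨h1, h2, _, _⟩, _⟩
  rw [Fin.lt_def] at h1 h2
  omega

open Classical in
/-- The number of involutions of sign `p` with one `132`, with values `≥ a` increasing. -/
noncomputable def cnt (n : ℕ) (p : ℤˣ) (a : ℕ) : ℕ :=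
  (Finset.univ.filter (fun π : Equiv.Perm (Fin n) =>
    (∀ i, π (π i) = i) ∧ Once π ∧ Equiv.Perm.sign π = p ∧ Cond π a)).card

theorem cnt_small {n : ℕ} (hn : n < 3) (p : ℤˣ) (a : ℕ) : cnt n p a = 0 := by
  classical
  unfold cnt
  rw [Finset.card_eq_zero, Finset.filter_eq_empty_iff]
  rintro π _ ⟨_, h, _⟩
  exact not_once_small hn π h

theorem cnt_rec (n : ℕ) (p : ℤˣ) (a : ℕ) :
    cnt (n + 2) p a = (if 1 ≤ n ∧ 2 ≤ a ∧ p = -1 then 1 else 0) +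
      ∑ b ∈ Finset.range (n + 1), if b < a then cnt n (-p) b else 0 := by
  classical
  rw [cnt, Finset.card_eq_sum_card_fiberwise (f := fun π => π 0) (t := Finset.univ)
    (fun _ _ => Finset.mem_coe.2 (Finset.mem_univ _)), Fin.sum_univ_succ]
  congr 1
  · rcases n with _ | n
    · rw [if_neg (by simp), Finset.card_eq_zero, Finset.filter_eq_empty_iff]
      intro π hπ
      rw [Finset.mem_filter] at hπ
      exact absurd hπ.2.2.1 (not_once_small (by omega) π)
    · split_ifs with h
      · rw [Finset.card_eq_one]
        refine ⟨Equiv.swap 1 2, ?_⟩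
        ext π
        rw [Finset.mem_filter, Finset.mem_filter, Finset.mem_singleton]
        constructor
        · rintro ⟨⟨_, _, ho, _, _⟩, h0⟩
          exact base_unique π h0 ho
        · rintro rfl
          refine ⟨⟨Finset.mem_univ _, fun i => Equiv.swap_apply_self _ _ _, base_once n, ?_,
            (base_cond n a).2 h.2.1⟩, ?_⟩
          · rw [base_sign, h.2.2]
          · apply Equiv.swap_apply_of_ne_of_ne
            · rw [Ne, Fin.ext_iff]
              exact Nat.zero_ne_one
            · rw [Ne, Fin.ext_iff]
              exact (by decide : (0 : ℕ) ≠ 2)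
      · rw [Finset.card_eq_zero, Finset.filter_eq_empty_iff]
        intro π hπ h0
        rw [Finset.mem_filter] at hπ
        obtain ⟨_, _, ho, hs, hc⟩ := hπ
        have := base_unique π h0 ho
        subst this
        rw [base_cond] at hc
        rw [base_sign] at hs
        exact h ⟨by omega, hc, hs.symm⟩
  · rw [← Fin.sum_univ_eq_sum_range (fun b => if b < a then cnt n (-p) b else 0) (n + 1)]
    apply Finset.sum_congr rfl
    intro b _
    split_ifs with hb
    · unfold cnt
      symm
      refine Finset.card_bij (fun τ _ => ins b τ) ?_ ?_ ?_
      · intro τ hτ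
        simp only [Finset.mem_filter, Finset.mem_univ, true_and] at hτ ⊢
        obtain ⟨h1, h2, h3, h4⟩ := hτ
        refine ⟨⟨(ins_invol b τ).2 h1, (one_ins b τ h1).2 ⟨h2, h4⟩, ?_,
          (cond_ins b τ h1 h4 a).2 hb⟩, ins_zero b τ⟩
        rw [sign_ins, h3, neg_neg]
      · intro τ _ τ' _ h
        exact ins_injective b h
      · intro π hπ
        simp only [Finset.mem_filter, Finset.mem_univ, true_and] at hπ
        obtain ⟨⟨h1, h2, h3, h4⟩, h0⟩ := hπ
        obtain ⟨τ, rfl⟩ := exists_ins b π h1 h0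
        rw [ins_invol] at h1
        rw [one_ins b τ h1] at h2
        refine ⟨τ, ?_, rfl⟩
        simp only [Finset.mem_filter, Finset.mem_univ, true_and]
        refine ⟨h1, h2.1, ?_, h2.2⟩
        rw [← h3, sign_ins, neg_neg]
    · rw [Finset.card_eq_zero, Finset.filter_eq_empty_iff]
      intro π hπ h0
      simp only [Finset.mem_filter, Finset.mem_univ, true_and] at hπ
      obtain ⟨h1, h2, h3, h4⟩ := hπ
      obtain ⟨τ, rfl⟩ := exists_ins b π h1 h0
      rw [ins_invol] at h1
      rw [one_ins b τ h1] at h2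
      exact hb ((cond_ins b τ h1 h2.2 a).1 h4)

/-- Numerical counts refined by (number of transpositions minus one) `m`. -/
def fN : ℕ → ℕ → ℕ → ℕ
  | 0, n, a => if 3 ≤ n ∧ 2 ≤ a then 1 else 0
  | _ + 1, 0, _ => 0
  | _ + 1, 1, _ => 0
  | m + 1, n + 2, a => ∑ b ∈ Finset.range (n + 1), if b < a then fN m n b else 0

theorem fN_zero (n a : ℕ) : fN 0 n a = if 3 ≤ n ∧ 2 ≤ a then 1 else 0 := by
  rw [fN]

theorem fN_rec (m n a : ℕ) : fN (m + 1) (n + 2) a =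
    ∑ b ∈ Finset.range (n + 1), if b < a then fN m n b else 0 := by
  rw [fN]

theorem fN_n_small (m : ℕ) : ∀ n a, n < 2 * m + 3 → fN m n a = 0 := by
  induction m with
  | zero =>
    intro n a h
    rw [fN_zero, if_neg (by omega)]
  | succ m ih =>
    intro n a h
    match n, h with
    | 0, _ => rw [fN]
    | 1, _ => rw [fN]
    | n + 2, h =>
      rw [fN_rec]
      apply Finset.sum_eq_zero
      intro b _
      rw [ih n b (by omega)]
      simp

theorem fN_a_small (m : ℕ) : ∀ n a, a < 2 → fN m n a = 0 := by
  induction m with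
  | zero =>
    intro n a h
    rw [fN_zero, if_neg (by omega)]
  | succ m ih =>
    intro n a h
    match n with
    | 0 => rw [fN]
    | 1 => rw [fN]
    | n + 2 =>
      rw [fN_rec]
      apply Finset.sum_eq_zero
      intro b _
      split_ifs with hb
      · exact ih n b (by omega)
      · rfl

theorem fN_two (m n : ℕ) : fN (m + 1) n 2 = 0 := by
  match n with
  | 0 => rw [fN]
  | 1 => rw [fN]
  | n + 2 =>
    rw [fN_rec]
    apply Finset.sum_eq_zero
    intro b _
    split_ifs with hb
    · exact fN_a_small m n b hb
    · rfl

theorem fN_step (m n a : ℕ) (ha : a ≤ n) :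
    fN (m + 1) (n + 2) (a + 1) = fN (m + 1) (n + 2) a + fN m n a := by
  rw [fN_rec, fN_rec]
  have h : ∀ b ∈ Finset.range (n + 1), (if b < a + 1 then fN m n b else 0) =
      (if b < a then fN m n b else 0) + (if b = a then fN m n b else 0) := by
    intro b _
    split_ifs <;> omega
  rw [Finset.sum_congr rfl h, Finset.sum_add_distrib, Finset.sum_ite_eq',
    if_pos (Finset.mem_range.2 (by omega))]

theorem fN_cap (m n : ℕ) (hn : 2 ≤ n) : fN m (n + 1) (n + 1) = fN m (n + 1) n := by
  cases m with
  | zero =>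
    rw [fN_zero, fN_zero]
    congr 1
    simp only [eq_iff_iff]
    omega
  | succ m =>
    obtain ⟨k, rfl⟩ : ∃ k, n = k + 1 := ⟨n - 1, by omega⟩
    rw [fN_rec, fN_rec]
    apply Finset.sum_congr rfl
    intro b hb
    rw [Finset.mem_range] at hb
    rw [if_pos (by omega), if_pos (by omega)]

/-- `C(z, m - r)` with value `0` when `m < r`. -/
def ch (z m r : ℕ) : ℕ := if r ≤ m then z.choose (m - r) else 0

theorem ch_pascal (z m r : ℕ) : ch (z + 1) m r = ch z m r + ch z m (r + 1) := by
  unfold ch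
  by_cases h : r + 1 ≤ m
  · obtain ⟨k, rfl⟩ : ∃ k, m = r + 1 + k := ⟨m - (r + 1), by omega⟩
    rw [if_pos (by omega), if_pos (by omega), if_pos (by omega)]
    rw [show r + 1 + k - r = k + 1 by omega, show r + 1 + k - (r + 1) = k by omega,
      Nat.choose_succ_succ']
    omega
  · by_cases h' : r ≤ m
    · rw [if_pos h', if_pos h', if_neg h, show m - r = 0 by omega]
      simp
    · rw [if_neg h', if_neg h', if_neg h]

theorem ch_succ (z m r : ℕ) : ch z (m + 1) (r + 1) = ch z m r := by
  unfold ch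
  simp only [Nat.add_le_add_iff_right, Nat.add_sub_add_right]

theorem fN_closed (m : ℕ) : ∀ z d, 2 * m ≤ z + d →
    fN m (z + d + 3) (z + 2) + ch z m (d + 2) = ch z m 0 := by
  induction m with
  | zero =>
    intro z d _
    rw [fN_zero, if_pos (by omega)]
    simp [ch]
  | succ m ih =>
    intro z
    induction z with
    | zero =>
      intro d hd
      rw [fN_two]
      unfold ch
      rw [if_neg (by omega)]
      simp
    | succ z ihz =>
      intro d hd
      have h1 := ihz (d + 1) (by omega)
      have h2 := fN_step m (z + d + 2) (z + 2) (by omega)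
      rw [show z + 1 + d + 3 = z + d + 2 + 2 by omega, show z + 1 + 2 = z + 2 + 1 by omega, h2]
      rw [show z + (d + 1) + 3 = z + d + 2 + 2 by omega] at h1
      have p1 := ch_pascal z (m + 1) 0
      have p2 := ch_pascal z (m + 1) (d + 2)
      have e1 : ch z (m + 1) (0 + 1) = ch z m 0 := ch_succ z m 0
      have e2 : ch z (m + 1) (d + 2) = ch z m (d + 1) := ch_succ z m (d + 1)
      have e3 : d + 1 + 2 = d + 2 + 1 := by omega
      rw [e3] at h1
      rcases d with _ | d
      · obtain ⟨y, rfl⟩ : ∃ y, z = y + 1 := ⟨z - 1, by omega⟩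
        have h3 := ih y 0 (by omega)
        have h4 := fN_cap m (y + 2) (by omega)
        have p3 := ch_pascal y m 0
        have p4 := ch_pascal y m 1
        simp only [Nat.zero_add, Nat.add_zero] at *
        rw [show y + 1 + 2 = y + 2 + 1 by omega] at *
        rw [show y + 3 = y + 2 + 1 by omega] at *
        norm_num at *
        omega
      · have h3 := ih z d (by omega)
        rw [show z + d + 3 = z + (d + 1) + 2 by omega] at h3
        rw [show d + 1 + 1 = d + 2 by omega] at *
        omega

theorem cnt_eq (n : ℕ) : ∀ N p a, n ≤ N →
    cnt n p a = ∑ m ∈ Finset.range N, if p = (-1) ^ (m + 1) then fN m n a else 0 := by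
  induction n using Nat.strong_induction_on with
  | _ n ih =>
    intro N p a hN
    by_cases hn : n < 3
    · rw [cnt_small hn]
      symm
      apply Finset.sum_eq_zero
      intro m _
      rw [fN_n_small m n a (by omega)]
      simp
    · obtain ⟨k, rfl⟩ : ∃ k, n = k + 2 := ⟨n - 2, by omega⟩
      obtain ⟨M, rfl⟩ : ∃ M, N = M + 1 := ⟨N - 1, by omega⟩
      rw [cnt_rec, Finset.sum_range_succ' _ M, add_comm]
      congr 1
      · have h : ∀ m ∈ Finset.range M,
            (if p = (-1) ^ (m + 1 + 1) then fN (m + 1) (k + 2) a else 0) =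
            ∑ b ∈ Finset.range (k + 1), if b < a then
              (if -p = (-1) ^ (m + 1) then fN m k b else 0) else 0 := by
          intro m _
          have hp : p = (-1) ^ (m + 1 + 1) ↔ -p = (-1) ^ (m + 1) := by
            rw [pow_succ (-1 : ℤˣ) (m + 1), mul_neg_one, neg_eq_iff_eq_neg]
          rw [fN_rec]
          by_cases hc : -p = (-1) ^ (m + 1)
          · rw [if_pos (hp.2 hc)]
            simp only [if_pos hc]
          · rw [if_neg (fun h => hc (hp.1 h))]
            simp only [if_neg hc, ite_self, Finset.sum_const_zero]
        rw [Finset.sum_congr rfl h, Finset.sum_comm]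
        apply Finset.sum_congr rfl
        intro b _
        split_ifs with hb
        · exact ih k (by omega) M (-p) b (by omega)
        · simp
      · have hk : 1 ≤ k := by omega
        have hk' : 3 ≤ k + 2 := by omega
        rw [fN_zero, zero_add, pow_one]
        split_ifs <;> first | rfl | omega | tauto

theorem fN_total (m n : ℕ) (hn : 2 * m + 3 ≤ n) :
    fN m n n + ch (n - 3) m 2 = (n - 3).choose m := by
  obtain ⟨z, rfl⟩ : ∃ z, n = z + 3 := ⟨n - 3, by omega⟩
  have h := fN_closed m z 0 (by omega)
  have h2 := fN_cap m (z + 2) (by omega)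
  simp only [Nat.add_zero, Nat.zero_add] at h
  rw [show z + 3 = z + 2 + 1 by omega] at *
  rw [h2, show z + 2 + 1 - 3 = z by omega, h]
  simp [ch]

theorem odd_sum (n K : ℕ) (hn : 4 * K + 5 ≤ n) :
    ∑ j ∈ Finset.range (K + 1), fN (2 * j + 1) n n = (n - 3).choose (1 + 2 * K) := by
  induction K with
  | zero =>
    have := fN_total 1 n (by omega)
    simpa [ch] using this
  | succ K ih =>
    rw [Finset.sum_range_succ, ih (by omega)]
    have := fN_total (2 * (K + 1) + 1) n (by omega)
    unfold ch at this
    rw [if_pos (by omega), show 2 * (K + 1) + 1 - 2 = 1 + 2 * K by omega] at this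
    rw [add_comm, this, add_comm 1]

theorem sum_double (n L : ℕ) :
    ∑ m ∈ Finset.range (2 * L), (if (1 : ℤˣ) = (-1) ^ (m + 1) then fN m n n else 0) =
      ∑ j ∈ Finset.range L, fN (2 * j + 1) n n := by
  induction L with
  | zero => simp
  | succ L ih =>
    rw [show 2 * (L + 1) = 2 * L + 1 + 1 by omega, Finset.sum_range_succ, Finset.sum_range_succ,
      Finset.sum_range_succ, ih]
    have h1 : (-1 : ℤˣ) ^ (2 * L + 1) = -1 := Odd.neg_one_pow ⟨L, rfl⟩
    have h2 : (-1 : ℤˣ) ^ (2 * L + 1 + 1) = 1 := Even.neg_one_pow ⟨L + 1, by omega⟩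
    rw [h1, h2, if_neg (by decide), if_pos rfl]
    omega

theorem cnt_total (n : ℕ) (hn : 5 ≤ n) :
    cnt n 1 n = (n - 3).choose (1 + 2 * ((n - 5) / 4)) := by
  rw [cnt_eq n (2 * n) 1 n (by omega), sum_double, ← odd_sum n ((n - 5) / 4) (by omega)]
  symm
  apply Finset.sum_subset
  · intro x hx
    rw [Finset.mem_range] at *
    omega
  · intro x _ hx
    rw [Finset.mem_range] at hx
    exact fN_n_small _ _ _ (by omega)

/-- For every n ≥ 5, the number of even involutions of length n containing 132
exactly once equals C(n−3, 1+2⌊(n−5)/4⌋). -/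
theorem even_involutions_containing_132_once (n : ℕ) (hn : 5 ≤ n) :
    (Finset.univ.filter (fun π : Equiv.Perm (Fin n) =>
      (∀ i, π (π i) = i) ∧ occ p132 π = 1 ∧ Even (inversions π))).card
      = Nat.choose (n - 3) (1 + 2 * ((n - 5) / 4)) := by
  classical
  rw [← cnt_total n hn, cnt]
  apply congrArg Finset.card
  ext π
  rw [Finset.mem_filter, Finset.mem_filter, occ_one_iff, even_inversions_iff]
  constructor
  · rintro ⟨h, h1, h2, h3⟩
    refine ⟨h, h1, h2, h3, ?_⟩
    intro i j _ hi
    have := (π i).isLt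
    omega
  · rintro ⟨h, h1, h2, h3, _⟩
    exact ⟨h, h1, h2, h3⟩
end
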